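/- Suppose (i) σ = σ(t, x) does not depend on the control and is uniformly Lipschitz continuous in the path variable x (with respect to the uniform norm), and (ii) b = σλ where λ : [0,T] × C([0,T];ℝⁿ) × A → ℝ^d is bounded, continuous in a, and uniformly Lipschitz continuous in x. Then the closed-loop value is dominated by the open-loop value: V^c_0 ≤ V^o_0. -/

import Mathlib

open MeasureTheory ProbabilityTheory Filter Set Matrix
open scoped Classical

noncomputable section

/-- The σ-algebra generated by the `P`-null sets. -/
def nullSets {Ω : Type*} [MeasurableSpace Ω] (P : Measure Ω) : MeasurableSpace Ω :=
  MeasurableSpace.generateFrom {s : Set Ω | P s = 0}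

/-- The natural filtration of a process `u`. -/
def natFilt {Ω E : Type*} [MeasurableSpace E] (u : ℝ → Ω → E) (s : ℝ) :
    MeasurableSpace Ω :=
  ⨆ r ∈ Set.Icc (0 : ℝ) s, MeasurableSpace.comap (u r) inferInstance

/-- The `P`-augmented natural filtration of a process `u`. -/
def augFilt {Ω E : Type*} [MeasurableSpace Ω] [MeasurableSpace E] (P : Measure Ω)
    (u : ℝ → Ω → E) (s : ℝ) : MeasurableSpace Ω :=
  natFilt u s ⊔ nullSets P

/-- Progressive measurability of a process `u` with respect to a family of σ-algebras `F`. -/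
def ProgMeas {Ω E : Type*} [MeasurableSpace E] (F : ℝ → MeasurableSpace Ω)
    (u : ℝ → Ω → E) : Prop :=
  ∀ s : ℝ, 0 ≤ s →
    @Measurable (Set.Icc (0 : ℝ) s × Ω) E
      (MeasurableSpace.prod inferInstance (F s)) _ (fun p => u p.1 p.2)

/-- `B` is a `d`-dimensional `F`-Brownian motion under `P`: continuous paths started at `0`,
adapted, with increments that are centered Gaussian (with iid coordinates) and independent
of the past. -/
def IsBMd {Ω : Type*} [MeasurableSpace Ω] {d : ℕ} (P : Measure Ω)
    (F : ℝ → MeasurableSpace Ω) (B : ℝ → Ω → Fin d → ℝ) : Prop :=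
  (∀ ω, B 0 ω = 0) ∧ (∀ ω, Continuous fun s => B s ω) ∧
  (∀ s : ℝ, 0 ≤ s → Measurable[F s] (B s)) ∧
  (∀ s u : ℝ, 0 ≤ s → s < u →
    Measure.map (fun ω => B u ω - B s ω) P
      = Measure.pi (fun _ : Fin d => gaussianReal 0 ((u - s).toNNReal)) ∧
    Indep (MeasurableSpace.comap (fun ω => B u ω - B s ω) inferInstance) (F s) P)

/-- Left-endpoint Riemann sum of a matrix-valued integrand against a vector-valued
integrator, along the uniform partition of `[0, s]` with `N` steps. -/
def itoRiemannSum {Ω : Type*} {n d : ℕ} (H : ℝ → Ω → Matrix (Fin n) (Fin d) ℝ)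
    (B : ℝ → Ω → Fin d → ℝ) (s : ℝ) (N : ℕ) (ω : Ω) : Fin n → ℝ :=
  ∑ i ∈ Finset.range N,
    (H (s * i / N) ω).mulVec (B (s * (i + 1) / N) ω - B (s * i / N) ω)

/-- `I` is (a version of) the Itô integral `∫ H dB` on `[0, T]`: at each time in `[0, T]`
the left-endpoint Riemann sums converge in probability. -/
def IsItoIntegralOn {Ω : Type*} [MeasurableSpace Ω] {n d : ℕ} (P : Measure Ω) (T : ℝ)
    (H : ℝ → Ω → Matrix (Fin n) (Fin d) ℝ) (B : ℝ → Ω → Fin d → ℝ)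
    (I : ℝ → Ω → Fin n → ℝ) : Prop :=
  ∀ s ∈ Set.Icc (0 : ℝ) T,
    TendstoInMeasure P (fun N ω => itoRiemannSum H B s N ω) atTop (fun ω => I s ω)

/-- A weak solution of the controlled path-dependent SDE
`X_s = x₀ + ∫_0^s b(r, X, α_r) dr + ∫_0^s σ(r, X, α_r) dB_r` on `[0, T]`,
with controls valued in `A`. -/
structure SDEWeakSol {n d m : ℕ} (T : ℝ) (x₀ : Fin n → ℝ) (A : Set (Fin m → ℝ))
    (b : ℝ → (ℝ → Fin n → ℝ) → (Fin m → ℝ) → Fin n → ℝ)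
    (σ : ℝ → (ℝ → Fin n → ℝ) → (Fin m → ℝ) → Matrix (Fin n) (Fin d) ℝ) where
  Ω : Type
  mΩ : MeasurableSpace Ω
  P : @Measure Ω mΩ
  hP : IsProbabilityMeasure P
  F : ℝ → MeasurableSpace Ω
  F_mono : ∀ s u : ℝ, s ≤ u → F s ≤ F u
  F_le : ∀ s : ℝ, F s ≤ mΩ
  B : ℝ → Ω → Fin d → ℝ
  X : ℝ → Ω → Fin n → ℝ
  α : ℝ → Ω → Fin m → ℝ
  hB : @IsBMd Ω mΩ d P F B
  X_cont : ∀ ω, Continuous fun s => X s ω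
  X_prog : ProgMeas F X
  α_prog : ProgMeas F α
  α_mem : ∀ s ω, α s ω ∈ A
  sde : @IsItoIntegralOn Ω mΩ n d P T (fun s ω => σ s (fun u => X u ω) (α s ω)) B
    (fun s ω => X s ω - x₀ - ∫ r in Set.Icc (0 : ℝ) s, b r (fun u => X u ω) (α r ω))

attribute [instance] SDEWeakSol.mΩ

/-- Open-loop: the control is prog. measurable w.r.t. the `P`-augmented natural filtration
of `B`. -/
def SDEWeakSol.OpenLoop {n d m : ℕ} {T : ℝ} {x₀ : Fin n → ℝ} {A : Set (Fin m → ℝ)} {b}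
    {σ : ℝ → (ℝ → Fin n → ℝ) → (Fin m → ℝ) → Matrix (Fin n) (Fin d) ℝ}
    (S : SDEWeakSol T x₀ A b σ) : Prop :=
  ProgMeas (augFilt S.P S.B) S.α

/-- Closed-loop: the control is prog. measurable w.r.t. the `P`-augmented natural filtration
of `X`. -/
def SDEWeakSol.ClosedLoop {n d m : ℕ} {T : ℝ} {x₀ : Fin n → ℝ} {A : Set (Fin m → ℝ)} {b}
    {σ : ℝ → (ℝ → Fin n → ℝ) → (Fin m → ℝ) → Matrix (Fin n) (Fin d) ℝ}
    (S : SDEWeakSol T x₀ A b σ) : Prop :=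
  ProgMeas (augFilt S.P S.X) S.α

/-- The open-loop value `V^o_0`. -/
def Vopen {n d m : ℕ} (T : ℝ) (x₀ : Fin n → ℝ) (A : Set (Fin m → ℝ))
    (b : ℝ → (ℝ → Fin n → ℝ) → (Fin m → ℝ) → Fin n → ℝ)
    (σ : ℝ → (ℝ → Fin n → ℝ) → (Fin m → ℝ) → Matrix (Fin n) (Fin d) ℝ)
    (g : (ℝ → Fin n → ℝ) → ℝ) : ℝ :=
  sSup {r | ∃ S : SDEWeakSol T x₀ A b σ, S.OpenLoop ∧
    r = ∫ ω, g (fun s => S.X s ω) ∂S.P}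

/-- The closed-loop value `V^c_0`. -/
def Vclosed {n d m : ℕ} (T : ℝ) (x₀ : Fin n → ℝ) (A : Set (Fin m → ℝ))
    (b : ℝ → (ℝ → Fin n → ℝ) → (Fin m → ℝ) → Fin n → ℝ)
    (σ : ℝ → (ℝ → Fin n → ℝ) → (Fin m → ℝ) → Matrix (Fin n) (Fin d) ℝ)
    (g : (ℝ → Fin n → ℝ) → ℝ) : ℝ :=
  sSup {r | ∃ S : SDEWeakSol T x₀ A b σ, S.ClosedLoop ∧
    r = ∫ ω, g (fun s => S.X s ω) ∂S.P}

/-- A `d`-dimensional Brownian motion together with a monotone family of sub-σ-algebras. -/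
structure IsFilteredBM {Ω : Type*} [mΩ : MeasurableSpace Ω] {d : ℕ} (P : Measure Ω)
    (F : ℝ → MeasurableSpace Ω) (B : ℝ → Ω → Fin d → ℝ) : Prop where
  mono : ∀ s u : ℝ, s ≤ u → F s ≤ F u
  le : ∀ s : ℝ, F s ≤ mΩ
  bm : IsBMd P F B

theorem lintegral_exp_dot_pi_gaussianReal {d : ℕ} (v : NNReal) (z : Fin d → ℝ) :
    ∫⁻ x, ENNReal.ofReal (Real.exp (∑ j, z j * x j))
        ∂(Measure.pi fun _ : Fin d => gaussianReal 0 v)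
      = ENNReal.ofReal (Real.exp (∑ j, z j ^ 2 * v / 2)) := by
  have hinteg : Integrable (fun x : Fin d → ℝ => ∏ j, Real.exp (z j * x j))
      (Measure.pi fun _ : Fin d => gaussianReal 0 v) :=
    Integrable.fintype_prod (f := fun j (y : ℝ) => Real.exp (z j * y))
      fun j => integrable_exp_mul_gaussianReal (z j)
  simp_rw [Real.exp_sum]
  rw [← ofReal_integral_eq_lintegral_ofReal hinteg
    (ae_of_all _ fun x => Finset.prod_nonneg fun j _ => (Real.exp_pos _).le),
    integral_fintype_prod_eq_prod (fun j (y : ℝ) => Real.exp (z j * y))]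
  congr 1
  refine Finset.prod_congr rfl fun j _ => ?_
  have := congrFun (mgf_id_gaussianReal (μ := 0) (v := v)) (z j)
  simp only [mgf, id] at this
  rw [this]; congr 1; ring

namespace IsFilteredBM

variable {Ω : Type*} [mΩ : MeasurableSpace Ω] {d : ℕ} {P : Measure Ω}
    {F : ℝ → MeasurableSpace Ω} {B : ℝ → Ω → Fin d → ℝ}

theorem measurable_adapted (h : IsFilteredBM P F B) {s t : ℝ} (hs : 0 ≤ s) (hst : s ≤ t) :
    Measurable[F t] (B s) :=
  (h.bm.2.2.1 s hs).mono (h.mono s t hst) le_rfl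

theorem measurable (h : IsFilteredBM P F B) {s : ℝ} (hs : 0 ≤ s) : Measurable (B s) :=
  (h.bm.2.2.1 s hs).mono (h.le s) le_rfl

theorem measurable_incr (h : IsFilteredBM P F B) {s u : ℝ} (hs : 0 ≤ s) (hu : 0 ≤ u) :
    Measurable (fun ω => B u ω - B s ω) :=
  (h.measurable hu).sub (h.measurable hs)

theorem measurable_incr_coord (h : IsFilteredBM P F B) {s u : ℝ} (hs : 0 ≤ s) (hu : 0 ≤ u)
    (j : Fin d) : Measurable (fun ω => B u ω j - B s ω j) :=
  ((measurable_pi_apply j).comp (h.measurable hu)).sub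
    ((measurable_pi_apply j).comp (h.measurable hs))

theorem indepFun_incr (h : IsFilteredBM P F B) {s u : ℝ} (hs : 0 ≤ s) (hsu : s < u)
    {E : Type*} [MeasurableSpace E] {η : Ω → E} (hη : Measurable[F s] η) :
    IndepFun η (fun ω => B u ω - B s ω) P := by
  have h1 := (h.bm.2.2.2 s u hs hsu).2
  rw [IndepFun_iff_Indep]
  exact (indep_of_indep_of_le_right h1 hη.comap_le).symm

/-- The one-step exponential identity. -/
theorem lintegral_exp_step [IsProbabilityMeasure P] (h : IsFilteredBM P F B) {s u : ℝ}
    (hs : 0 ≤ s) (hsu : s < u)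
    {η : Ω → ENNReal} (hη : Measurable[F s] η) {ψ : Ω → Fin d → ℝ} (hψ : Measurable[F s] ψ) :
    ∫⁻ ω, η ω * ENNReal.ofReal (Real.exp (∑ j, ψ ω j * (B u ω j - B s ω j)
        - ∑ j, ψ ω j ^ 2 * (u - s) / 2)) ∂P = ∫⁻ ω, η ω ∂P := by
  have hind := h.indepFun_incr hs hsu (hη.prodMk hψ)
  have hm1 : Measurable (fun ω => (η ω, ψ ω)) := (hη.prodMk hψ).mono (h.le s) le_rfl
  have hm2 := h.measurable_incr hs (hs.trans hsu.le)
  have hmap := (indepFun_iff_map_prod_eq_prod_map_map hm1.aemeasurable hm2.aemeasurable).1 hind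
  rw [(h.bm.2.2.2 s u hs hsu).1] at hmap
  let G : (ENNReal × (Fin d → ℝ)) × (Fin d → ℝ) → ENNReal := fun q =>
    q.1.1 * ENNReal.ofReal (Real.exp (∑ j, q.1.2 j * q.2 j - ∑ j, q.1.2 j ^ 2 * (u - s) / 2))
  have hG : Measurable G := by fun_prop
  have e1 : ∫⁻ ω, η ω * ENNReal.ofReal (Real.exp (∑ j, ψ ω j * (B u ω j - B s ω j)
        - ∑ j, ψ ω j ^ 2 * (u - s) / 2)) ∂P
      = ∫⁻ q, G q ∂(Measure.map (fun ω => ((η ω, ψ ω), B u ω - B s ω)) P) := by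
    rw [lintegral_map hG (hm1.prodMk hm2)]
    rfl
  rw [e1, hmap, lintegral_prod _ hG.aemeasurable, lintegral_map (hG.lintegral_prod_right') hm1]
  refine lintegral_congr fun ω => ?_
  simp only [G]
  rw [lintegral_const_mul _ (by fun_prop)]
  have : ∀ y : Fin d → ℝ, ENNReal.ofReal (Real.exp (∑ j, ψ ω j * y j
      - ∑ j, ψ ω j ^ 2 * (u - s) / 2)) = ENNReal.ofReal (Real.exp (∑ j, ψ ω j * y j))
      * ENNReal.ofReal (Real.exp (-∑ j, ψ ω j ^ 2 * (u - s) / 2)) := fun y => by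
    rw [← ENNReal.ofReal_mul (Real.exp_pos _).le, ← Real.exp_add, sub_eq_add_neg]
  simp_rw [this]
  rw [lintegral_mul_const _ (by fun_prop), lintegral_exp_dot_pi_gaussianReal,
    ← ENNReal.ofReal_mul (Real.exp_pos _).le, ← Real.exp_add,
    Real.coe_toNNReal _ (sub_nonneg.2 hsu.le)]
  simp

theorem map_incr_coord (h : IsFilteredBM P F B) {s u : ℝ} (hs : 0 ≤ s) (hsu : s < u)
    (j : Fin d) :
    Measure.map (fun ω => B u ω j - B s ω j) P = gaussianReal 0 (u - s).toNNReal := by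
  have hm2 := h.measurable_incr hs (hs.trans hsu.le)
  have := (measurePreserving_eval (fun _ : Fin d => gaussianReal 0 (u - s).toNNReal) j).map_eq
  rw [← this, ← (h.bm.2.2.2 s u hs hsu).1, Measure.map_map (measurable_pi_apply j) hm2]
  rfl

theorem memLp_incr (h : IsFilteredBM P F B) {s u : ℝ} (hs : 0 ≤ s) (hsu : s ≤ u)
    (j : Fin d) : MemLp (fun ω => B u ω j - B s ω j) 2 P := by
  rcases hsu.eq_or_lt with rfl | hsu
  · simp
  have h1 := h.map_incr_coord hs hsu j
  have h2 : MemLp id 2 (Measure.map (fun ω => B u ω j - B s ω j) P) := by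
    rw [h1]; exact memLp_id_gaussianReal 2
  exact h2.comp_of_map (h.measurable_incr_coord hs (hs.trans hsu.le) j).aemeasurable

theorem integral_incr (h : IsFilteredBM P F B) {s u : ℝ} (hs : 0 ≤ s) (hsu : s ≤ u)
    (j : Fin d) : ∫ ω, (B u ω j - B s ω j) ∂P = 0 := by
  rcases hsu.eq_or_lt with rfl | hsu
  · simp
  have h1 := h.map_incr_coord hs hsu j
  have := integral_map (μ := P) (φ := fun ω => B u ω j - B s ω j)
    (h.measurable_incr_coord hs (hs.trans hsu.le) j).aemeasurable
    (f := id) aestronglyMeasurable_id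
  rw [h1] at this
  simpa using this.symm.trans (integral_id_gaussianReal)

theorem integral_incr_sq (h : IsFilteredBM P F B) {s u : ℝ} (hs : 0 ≤ s) (hsu : s ≤ u)
    (j : Fin d) : ∫ ω, (B u ω j - B s ω j) * (B u ω j - B s ω j) ∂P = u - s := by
  rcases hsu.eq_or_lt with rfl | hsu
  · simp
  have h1 := h.map_incr_coord hs hsu j
  have := integral_map (μ := P) (φ := fun ω => B u ω j - B s ω j)
    (h.measurable_incr_coord hs (hs.trans hsu.le) j).aemeasurable
    (f := fun x : ℝ => x * x) (by fun_prop)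
  rw [h1] at this
  rw [← this]
  have hv := variance_fun_id_gaussianReal (μ := 0) (v := (u - s).toNNReal)
  rw [variance_eq_integral (by fun_prop)] at hv
  simp only [integral_id_gaussianReal, sub_zero, Real.coe_toNNReal _ (sub_nonneg.2 hsu.le)] at hv
  exact (integral_congr_ae (ae_of_all _ fun x => (sq x).symm)).trans hv

theorem integral_incr_mul_of_ne (h : IsFilteredBM P F B) {s u : ℝ}
    (hs : 0 ≤ s) (hsu : s ≤ u) {j k : Fin d} (hjk : j ≠ k) :
    ∫ ω, (B u ω j - B s ω j) * (B u ω k - B s ω k) ∂P = 0 := by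
  rcases hsu.eq_or_lt with rfl | hsu
  · simp
  have hm2 := h.measurable_incr hs (hs.trans hsu.le)
  have := integral_map (μ := P) (φ := fun ω => B u ω - B s ω) hm2.aemeasurable
    (f := fun x : Fin d → ℝ => x j * x k) (by fun_prop)
  rw [(h.bm.2.2.2 s u hs hsu).1] at this
  refine this.symm.trans ?_
  have hI := (iIndepFun_pi (μ := fun _ : Fin d => gaussianReal 0 (u - s).toNNReal)
    (X := fun _ => id) (fun _ => aemeasurable_id)).indepFun hjk
  have := hI.integral_mul_eq_mul_integral
    (measurable_pi_apply j).aestronglyMeasurable (measurable_pi_apply k).aestronglyMeasurable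
  simp only [id, Pi.mul_apply] at this
  rw [this]
  have hz : ∫ x : Fin d → ℝ, x j ∂(Measure.pi fun _ : Fin d => gaussianReal 0 (u - s).toNNReal)
      = 0 := by
    have := (measurePreserving_eval (fun _ : Fin d => gaussianReal 0 (u - s).toNNReal) j).map_eq
    have h3 := integral_map (μ := Measure.pi fun _ : Fin d => gaussianReal 0 (u - s).toNNReal)
      (φ := Function.eval j) (measurable_pi_apply j).aemeasurable
      (f := id) aestronglyMeasurable_id
    rw [this] at h3
    simpa using h3.symm.trans integral_id_gaussianReal
  rw [hz, zero_mul]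

/-- Products of a past random variable with a function of an increment factor. -/
theorem integral_mul_incr [IsProbabilityMeasure P] (h : IsFilteredBM P F B) {s u : ℝ}
    (hs : 0 ≤ s) (hsu : s ≤ u) {η : Ω → ℝ} (hη : Measurable[F s] η) (j : Fin d) :
    ∫ ω, η ω * (B u ω j - B s ω j) ∂P = 0 := by
  rcases hsu.eq_or_lt with rfl | hsu'
  · simp
  have := ((h.indepFun_incr hs hsu' hη).comp (φ := id) (ψ := fun x : Fin d → ℝ => x j)
    measurable_id (measurable_pi_apply j)).integral_mul_eq_mul_integral
      (hη.mono (h.le s) le_rfl).aestronglyMeasurable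
      (h.measurable_incr_coord hs (hs.trans hsu) j).aestronglyMeasurable
  have h2 : ∫ ω, η ω * (B u ω j - B s ω j) ∂P = (∫ ω, η ω ∂P) * ∫ ω, (B u ω j - B s ω j) ∂P :=
    this
  rw [h2, h.integral_incr hs hsu, mul_zero]

theorem integral_mul_incr_mul_incr [IsProbabilityMeasure P] (h : IsFilteredBM P F B) {s u : ℝ}
    (hs : 0 ≤ s) (hsu : s ≤ u) {η : Ω → ℝ} (hη : Measurable[F s] η) (j k : Fin d) :
    ∫ ω, η ω * ((B u ω j - B s ω j) * (B u ω k - B s ω k)) ∂P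
      = (∫ ω, η ω ∂P) * (if j = k then u - s else 0) := by
  have e : (if j = k then u - s else 0)
      = ∫ ω, (B u ω j - B s ω j) * (B u ω k - B s ω k) ∂P := by
    split_ifs with hjk
    · subst hjk; exact (h.integral_incr_sq hs hsu j).symm
    · exact (h.integral_incr_mul_of_ne hs hsu hjk).symm
  rw [e]
  rcases hsu.eq_or_lt with rfl | hsu'
  · simp
  exact ((h.indepFun_incr hs hsu' hη).comp (φ := id) (ψ := fun x : Fin d → ℝ => x j * x k)
    measurable_id (by fun_prop)).integral_mul_eq_mul_integral
      (hη.mono (h.le s) le_rfl).aestronglyMeasurable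
      ((h.measurable_incr_coord hs (hs.trans hsu) j).mul
        (h.measurable_incr_coord hs (hs.trans hsu) k)).aestronglyMeasurable

end IsFilteredBM

/-- An elementary integrand `ξ 1_{(a, b]} e_j` paired with its stochastic integral. -/
def itoGen {Ω : Type*} {d : ℕ} (B : ℝ → Ω → Fin d → ℝ) (a b : ℝ) (j : Fin d) (ξ : Ω → ℝ) :
    (ℝ × Ω → EuclideanSpace ℝ (Fin d)) × (Ω → ℝ) :=
  (fun q => EuclideanSpace.single j ((Ioc a b).indicator (fun _ => ξ q.2) q.1),
    fun ω => ξ ω * (B b ω j - B a ω j))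

/-- Simple integrands paired with their stochastic integrals. -/
def simpleSpan {Ω : Type*} {d : ℕ} (F : ℝ → MeasurableSpace Ω) (B : ℝ → Ω → Fin d → ℝ) :
    Submodule ℝ ((ℝ × Ω → EuclideanSpace ℝ (Fin d)) × (Ω → ℝ)) :=
  Submodule.span ℝ {p | ∃ (a b : ℝ) (j : Fin d) (ξ : Ω → ℝ), 0 ≤ a ∧ a ≤ b ∧
    Measurable[F a] ξ ∧ (∃ C : ℝ, ∀ ω, |ξ ω| ≤ C) ∧ p = itoGen B a b j ξ}

section
variable {Ω : Type*} [mΩ : MeasurableSpace Ω] {P : Measure Ω}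

theorem integrable_bdd_mul_mul {ξ f g : Ω → ℝ} {C : ℝ} (hξ : Measurable ξ)
    (hC : ∀ ω, |ξ ω| ≤ C) (hf : MemLp f 2 P) (hg : MemLp g 2 P) :
    Integrable (fun ω => ξ ω * (f ω * g ω)) P :=
  (hf.integrable_mul hg).bdd_mul hξ.aestronglyMeasurable (ae_of_all _ fun ω => hC ω)

theorem MeasureTheory.MemLp.integrable_real_inner {α E : Type*} [MeasurableSpace α]
    {μ : Measure α} [NormedAddCommGroup E] [InnerProductSpace ℝ E]
    {f g : α → E} (hf : MemLp f 2 μ) (hg : MemLp g 2 μ) :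
    Integrable (fun x => inner ℝ (f x) (g x)) μ := by
  refine (hf.norm.integrable_mul hg.norm).mono'
    (hf.aestronglyMeasurable.inner hg.aestronglyMeasurable) (ae_of_all _ fun x => ?_)
  exact norm_inner_le_norm _ _

theorem MeasureTheory.MemLp.eLpNorm_two_eq_of_inner {α E : Type*} [MeasurableSpace α]
    {μ : Measure α} [NormedAddCommGroup E] [InnerProductSpace ℝ E] {f : α → E}
    (hf : MemLp f 2 μ) :
    eLpNorm f 2 μ = ENNReal.ofReal (Real.sqrt (∫ x, inner ℝ (f x) (f x) ∂μ)) := by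
  rw [hf.eLpNorm_eq_integral_rpow_norm two_ne_zero ENNReal.ofNat_ne_top, Real.sqrt_eq_rpow]
  simp
end

namespace IsFilteredBM
variable {Ω : Type*} [mΩ : MeasurableSpace Ω] {d : ℕ} {P : Measure Ω}
    {F : ℝ → MeasurableSpace Ω} {B : ℝ → Ω → Fin d → ℝ}

theorem integral_gen_mul_gen_of_le [IsProbabilityMeasure P] (h : IsFilteredBM P F B)
    {a b a' b' : ℝ} {j k : Fin d} {ξ ξ' : Ω → ℝ} (ha : 0 ≤ a) (hab : a ≤ b) (hab' : a' ≤ b')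
    (haa : a ≤ a') (hξ : Measurable[F a] ξ) (hξ' : Measurable[F a'] ξ')
    {C C' : ℝ} (hC : ∀ ω, |ξ ω| ≤ C) (hC' : ∀ ω, |ξ' ω| ≤ C') :
    ∫ ω, (itoGen B a b j ξ).2 ω * (itoGen B a' b' k ξ').2 ω ∂P
      = (∫ ω, ξ ω * ξ' ω ∂P) * (if j = k then max (min b b' - max a a') 0 else 0) := by
  have ha' : 0 ≤ a' := ha.trans haa
  have hζ : Measurable[F a'] (fun ω => ξ ω * ξ' ω) := (hξ.mono (h.mono _ _ haa) le_rfl).mul hξ'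
  have hζb : ∀ ω, |ξ ω * ξ' ω| ≤ C * C' := fun ω => by
    rw [abs_mul]
    exact mul_le_mul (hC ω) (hC' ω) (abs_nonneg _) ((abs_nonneg _).trans (hC ω))
  have co : ∀ (i : Fin d) {s t : ℝ}, 0 ≤ s → s ≤ t → Measurable[F t] (fun ω => B s ω i) :=
    fun i s t hs hst => (measurable_pi_apply i).comp (h.measurable_adapted hs hst)
  simp only [itoGen]
  rw [max_eq_right haa]
  rcases le_or_gt b a' with hba | hba
  · have e : ∀ ω, ξ ω * (B b ω j - B a ω j) * (ξ' ω * (B b' ω k - B a' ω k))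
        = (ξ ω * ξ' ω * (B b ω j - B a ω j)) * (B b' ω k - B a' ω k) := fun ω => by ring
    simp_rw [e]
    rw [h.integral_mul_incr (η := fun ω => ξ ω * ξ' ω * (B b ω j - B a ω j)) ha' hab'
      (hζ.mul ((co j (ha.trans hab) hba).sub (co j ha haa)))]
    have : max (min b b' - a') 0 = 0 := max_eq_right (by linarith [min_le_left b b'])
    simp [this]
  · set c := min b b' with hc
    have hac : a' ≤ c := le_min hba.le hab'
    have hc0 : 0 ≤ c := ha'.trans hac
    have hcb : c ≤ b := min_le_left _ _
    have hcb' : c ≤ b' := min_le_right _ _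
    have hzero : ∀ ω, (B b ω j - B c ω j) * (B b' ω k - B c ω k) = 0 := fun ω => by
      rcases min_choice b b' with h1 | h1 <;> rw [hc, h1] <;> simp
    have e : ∀ ω, ξ ω * (B b ω j - B a ω j) * (ξ' ω * (B b' ω k - B a' ω k))
        = ξ ω * ξ' ω * (B a' ω j - B a ω j) * (B b' ω k - B a' ω k)
        + ξ ω * ξ' ω * ((B c ω j - B a' ω j) * (B c ω k - B a' ω k))
        + ξ ω * ξ' ω * (B c ω k - B a' ω k) * (B b ω j - B c ω j)
        + ξ ω * ξ' ω * (B c ω j - B a' ω j) * (B b' ω k - B c ω k) := fun ω => by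
      linear_combination (ξ ω * ξ' ω) * hzero ω
    have hζ0 : Measurable (fun ω => ξ ω * ξ' ω) := hζ.mono (h.le _) le_rfl
    have i1 := integrable_bdd_mul_mul (P := P) hζ0 hζb (h.memLp_incr ha haa j)
      (h.memLp_incr ha' hab' k)
    have i2 := integrable_bdd_mul_mul (P := P) hζ0 hζb (h.memLp_incr ha' hac j)
      (h.memLp_incr ha' hac k)
    have i3 := integrable_bdd_mul_mul (P := P) hζ0 hζb (h.memLp_incr ha' hac k)
      (h.memLp_incr hc0 hcb j)
    have i4 := integrable_bdd_mul_mul (P := P) hζ0 hζb (h.memLp_incr ha' hac j)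
      (h.memLp_incr hc0 hcb' k)
    simp_rw [← mul_assoc] at i1 i3 i4
    simp_rw [e]
    have hζc : Measurable[F c] (fun ω => ξ ω * ξ' ω) := hζ.mono (h.mono _ _ hac) le_rfl
    rw [integral_add, integral_add, integral_add,
      h.integral_mul_incr (η := fun ω => ξ ω * ξ' ω * (B a' ω j - B a ω j)) ha' hab'
        (hζ.mul ((co j ha' le_rfl).sub (co j ha haa))),
      h.integral_mul_incr (η := fun ω => ξ ω * ξ' ω * (B c ω k - B a' ω k)) hc0 hcb
        (hζc.mul ((co k hc0 le_rfl).sub (co k ha' hac))),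
      h.integral_mul_incr (η := fun ω => ξ ω * ξ' ω * (B c ω j - B a' ω j)) hc0 hcb'
        (hζc.mul ((co j hc0 le_rfl).sub (co j ha' hac))),
      h.integral_mul_incr_mul_incr ha' hac hζ, max_eq_left (sub_nonneg.2 hac)]
    · ring
    · exact i1
    · exact i2
    · exact i1.add i2
    · exact i3
    · exact (i1.add i2).add i3
    · exact i4

theorem integral_inner_gen [IsProbabilityMeasure P] (a b a' b' : ℝ) (j k : Fin d)
    (ξ ξ' : Ω → ℝ) :
    ∫ q, inner ℝ ((itoGen B a b j ξ).1 q) ((itoGen B a' b' k ξ').1 q)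
        ∂((volume : Measure ℝ).prod P)
      = (∫ ω, ξ ω * ξ' ω ∂P) * (if j = k then max (min b b' - max a a') 0 else 0) := by
  have e : ∀ q : ℝ × Ω, inner ℝ ((itoGen B a b j ξ).1 q) ((itoGen B a' b' k ξ').1 q)
      = (Ioc (max a a') (min b b')).indicator (fun _ => if j = k then (1 : ℝ) else 0) q.1
        * (ξ q.2 * ξ' q.2) := fun q => by
    simp only [itoGen, EuclideanSpace.inner_single_left, PiLp.single_apply]
    rw [← Ioc_inter_Ioc, ← indicator_indicator]
    by_cases h1 : q.1 ∈ Ioc a b <;> by_cases h2 : q.1 ∈ Ioc a' b' <;> by_cases h3 : j = k <;>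
      simp [h1, h2, h3]
  simp_rw [e]
  rw [integral_prod_mul (fun x : ℝ => (Ioc (max a a') (min b b')).indicator
    (fun _ => if j = k then (1 : ℝ) else 0) x) (fun ω => ξ ω * ξ' ω),
    integral_indicator measurableSet_Ioc, mul_comm]
  congr 1
  split_ifs with h3 <;> simp [Measure.real, ENNReal.toReal_ofReal']

theorem memLp_gen [IsProbabilityMeasure P] (h : IsFilteredBM P F B) {a b : ℝ} {j : Fin d}
    {ξ : Ω → ℝ} (ha : 0 ≤ a) (hab : a ≤ b) (hξ : Measurable[F a] ξ)
    {C : ℝ} (hC : ∀ ω, |ξ ω| ≤ C) :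
    MemLp (itoGen B a b j ξ).1 2 ((volume : Measure ℝ).prod P)
      ∧ MemLp (itoGen B a b j ξ).2 2 P := by
  have hξ0 : Measurable ξ := hξ.mono (h.le _) le_rfl
  constructor
  · have e : (itoGen B a b j ξ).1 = (Ioc a b ×ˢ univ).indicator
        (fun q : ℝ × Ω => EuclideanSpace.single j (ξ q.2)) := by
      ext q i
      by_cases h1 : a < q.1 ∧ q.1 ≤ b <;> simp [itoGen, indicator, mem_prod, h1]
    rw [e]
    refine (memLp_indicator_iff_restrict ?_).2 ?_
    · exact measurableSet_Ioc.prod MeasurableSet.univ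
    have : IsFiniteMeasure (((volume : Measure ℝ).prod P).restrict (Ioc a b ×ˢ univ)) := by
      refine ⟨?_⟩
      rw [Measure.restrict_apply_univ, Measure.prod_prod]
      simp
    refine MemLp.of_bound (C := C) ?_ (ae_of_all _ fun q => ?_)
    · refine Measurable.aestronglyMeasurable ?_
      have : (fun q : ℝ × Ω => EuclideanSpace.single j (ξ q.2))
          = fun q => (ξ q.2) • EuclideanSpace.single j (1 : ℝ) := by
        ext q i; simp [PiLp.single_apply]
      rw [this]
      exact (hξ0.comp measurable_snd).smul_const _
    · simpa using hC q.2
  · have hm := h.memLp_incr ha hab j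
    refine hm.of_le_mul (c := C) (hξ0.aestronglyMeasurable.mul hm.aestronglyMeasurable)
      (ae_of_all _ fun ω => ?_)
    rw [Real.norm_eq_abs, Real.norm_eq_abs, itoGen, abs_mul]
    exact mul_le_mul_of_nonneg_right (hC ω) (abs_nonneg _)

theorem memLp_of_mem_simpleSpan [IsProbabilityMeasure P] (h : IsFilteredBM P F B)
    {p : (ℝ × Ω → EuclideanSpace ℝ (Fin d)) × (Ω → ℝ)} (hp : p ∈ simpleSpan F B) :
    MemLp p.1 2 ((volume : Measure ℝ).prod P) ∧ MemLp p.2 2 P := by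
  induction hp using Submodule.span_induction with
  | mem p hp =>
    obtain ⟨a, b, j, ξ, ha, hab, hξ, ⟨C, hC⟩, rfl⟩ := hp
    exact h.memLp_gen ha hab hξ hC
  | zero => exact ⟨MemLp.zero, MemLp.zero⟩
  | add p q _ _ hp hq => exact ⟨hp.1.add hq.1, hp.2.add hq.2⟩
  | smul c p _ hp => exact ⟨hp.1.const_smul c, hp.2.const_smul c⟩

theorem integral_inner_simpleSpan [IsProbabilityMeasure P] (h : IsFilteredBM P F B)
    {p p' : (ℝ × Ω → EuclideanSpace ℝ (Fin d)) × (Ω → ℝ)} (hp : p ∈ simpleSpan F B)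
    (hp' : p' ∈ simpleSpan F B) :
    ∫ q, inner ℝ (p.1 q) (p'.1 q) ∂((volume : Measure ℝ).prod P)
      = ∫ ω, inner ℝ (p.2 ω) (p'.2 ω) ∂P := by
  have key : ∀ p' ∈ simpleSpan F B, ∀ p ∈ simpleSpan F B,
      (∀ g ∈ {p | ∃ (a b : ℝ) (j : Fin d) (ξ : Ω → ℝ), 0 ≤ a ∧ a ≤ b ∧
        Measurable[F a] ξ ∧ (∃ C : ℝ, ∀ ω, |ξ ω| ≤ C) ∧ p = itoGen B a b j ξ},
        ∫ q, inner ℝ (g.1 q) (p'.1 q) ∂((volume : Measure ℝ).prod P)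
          = ∫ ω, inner ℝ (g.2 ω) (p'.2 ω) ∂P) →
      ∫ q, inner ℝ (p.1 q) (p'.1 q) ∂((volume : Measure ℝ).prod P)
        = ∫ ω, inner ℝ (p.2 ω) (p'.2 ω) ∂P := by
    intro p' hp' p hp hg
    have m' := h.memLp_of_mem_simpleSpan hp'
    induction hp using Submodule.span_induction with
    | mem p hp => exact hg p hp
    | zero => simp
    | add p q hp hq ihp ihq =>
      have mp := h.memLp_of_mem_simpleSpan hp
      have mq := h.memLp_of_mem_simpleSpan hq
      simp only [Prod.fst_add, Prod.snd_add, Pi.add_apply, inner_add_left]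
      rw [integral_add (mp.1.integrable_real_inner m'.1) (mq.1.integrable_real_inner m'.1),
        integral_add (mp.2.integrable_real_inner m'.2) (mq.2.integrable_real_inner m'.2), ihp, ihq]
    | smul c p hp ihp =>
      simp only [Prod.smul_fst, Prod.smul_snd, Pi.smul_apply, real_inner_smul_left]
      rw [integral_const_mul, integral_const_mul, ihp]
  refine key p' hp' p hp fun g hg => ?_
  have hgs : g ∈ simpleSpan F B := Submodule.subset_span hg
  have := key g hgs p' hp' fun g' hg' => ?_
  · simpa only [real_inner_comm] using this
  obtain ⟨a, b, j, ξ, ha, hab, hξ, ⟨C, hC⟩, rfl⟩ := hg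
  obtain ⟨a', b', k, ξ', ha', hab', hξ', ⟨C', hC'⟩, rfl⟩ := hg'
  rw [integral_inner_gen]
  simp only [RCLike.inner_apply, conj_trivial]
  rcases le_total a' a with haa | haa
  · refine ((h.integral_gen_mul_gen_of_le ha' hab' hab haa hξ' hξ hC' hC).symm).trans ?_
    exact integral_congr_ae (ae_of_all _ fun ω => mul_comm _ _)
  · have := (h.integral_gen_mul_gen_of_le (j := j) (k := k) ha hab hab' haa hξ hξ' hC hC').symm
    simpa only [mul_comm, min_comm, max_comm, eq_comm] using this

/-- The Itô isometry for simple integrands. -/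
theorem eLpNorm_simpleSpan [IsProbabilityMeasure P] (h : IsFilteredBM P F B)
    {p : (ℝ × Ω → EuclideanSpace ℝ (Fin d)) × (Ω → ℝ)} (hp : p ∈ simpleSpan F B) :
    eLpNorm p.2 2 P = eLpNorm p.1 2 ((volume : Measure ℝ).prod P) := by
  have m := h.memLp_of_mem_simpleSpan hp
  rw [m.1.eLpNorm_two_eq_of_inner, m.2.eLpNorm_two_eq_of_inner,
    h.integral_inner_simpleSpan hp hp]

end IsFilteredBM

/-- `J` is the Itô integral of the square integrable integrand `h`, as an `L²`-limit of
stochastic integrals of simple integrands. -/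
def IsIto {Ω : Type*} [MeasurableSpace Ω] {d : ℕ} (P : Measure Ω) (F : ℝ → MeasurableSpace Ω)
    (B : ℝ → Ω → Fin d → ℝ) (h : ℝ × Ω → EuclideanSpace ℝ (Fin d)) (J : Ω → ℝ) : Prop :=
  AEStronglyMeasurable h ((volume : Measure ℝ).prod P) ∧ AEStronglyMeasurable J P ∧
  ∀ ε : ENNReal, ε ≠ 0 → ∃ p ∈ simpleSpan F B,
    eLpNorm (h - p.1) 2 ((volume : Measure ℝ).prod P) ≤ ε ∧ eLpNorm (J - p.2) 2 P ≤ ε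

section
variable {α : Type*} {mα : MeasurableSpace α} {μ : Measure α} {E : Type*} [NormedAddCommGroup E]

theorem eLpNorm_le_eLpNorm_add_eLpNorm_sub {f g : α → E} (hf : AEStronglyMeasurable f μ)
    (hg : AEStronglyMeasurable g μ) :
    eLpNorm f 2 μ ≤ eLpNorm g 2 μ + eLpNorm (f - g) 2 μ := by
  have := eLpNorm_add_le hg (hf.sub hg) (p := 2) (by norm_num)
  simpa using this

theorem eLpNorm_sub_le_add_sub {f g k : α → E} (hf : AEStronglyMeasurable f μ)
    (hg : AEStronglyMeasurable g μ) (hk : AEStronglyMeasurable k μ) :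
    eLpNorm (f - k) 2 μ ≤ eLpNorm (f - g) 2 μ + eLpNorm (g - k) 2 μ := by
  have := eLpNorm_add_le (hf.sub hg) (hg.sub hk) (p := 2) (by norm_num)
  simpa using this

theorem enorm_integral_mul_le {f g : α → ℝ} (hf : AEStronglyMeasurable f μ)
    (hg : AEStronglyMeasurable g μ) :
    ‖∫ x, f x * g x ∂μ‖ₑ ≤ eLpNorm f 2 μ * eLpNorm g 2 μ := by
  refine (enorm_integral_le_lintegral_enorm _).trans ?_
  have := eLpNorm_smul_le_mul_eLpNorm (p := 2) (q := 2) (r := 1) hg hf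
  rwa [eLpNorm_one_eq_lintegral_enorm] at this

end

theorem ENNReal.le_of_forall_ne_zero_le_add_two_mul {a b : ENNReal}
    (h : ∀ ε : ENNReal, ε ≠ 0 → a ≤ b + (ε + ε)) : a ≤ b := by
  refine ENNReal.le_of_forall_pos_le_add fun ε hε _ => ?_
  have := h (ε / 2) (by simp [hε.ne'])
  rwa [ENNReal.add_halves] at this

namespace IsIto
variable {Ω : Type*} [mΩ : MeasurableSpace Ω] {d : ℕ} {P : Measure Ω}
    {F : ℝ → MeasurableSpace Ω} {B : ℝ → Ω → Fin d → ℝ}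
    {h h' : ℝ × Ω → EuclideanSpace ℝ (Fin d)} {J J' : Ω → ℝ}

theorem of_mem_simpleSpan [IsProbabilityMeasure P] (hB : IsFilteredBM P F B)
    {p : (ℝ × Ω → EuclideanSpace ℝ (Fin d)) × (Ω → ℝ)} (hp : p ∈ simpleSpan F B) :
    IsIto P F B p.1 p.2 :=
  ⟨(hB.memLp_of_mem_simpleSpan hp).1.1, (hB.memLp_of_mem_simpleSpan hp).2.1,
    fun ε _ => ⟨p, hp, by simp, by simp⟩⟩

/-- The Itô isometry. -/
theorem eLpNorm_eq [IsProbabilityMeasure P] (hB : IsFilteredBM P F B) (hJ : IsIto P F B h J) :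
    eLpNorm J 2 P = eLpNorm h 2 ((volume : Measure ℝ).prod P) := by
  obtain ⟨mh, mJ, H⟩ := hJ
  apply le_antisymm
  · refine ENNReal.le_of_forall_ne_zero_le_add_two_mul fun ε hε => ?_
    obtain ⟨p, hp, h1, h2⟩ := H ε hε
    have m := hB.memLp_of_mem_simpleSpan hp
    calc eLpNorm J 2 P ≤ eLpNorm p.2 2 P + eLpNorm (J - p.2) 2 P :=
          eLpNorm_le_eLpNorm_add_eLpNorm_sub mJ m.2.1
      _ ≤ eLpNorm p.1 2 (volume.prod P) + ε := by rw [hB.eLpNorm_simpleSpan hp]; gcongr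
      _ ≤ eLpNorm h 2 (volume.prod P) + eLpNorm (p.1 - h) 2 (volume.prod P) + ε := by
          gcongr; exact eLpNorm_le_eLpNorm_add_eLpNorm_sub m.1.1 mh
      _ ≤ eLpNorm h 2 (volume.prod P) + (ε + ε) := by
          rw [add_assoc, eLpNorm_sub_comm]; gcongr
  · refine ENNReal.le_of_forall_ne_zero_le_add_two_mul fun ε hε => ?_
    obtain ⟨p, hp, h1, h2⟩ := H ε hε
    have m := hB.memLp_of_mem_simpleSpan hp
    calc eLpNorm h 2 (volume.prod P)
          ≤ eLpNorm p.1 2 (volume.prod P) + eLpNorm (h - p.1) 2 (volume.prod P) :=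
          eLpNorm_le_eLpNorm_add_eLpNorm_sub mh m.1.1
      _ ≤ eLpNorm p.2 2 P + ε := by rw [hB.eLpNorm_simpleSpan hp]; gcongr
      _ ≤ eLpNorm J 2 P + eLpNorm (p.2 - J) 2 P + ε := by
          gcongr; exact eLpNorm_le_eLpNorm_add_eLpNorm_sub m.2.1 mJ
      _ ≤ eLpNorm J 2 P + (ε + ε) := by
          rw [add_assoc, eLpNorm_sub_comm]; gcongr

theorem memLp [IsProbabilityMeasure P] (hB : IsFilteredBM P F B) (hJ : IsIto P F B h J) :
    MemLp h 2 ((volume : Measure ℝ).prod P) ∧ MemLp J 2 P := by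
  have h2 : MemLp h 2 ((volume : Measure ℝ).prod P) := by
    obtain ⟨p, hp, h1, _⟩ := hJ.2.2 1 one_ne_zero
    have m := hB.memLp_of_mem_simpleSpan hp
    refine ⟨hJ.1, (eLpNorm_le_eLpNorm_add_eLpNorm_sub hJ.1 m.1.1).trans_lt ?_⟩
    exact ENNReal.add_lt_top.2 ⟨m.1.2, h1.trans_lt ENNReal.one_lt_top⟩
  exact ⟨h2, hJ.2.1, by rw [hJ.eLpNorm_eq hB]; exact h2.2⟩

theorem sub [IsProbabilityMeasure P] (hB : IsFilteredBM P F B) (hJ : IsIto P F B h J)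
    (hJ' : IsIto P F B h' J') : IsIto P F B (h - h') (J - J') := by
  refine ⟨hJ.1.sub hJ'.1, hJ.2.1.sub hJ'.2.1, fun ε hε => ?_⟩
  obtain ⟨p, hp, h1, h2⟩ := hJ.2.2 (ε / 2) (by simpa using hε)
  obtain ⟨p', hp', h1', h2'⟩ := hJ'.2.2 (ε / 2) (by simpa using hε)
  have m := hB.memLp_of_mem_simpleSpan hp
  have m' := hB.memLp_of_mem_simpleSpan hp'
  refine ⟨p - p', Submodule.sub_mem _ hp hp', ?_, ?_⟩
  · have e : h - h' - (p - p').1 = (h - p.1) - (h' - p'.1) := by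
      rw [Prod.fst_sub]; abel
    rw [e, ← ENNReal.add_halves ε]
    exact (eLpNorm_sub_le (hJ.1.sub m.1.1) (hJ'.1.sub m'.1.1) (by norm_num)).trans (by gcongr)
  · have e : J - J' - (p - p').2 = (J - p.2) - (J' - p'.2) := by
      rw [Prod.snd_sub]; abel
    rw [e, ← ENNReal.add_halves ε]
    exact (eLpNorm_sub_le (hJ.2.1.sub m.2.1) (hJ'.2.1.sub m'.2.1) (by norm_num)).trans (by gcongr)

theorem of_forall_exists [IsProbabilityMeasure P] (hB : IsFilteredBM P F B)
    (mh : AEStronglyMeasurable h ((volume : Measure ℝ).prod P)) (mJ : AEStronglyMeasurable J P)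
    (H : ∀ ε : ENNReal, ε ≠ 0 → ∃ h' J', IsIto P F B h' J' ∧
      eLpNorm (h - h') 2 ((volume : Measure ℝ).prod P) ≤ ε ∧ eLpNorm (J - J') 2 P ≤ ε) :
    IsIto P F B h J := by
  refine ⟨mh, mJ, fun ε hε => ?_⟩
  obtain ⟨h', J', hJ', h1, h2⟩ := H (ε / 2) (by simpa using hε)
  obtain ⟨p, hp, h1', h2'⟩ := hJ'.2.2 (ε / 2) (by simpa using hε)
  have m := hB.memLp_of_mem_simpleSpan hp
  refine ⟨p, hp, ?_, ?_⟩
  · rw [← ENNReal.add_halves ε]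
    exact (eLpNorm_sub_le_add_sub mh hJ'.1 m.1.1).trans (by gcongr)
  · rw [← ENNReal.add_halves ε]
    exact (eLpNorm_sub_le_add_sub mJ hJ'.2.1 m.2.1).trans (by gcongr)

/-- If the integrands converge in `L²` and the integrals converge in probability, the limit is
the Itô integral of the limit and the convergence of the integrals holds in `L²`. -/
theorem of_tendsto [IsProbabilityMeasure P] (hB : IsFilteredBM P F B)
    {hs : ℕ → ℝ × Ω → EuclideanSpace ℝ (Fin d)} {Js : ℕ → Ω → ℝ}
    (mh : AEStronglyMeasurable h ((volume : Measure ℝ).prod P))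
    (hI : ∀ k, IsIto P F B (hs k) (Js k))
    (hh : Tendsto (fun k => eLpNorm (hs k - h) 2 ((volume : Measure ℝ).prod P)) atTop (nhds 0))
    (hJ : TendstoInMeasure P Js atTop J) : IsIto P F B h J := by
  have mJ : AEStronglyMeasurable J P :=
    (TendstoInMeasure.aemeasurable (fun k => (hI k).2.1.aemeasurable) hJ).aestronglyMeasurable
  refine of_forall_exists hB mh mJ fun ε hε => ?_
  have hε2 : ε / 2 ≠ 0 := by simpa using hε
  obtain ⟨K, hK⟩ := eventually_atTop.1 (hh.eventually (ge_mem_nhds (pos_iff_ne_zero.2 hε2)))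
  refine ⟨hs K, Js K, hI K, ?_, ?_⟩
  · rw [eLpNorm_sub_comm]
    exact (hK K le_rfl).trans ENNReal.half_le_self
  obtain ⟨ns, hns, hae⟩ := hJ.exists_seq_tendsto_ae
  rw [eLpNorm_sub_comm]
  refine (Lp.eLpNorm_lim_le_liminf_eLpNorm (f := fun l => Js K - Js (ns l))
    (fun l => (hI K).2.1.sub (hI (ns l)).2.1) _ ?_).trans ?_
  · filter_upwards [hae] with ω hω
    exact hω.const_sub _
  · refine liminf_le_of_frequently_le' (Eventually.frequently ?_)
    filter_upwards [eventually_ge_atTop K] with l hl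
    rw [((hI K).sub hB (hI (ns l))).eLpNorm_eq hB, ← ENNReal.add_halves ε]
    refine (eLpNorm_sub_le_add_sub (hI K).1 mh (hI (ns l)).1).trans ?_
    rw [eLpNorm_sub_comm h]
    exact add_le_add (hK K le_rfl) (hK (ns l) (hl.trans (hns.le_apply)))

/-- Convergence of integrands yields existence of the Itô integral of the limit. -/
theorem exists_of_tendsto [IsProbabilityMeasure P] (hB : IsFilteredBM P F B)
    {hs : ℕ → ℝ × Ω → EuclideanSpace ℝ (Fin d)} {Js : ℕ → Ω → ℝ}
    (mh : AEStronglyMeasurable h ((volume : Measure ℝ).prod P))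
    (hI : ∀ k, IsIto P F B (hs k) (Js k))
    (hh : Tendsto (fun k => eLpNorm (hs k - h) 2 ((volume : Measure ℝ).prod P)) atTop (nhds 0)) :
    ∃ J : Ω → ℝ, Measurable J ∧ IsIto P F B h J ∧ TendstoInMeasure P Js atTop J := by
  have hC : CauchySeq fun k => ((hI k).memLp hB).2.toLp := by
    rw [Lp.cauchySeq_Lp_iff_cauchySeq_eLpNorm]
    have e : ∀ n : ℕ × ℕ, eLpNorm (⇑((hI n.1).memLp hB).2.toLp - ⇑((hI n.2).memLp hB).2.toLp) 2 P
        ≤ eLpNorm (hs n.1 - h) 2 (volume.prod P) + eLpNorm (hs n.2 - h) 2 (volume.prod P) := by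
      intro n
      rw [eLpNorm_congr_ae (((hI n.1).memLp hB).2.coeFn_toLp.sub ((hI n.2).memLp hB).2.coeFn_toLp),
        ((hI n.1).sub hB (hI n.2)).eLpNorm_eq hB, eLpNorm_sub_comm (hs n.2)]
      exact eLpNorm_sub_le_add_sub (hI n.1).1 mh (hI n.2).1
    refine tendsto_of_tendsto_of_tendsto_of_le_of_le tendsto_const_nhds ?_ (fun _ => zero_le) e
    rw [← prod_atTop_atTop_eq]
    simpa using (hh.comp tendsto_fst).add (hh.comp tendsto_snd)
  obtain ⟨L, hL⟩ := cauchySeq_tendsto_of_complete hC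
  rw [Lp.tendsto_Lp_iff_tendsto_eLpNorm'] at hL
  obtain ⟨J, mJ, hJ⟩ := (Lp.aestronglyMeasurable L).aemeasurable
  have hT : TendstoInMeasure P Js atTop J := by
    refine tendstoInMeasure_of_tendsto_eLpNorm two_ne_zero (fun k => (hI k).2.1)
      mJ.aestronglyMeasurable (hL.congr fun k => ?_)
    exact eLpNorm_congr_ae (((hI k).memLp hB).2.coeFn_toLp.sub hJ)
  exact ⟨J, mJ, of_tendsto hB mh hI hh hT, hT⟩

theorem exists_restrict_of_mem_simpleSpan [IsProbabilityMeasure P] (hB : IsFilteredBM P F B)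
    {r : ℝ} (hr : 0 ≤ r) {η : Ω → ℝ} (hη : Measurable[F r] η) (hη2 : MemLp η 2 P)
    {p : (ℝ × Ω → EuclideanSpace ℝ (Fin d)) × (Ω → ℝ)} (hp : p ∈ simpleSpan F B) :
    ∃ p' ∈ simpleSpan F B, p'.1 = {q : ℝ × Ω | q.1 ≤ r}.indicator p.1 ∧
      ∫ ω, η ω * (p.2 ω - p'.2 ω) ∂P = 0 := by
  induction hp using Submodule.span_induction with
  | mem p hp =>
    obtain ⟨a, b, j, ξ, ha, hab, hξ, ⟨C, hC⟩, rfl⟩ := hp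
    rcases lt_or_ge r a with hra | har
    · refine ⟨0, Submodule.zero_mem _, ?_, ?_⟩
      · ext q i
        by_cases h1 : q.1 ≤ r
        · have h2 : ¬ (a < q.1 ∧ q.1 ≤ b) := fun h => by linarith [h.1]
          simp [itoGen, indicator, h1, h2]
        · simp [indicator, h1]
      · have e : ∀ ω, η ω * ((itoGen B a b j ξ).2 ω - (0 : (ℝ × Ω → EuclideanSpace ℝ (Fin d))
            × (Ω → ℝ)).2 ω) = (η ω * ξ ω) * (B b ω j - B a ω j) := fun ω => by
          simp only [itoGen, Prod.snd_zero, Pi.zero_apply]; ring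
        simp_rw [e]
        exact hB.integral_mul_incr ha hab ((hη.mono (hB.mono _ _ hra.le) le_rfl).mul hξ) j
    · refine ⟨itoGen B a (min b r) j ξ, Submodule.subset_span ⟨a, min b r, j, ξ, ha,
        le_min hab har, hξ, ⟨C, hC⟩, rfl⟩, ?_, ?_⟩
      · ext q i
        by_cases h1 : q.1 ≤ r <;> simp [itoGen, indicator, h1]
      · rcases le_total b r with hbr | hbr
        · simp [min_eq_left hbr]
        · have e : ∀ ω, η ω * ((itoGen B a b j ξ).2 ω - (itoGen B a (min b r) j ξ).2 ω)
              = (η ω * ξ ω) * (B b ω j - B r ω j) := fun ω => by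
            simp only [itoGen, min_eq_right hbr]; ring
          simp_rw [e]
          exact hB.integral_mul_incr hr hbr (hη.mul (hξ.mono (hB.mono _ _ har) le_rfl)) j
  | zero => exact ⟨0, Submodule.zero_mem _, by simp, by simp⟩
  | add p q hp hq ihp ihq =>
    obtain ⟨p', hp', e1, e2⟩ := ihp
    obtain ⟨q', hq', f1, f2⟩ := ihq
    refine ⟨p' + q', Submodule.add_mem _ hp' hq', ?_, ?_⟩
    · rw [Prod.fst_add, Prod.fst_add, e1, f1, indicator_add']
    · have e : ∀ ω, η ω * ((p + q).2 ω - (p' + q').2 ω)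
          = η ω * (p.2 ω - p'.2 ω) + η ω * (q.2 ω - q'.2 ω) := fun ω => by
        simp only [Prod.snd_add, Pi.add_apply]; ring
      have m : ∀ {p p' : (ℝ × Ω → EuclideanSpace ℝ (Fin d)) × (Ω → ℝ)}, p ∈ simpleSpan F B →
          p' ∈ simpleSpan F B → Integrable (fun ω => η ω * (p.2 ω - p'.2 ω)) P :=
        fun hp hp' => hη2.integrable_mul ((hB.memLp_of_mem_simpleSpan hp).2.sub
          (hB.memLp_of_mem_simpleSpan hp').2)
      simp_rw [e]
      rw [integral_add (m hp hp') (m hq hq'), e2, f2, add_zero]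
  | smul c p hp ihp =>
    obtain ⟨p', hp', e1, e2⟩ := ihp
    refine ⟨c • p', Submodule.smul_mem _ _ hp', ?_, ?_⟩
    · rw [Prod.smul_fst, Prod.smul_fst, e1]
      exact (indicator_const_smul _ c p.1).symm
    · have e : ∀ ω, η ω * ((c • p).2 ω - (c • p').2 ω)
          = c * (η ω * (p.2 ω - p'.2 ω)) := fun ω => by
        simp only [Prod.smul_snd, Pi.smul_apply, smul_eq_mul]; ring
      simp_rw [e]
      rw [integral_const_mul, e2, mul_zero]

/-- Itô integrals over future times are orthogonal to the past. -/
theorem integral_mul_eq_zero [IsProbabilityMeasure P] (hB : IsFilteredBM P F B)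
    (hJ : IsIto P F B h J) {r : ℝ} (hr : 0 ≤ r) (h0 : ∀ q : ℝ × Ω, q.1 ≤ r → h q = 0)
    {η : Ω → ℝ} (hη : Measurable[F r] η) (hη2 : MemLp η 2 P) :
    ∫ ω, η ω * J ω ∂P = 0 := by
  have key : ∀ ε : ENNReal, ε ≠ 0 → ‖∫ ω, η ω * J ω ∂P‖ₑ ≤ eLpNorm η 2 P * (ε + ε) := by
    intro ε hε
    obtain ⟨p, hp, h1, h2⟩ := hJ.2.2 ε hε
    obtain ⟨p', hp', e1, e2⟩ := exists_restrict_of_mem_simpleSpan hB hr hη hη2 hp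
    have m := hB.memLp_of_mem_simpleSpan hp
    have m' := hB.memLp_of_mem_simpleSpan hp'
    have mJ := (hJ.memLp hB).2
    have e : ∫ ω, η ω * J ω ∂P = ∫ ω, η ω * ((J - p.2) + p'.2) ω ∂P := by
      have : ∀ ω, η ω * J ω = η ω * ((J - p.2) + p'.2) ω + η ω * (p.2 ω - p'.2 ω) := fun ω => by
        simp only [Pi.add_apply, Pi.sub_apply]; ring
      simp_rw [this]
      have i1 : Integrable (fun ω => η ω * ((J - p.2) + p'.2) ω) P :=
        hη2.integrable_mul ((mJ.sub m.2).add m'.2)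
      have i2 : Integrable (fun ω => η ω * (p.2 ω - p'.2 ω)) P :=
        hη2.integrable_mul (m.2.sub m'.2)
      rw [integral_add i1 i2, e2, add_zero]
    rw [e]
    refine (enorm_integral_mul_le hη2.1 ((mJ.sub m.2).add m'.2).1).trans ?_
    gcongr
    refine (eLpNorm_add_le (mJ.sub m.2).1 m'.2.1 (by norm_num)).trans (add_le_add h2 ?_)
    rw [hB.eLpNorm_simpleSpan hp', e1]
    refine le_trans (eLpNorm_mono fun q => ?_) h1
    by_cases hq : q.1 ≤ r
    · simp [indicator, hq, h0 q hq]
    · simp [indicator, hq]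
  have hz : ‖∫ ω, η ω * J ω ∂P‖ₑ = 0 := by
    refine le_antisymm ?_ zero_le
    have : Tendsto (fun ε : ENNReal => eLpNorm η 2 P * (ε + ε)) (nhdsWithin 0 {0}ᶜ)
        (nhds (eLpNorm η 2 P * (0 + 0))) := by
      refine ENNReal.Tendsto.const_mul (Tendsto.mono_left (Continuous.tendsto (by fun_prop) 0)
        nhdsWithin_le_nhds) (Or.inr hη2.2.ne)
    have hne : (nhdsWithin (0 : ENNReal) {0}ᶜ).NeBot := by
      have : ({0}ᶜ : Set ENNReal) = Ioi 0 := by ext x; simp [pos_iff_ne_zero]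
      rw [this]; infer_instance
    rw [add_zero, mul_zero] at this
    exact ge_of_tendsto this (eventually_mem_nhdsWithin.mono fun ε hε => key ε hε)
  simpa using hz

end IsIto

/-- Progressive measurability, phrased by clamping the time variable to `[0, t]`. -/
def ClampedProg {Ω E : Type*} [MeasurableSpace E] (F : ℝ → MeasurableSpace Ω)
    (u : ℝ → Ω → E) : Prop :=
  ∀ t : ℝ, 0 ≤ t → Measurable[MeasurableSpace.prod inferInstance (F t)]
    (fun q : ℝ × Ω => u (max 0 (min q.1 t)) q.2)

theorem progMeas_iff_clampedProg {Ω E : Type*} [MeasurableSpace E] {F : ℝ → MeasurableSpace Ω}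
    {u : ℝ → Ω → E} : ProgMeas F u ↔ ClampedProg F u := by
  refine forall_congr' fun t => forall_congr' fun ht => ⟨fun h => ?_, fun h => ?_⟩
  · let _ := F t
    have hc : Measurable (fun q : ℝ × Ω => ((⟨max 0 (min q.1 t), le_max_left _ _,
        max_le ht (min_le_right _ _)⟩ : Icc (0 : ℝ) t), q.2)) := by
      refine Measurable.prodMk (Measurable.subtype_mk ?_) measurable_snd
      fun_prop
    exact h.comp hc
  · let _ := F t
    have hc : Measurable (fun p : Icc (0 : ℝ) t × Ω => ((p.1 : ℝ), p.2)) := by fun_prop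
    have := h.comp hc
    refine (congrArg _ ?_).mp this
    ext p
    simp [p.1.2.1, p.1.2.2]

/-- The integrand `h` viewed as a map into Euclidean space. -/
def toEuclid {Ω : Type*} {d : ℕ} (h : ℝ → Ω → Fin d → ℝ) (q : ℝ × Ω) :
    EuclideanSpace ℝ (Fin d) := WithLp.toLp 2 (h q.1 q.2)

/-- Truncation of a process to the time interval `(0, s]`. -/
def timeTrunc {Ω : Type*} {d : ℕ} (s : ℝ) (h : ℝ → Ω → Fin d → ℝ) (r : ℝ) (ω : Ω) : Fin d → ℝ :=
  if r ∈ Ioc 0 s then h r ω else 0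

/-- Bounded progressive integrands supported in `(0, T]`. -/
structure BddProg {Ω : Type*} {d : ℕ} (F : ℝ → MeasurableSpace Ω) (C T : ℝ)
    (h : ℝ → Ω → Fin d → ℝ) : Prop where
  prog : ClampedProg F h
  bdd : ∀ r ω j, |h r ω j| ≤ C
  supp : ∀ r ω, r ∉ Ioc 0 T → h r ω = 0

theorem ClampedProg.bddProg_timeTrunc {Ω : Type*} {d : ℕ} {F : ℝ → MeasurableSpace Ω} {C : ℝ}
    {h : ℝ → Ω → Fin d → ℝ} (hp : ClampedProg F h) (hb : ∀ r ω j, |h r ω j| ≤ C) (s : ℝ) :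
    BddProg F C s (timeTrunc s h) := by
  refine ⟨fun t ht => ?_, fun r ω j => ?_, fun r ω hr => if_neg hr⟩
  · let _ := F t
    have hc : Measurable (fun q : ℝ × Ω => max 0 (min q.1 t)) := by fun_prop
    exact Measurable.ite (hc measurableSet_Ioc) (hp t ht) measurable_const
  · rw [timeTrunc]
    split_ifs
    · exact hb r ω j
    · simpa using (abs_nonneg _).trans (hb r ω j)

theorem ClampedProg.measurable_apply {Ω E : Type*} [MeasurableSpace E] {F : ℝ → MeasurableSpace Ω}
    {u : ℝ → Ω → E} (hu : ClampedProg F u) {t : ℝ} (ht : 0 ≤ t) : Measurable[F t] (u t) := by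
  have h1 := hu t ht
  let _ := F t
  have h2 := h1.comp (measurable_prodMk_left (x := t))
  simpa [Function.comp_def, ht] using h2

theorem measurable_setIntegral_left {Ω : Type*} [MeasurableSpace Ω] {f : ℝ × Ω → ℝ}
    (hf : Measurable f) (S : Set ℝ) : Measurable (fun ω => ∫ r in S, f (r, ω)) :=
  (hf.stronglyMeasurable.integral_prod_left' (μ := volume.restrict S)).measurable

namespace BddProg
variable {Ω : Type*} {d : ℕ} {F : ℝ → MeasurableSpace Ω} {C T : ℝ}
    {h : ℝ → Ω → Fin d → ℝ}

theorem clamp_eq (hh : BddProg F C T h) {r t : ℝ} (hr : r ≤ t) (ω : Ω) :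
    h (max 0 (min r t)) ω = h r ω := by
  rw [min_eq_left hr]
  rcases le_total 0 r with h0 | h0
  · rw [max_eq_right h0]
  · rw [max_eq_left h0, hh.supp 0 ω (by simp), hh.supp r ω (by simp [h0.not_gt])]

theorem measurable_uncurry [mΩ : MeasurableSpace Ω] (hh : BddProg F C T h) (hF : ∀ s, F s ≤ mΩ) :
    Measurable (fun q : ℝ × Ω => h q.1 q.2) := by
  have h1 : Measurable (fun q : ℝ × Ω => h (max 0 (min q.1 (max T 0))) q.2) := by
    refine (hh.prog (max T 0) (le_max_right _ _)).mono ?_ le_rfl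
    exact sup_le_sup le_rfl (MeasurableSpace.comap_mono (hF _))
  have e : (fun q : ℝ × Ω => h q.1 q.2) = fun q : ℝ × Ω => if q.1 ≤ max T 0 then
      h (max 0 (min q.1 (max T 0))) q.2 else 0 := by
    ext1 q
    split_ifs with hq
    · exact (hh.clamp_eq hq q.2).symm
    · exact hh.supp _ _ fun h2 => hq (h2.2.trans (le_max_left _ _))
  rw [e]
  exact Measurable.ite (measurableSet_le measurable_fst measurable_const) h1 measurable_const

theorem measurable_setIntegral_coord (hh : BddProg F C T h) {t : ℝ} (ht : 0 ≤ t) (a : ℝ)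
    (j : Fin d) : Measurable[F t] (fun ω => ∫ r in Ioc a t, h r ω j) := by
  have h1 := @measurable_setIntegral_left Ω (F t) (fun q => h (max 0 (min q.1 t)) q.2 j)
    ((measurable_pi_apply j).comp (hh.prog t ht)) (Ioc a t)
  refine (congrArg _ ?_).mp h1
  ext ω
  refine setIntegral_congr_fun measurableSet_Ioc fun r hr => ?_
  simp only [hh.clamp_eq hr.2 ω]

theorem norm_toEuclid_le {h : ℝ → Ω → Fin d → ℝ} (hb : ∀ r ω j, |h r ω j| ≤ C) (q : ℝ × Ω) :
    ‖toEuclid h q‖ ≤ d * C := by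
  have h1 : ‖toEuclid h q‖ ≤ ∑ j, |h q.1 q.2 j| := by
    rw [EuclideanSpace.norm_eq]
    refine Real.sqrt_le_iff.2 ⟨Finset.sum_nonneg fun _ _ => abs_nonneg _, ?_⟩
    exact Finset.sum_sq_le_sq_sum_of_nonneg fun _ _ => abs_nonneg _
  refine h1.trans ((Finset.sum_le_card_nsmul _ _ C fun j _ => hb _ _ j).trans ?_)
  simp

theorem measurable_toEuclid [mΩ : MeasurableSpace Ω] (hh : BddProg F C T h) (hF : ∀ s, F s ≤ mΩ) :
    Measurable (toEuclid h) :=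
  (WithLp.measurable_toLp 2 _).comp (hh.measurable_uncurry hF)

end BddProg

/-- The index of the grid cell `(iδ, (i+1)δ]` that contains `r`. -/
def cellIdx (δ r : ℝ) : ℕ := ⌈r / δ⌉₊ - 1

theorem mem_cell_iff {δ r : ℝ} (hδ : 0 < δ) {i : ℕ} :
    r ∈ Ioc ((i : ℝ) * δ) ((i + 1) * δ) ↔ 0 < r ∧ cellIdx δ r = i := by
  have h1 : r ∈ Ioc ((i : ℝ) * δ) ((i + 1) * δ) ↔ ⌈r / δ⌉₊ = i + 1 := by
    rw [Nat.ceil_eq_iff (by simp), mem_Ioc, lt_div_iff₀ hδ, div_le_iff₀ hδ]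
    simp
  rw [h1, cellIdx]
  constructor
  · intro h
    have : 0 < ⌈r / δ⌉₊ := by omega
    rw [Nat.ceil_pos] at this
    exact ⟨by rwa [div_pos_iff_of_pos_right hδ] at this, by omega⟩
  · rintro ⟨h, h2⟩
    have := Nat.ceil_pos.2 (div_pos h hδ)
    omega

theorem cellIdx_lt_iff {δ r : ℝ} (hδ : 0 < δ) (hr : 0 < r) {N : ℕ} :
    cellIdx δ r < N ↔ r ≤ N * δ := by
  have := (mem_cell_iff hδ (r := r) (i := cellIdx δ r)).2 ⟨hr, rfl⟩
  constructor
  · intro h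
    refine this.2.trans (mul_le_mul_of_nonneg_right ?_ hδ.le)
    exact_mod_cast h
  · intro h
    have h2 := this.1.trans_le h
    exact_mod_cast lt_of_mul_lt_mul_right h2 hδ.le

/-- The step process with value `ψ i` on the grid cell `(iδ, (i+1)δ]`, `i < N`. -/
def gridStep {Ω : Type*} {d : ℕ} (δ : ℝ) (N : ℕ) (ψ : ℕ → Ω → Fin d → ℝ) (r : ℝ) (ω : Ω) :
    Fin d → ℝ :=
  if r ∈ Ioc 0 (N * δ) then ψ (cellIdx δ r) ω else 0

/-- The stochastic integral up to time `s` of a step process. -/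
def gridInt {Ω : Type*} {d : ℕ} (B : ℝ → Ω → Fin d → ℝ) (δ : ℝ) (N : ℕ) (ψ : ℕ → Ω → Fin d → ℝ)
    (s : ℝ) (ω : Ω) : ℝ :=
  ∑ i ∈ Finset.range N, ∑ j, ψ i ω j * (B (min ((i + 1) * δ) s) ω j - B (min (i * δ) s) ω j)

theorem gridInt_mem_simpleSpan {Ω : Type*} {d : ℕ} {F : ℝ → MeasurableSpace Ω}
    {B : ℝ → Ω → Fin d → ℝ} {δ : ℝ} (hδ : 0 < δ) (N : ℕ) {ψ : ℕ → Ω → Fin d → ℝ}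
    (hψ : ∀ i : ℕ, Measurable[F (i * δ)] (ψ i)) {C : ℝ} (hC : ∀ i ω j, |ψ i ω j| ≤ C) (s : ℝ) :
    (toEuclid (timeTrunc s (gridStep δ N ψ)), gridInt B δ N ψ s) ∈ simpleSpan F B := by
  have e : (toEuclid (timeTrunc s (gridStep δ N ψ)), gridInt B δ N ψ s)
      = ∑ i ∈ Finset.range N, ∑ j, if (i : ℝ) * δ ≤ s then
        itoGen B (i * δ) (min ((i + 1) * δ) s) j (fun ω => ψ i ω j) else 0 := by
    refine Prod.ext ?_ ?_
    · ext q k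
      simp only [Prod.fst_sum, Finset.sum_apply, WithLp.ofLp_sum]
      have e1 : ∀ i ∈ Finset.range N, (∑ j, WithLp.ofLp ((if (i : ℝ) * δ ≤ s then
          itoGen B (i * δ) (min ((i + 1) * δ) s) j (fun ω => ψ i ω j) else 0).1 q) k)
          = if q.1 ≤ s ∧ 0 < q.1 ∧ cellIdx δ q.1 = i then ψ i q.2 k else 0 := by
        intro i _
        by_cases his : (i : ℝ) * δ ≤ s
        · simp only [his, if_true, itoGen, PiLp.single_apply, indicator]
          rw [Finset.sum_ite_eq, if_pos (Finset.mem_univ _)]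
          refine if_congr ?_ rfl rfl
          rw [← mem_cell_iff hδ, mem_Ioc, mem_Ioc, le_min_iff]
          tauto
        · simp only [his, if_false, Prod.fst_zero, Pi.zero_apply, PiLp.zero_apply,
            Finset.sum_const_zero]
          rw [if_neg]
          rw [← mem_cell_iff hδ]
          rintro ⟨h1, h2⟩
          exact his (h2.1.le.trans h1)
      rw [Finset.sum_congr rfl e1]
      simp only [toEuclid, timeTrunc, gridStep]
      by_cases h1 : q.1 ≤ s ∧ 0 < q.1
      · have h2 : q.1 ∈ Ioc 0 s := ⟨h1.2, h1.1⟩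
        simp only [h2, h1.1, h1.2, if_true, true_and, mem_Ioc, ← cellIdx_lt_iff hδ h1.2]
        rw [Finset.sum_ite_eq]
        by_cases h3 : cellIdx δ q.1 < N <;> simp [h3]
      · have h2 : q.1 ∉ Ioc 0 s := fun h => h1 ⟨h.2, h.1⟩
        rw [if_neg h2]
        refine (Finset.sum_eq_zero fun i _ => if_neg fun h => h1 ⟨h.1, h.2.1⟩).symm
    · ext ω
      simp only [Prod.snd_sum, Finset.sum_apply, gridInt]
      refine Finset.sum_congr rfl fun i _ => Finset.sum_congr rfl fun j _ => ?_
      split_ifs with his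
      · simp [itoGen, min_eq_left his]
      · have h1 : s ≤ (i + 1) * δ := by nlinarith
        simp [min_eq_right h1, min_eq_right (not_le.1 his).le]
  rw [e]
  refine Submodule.sum_mem _ fun i _ => Submodule.sum_mem _ fun j _ => ?_
  split_ifs with his
  · have h0 : (0 : ℝ) ≤ i * δ := by positivity
    exact Submodule.subset_span ⟨_, _, j, _, h0, le_min (by nlinarith) his,
      (measurable_pi_apply j).comp (hψ i), ⟨C, fun ω => hC i ω j⟩, rfl⟩
  · exact Submodule.zero_mem _

/-- The average of `h` over the grid cell preceding the cell with index `i`. -/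
def prevAvg {Ω : Type*} {d : ℕ} (δ : ℝ) (h : ℝ → Ω → Fin d → ℝ) (i : ℕ) (ω : Ω) (j : Fin d) : ℝ :=
  δ⁻¹ * ∫ r in Ioc (((i : ℝ) - 1) * δ) (i * δ), h r ω j

theorem BddProg.measurable_prevAvg {Ω : Type*} {d : ℕ} {F : ℝ → MeasurableSpace Ω} {C T : ℝ}
    {h : ℝ → Ω → Fin d → ℝ} (hh : BddProg F C T h) {δ : ℝ} (hδ : 0 ≤ δ) (i : ℕ) :
    Measurable[F (i * δ)] (prevAvg δ h i) := by
  refine @measurable_pi_lambda _ _ _ (F (i * δ)) _ _ fun j => ?_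
  exact (hh.measurable_setIntegral_coord (by positivity) _ j).const_mul _

theorem abs_prevAvg_le {Ω : Type*} {d : ℕ} {C δ : ℝ} (hδ : 0 < δ)
    {h : ℝ → Ω → Fin d → ℝ} (hC : ∀ r ω j, |h r ω j| ≤ C) (i : ℕ) (ω : Ω) (j : Fin d) :
    |prevAvg δ h i ω j| ≤ C := by
  have h1 : ‖∫ r in Ioc (((i : ℝ) - 1) * δ) (i * δ), h r ω j‖
      ≤ C * volume.real (Ioc (((i : ℝ) - 1) * δ) (i * δ)) :=
    norm_setIntegral_le_of_norm_le_const (by simp) fun r _ => hC r ω j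
  have h2 : volume.real (Ioc (((i : ℝ) - 1) * δ) (i * δ)) = δ := by
    rw [Real.volume_real_Ioc_of_le (by nlinarith)]; ring
  rw [h2, Real.norm_eq_abs] at h1
  rw [prevAvg, abs_mul, abs_of_pos (inv_pos.2 hδ), inv_mul_le_iff₀ hδ]
  linarith

theorem ae_tendsto_prevAvg {f : ℝ → ℝ} (hf : LocallyIntegrable f volume) {T : ℝ} (hT : 0 < T) :
    ∀ᵐ r, r ∈ Ioc 0 T → Tendsto (fun k : ℕ => (T / (k + 1))⁻¹ *
      ∫ y in Ioc (((cellIdx (T / (k + 1)) r : ℝ) - 1) * (T / (k + 1)))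
        (cellIdx (T / (k + 1)) r * (T / (k + 1))), f y) atTop (nhds (f r)) := by
  filter_upwards [IsUnifLocDoublingMeasure.ae_tendsto_average volume hf 3] with r hr hrT
  have hδ : ∀ k : ℕ, 0 < T / ((k : ℝ) + 1) := fun k => by positivity
  have hlim : Tendsto (fun k : ℕ => T / ((k : ℝ) + 1) / 2) atTop (nhdsWithin 0 (Ioi 0)) := by
    refine tendsto_nhdsWithin_iff.2 ⟨?_, Eventually.of_forall fun k => half_pos (hδ k)⟩
    have := (tendsto_const_nhds (x := T)).div_atTop
      (tendsto_atTop_add_const_right _ (1 : ℝ) tendsto_natCast_atTop_atTop)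
    simpa using this.div_const 2
  have := hr (fun k : ℕ => ((cellIdx (T / (k + 1)) r : ℝ) - 1 / 2) * (T / (k + 1)))
    (fun k : ℕ => T / ((k : ℝ) + 1) / 2) hlim (Eventually.of_forall fun k => ?_)
  · refine this.congr fun k => ?_
    rw [setAverage_eq, Real.closedBall_eq_Icc, integral_Icc_eq_integral_Ioc, smul_eq_mul]
    congr 2
    · rw [Real.volume_real_Icc_of_le (by linarith [hδ k])]; ring
    · congr 2 <;> ring
  · have h1 := (mem_cell_iff (hδ k) (r := r) (i := cellIdx _ r)).2 ⟨hrT.1, rfl⟩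
    rw [Real.closedBall_eq_Icc]
    constructor
    · nlinarith [h1.1, hδ k]
    · nlinarith [h1.2, hδ k]

theorem eLpNorm_two_sq {α E : Type*} [MeasurableSpace α] {μ : Measure α} [NormedAddCommGroup E]
    (f : α → E) : eLpNorm f 2 μ ^ 2 = ∫⁻ x, ‖f x‖ₑ ^ 2 ∂μ := by
  have := eLpNorm_nnreal_pow_eq_lintegral (f := f) (μ := μ) (p := 2) (by norm_num)
  simpa using this

theorem ENNReal.tendsto_zero_of_tendsto_sq_zero {ι : Type*} {l : Filter ι} {u : ι → ENNReal}
    (h : Tendsto (fun i => u i ^ 2) l (nhds 0)) : Tendsto u l (nhds 0) := by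
  have := (ENNReal.continuous_rpow_const (y := 1 / 2)).tendsto 0 |>.comp h
  simp only [one_div, inv_pos, Nat.ofNat_pos, ENNReal.zero_rpow_of_pos] at this
  refine this.congr fun i => ?_
  simp only [Function.comp]
  rw [← ENNReal.rpow_natCast, ← ENNReal.rpow_mul]
  norm_num

theorem tendsto_eLpNorm_prod_zero {Ω E : Type*} [MeasurableSpace Ω] {P : Measure Ω}
    [IsProbabilityMeasure P] [NormedAddCommGroup E] [MeasurableSpace E] [OpensMeasurableSpace E]
    {f : ℕ → ℝ × Ω → E} (hf : ∀ k, Measurable (f k)) {C T : ℝ} (hC : ∀ k q, ‖f k q‖ ≤ C)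
    (hs : ∀ k q, q.1 ∉ Ioc 0 T → f k q = 0)
    (hlim : ∀ᵐ ω ∂P, ∀ᵐ r : ℝ, Tendsto (fun k => f k (r, ω)) atTop (nhds 0)) :
    Tendsto (fun k => eLpNorm (f k) 2 ((volume : Measure ℝ).prod P)) atTop (nhds 0) := by
  refine ENNReal.tendsto_zero_of_tendsto_sq_zero ?_
  simp_rw [eLpNorm_two_sq]
  have hm : ∀ k, Measurable fun q => ‖f k q‖ₑ ^ 2 := fun k => (hf k).enorm.pow_const 2
  have hb : ∀ k q, ‖f k q‖ₑ ^ 2 ≤ (Ioc 0 T).indicator (fun _ => ENNReal.ofReal C ^ 2) q.1 := by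
    intro k q
    by_cases hq : q.1 ∈ Ioc 0 T
    · rw [indicator_of_mem hq, ← ofReal_norm]
      gcongr
      exact hC k q
    · simp [hs k q hq]
  have hfin : ∫⁻ r : ℝ, (Ioc 0 T).indicator (fun _ => ENNReal.ofReal C ^ 2) r ≠ ⊤ := by
    rw [lintegral_indicator measurableSet_Ioc, setLIntegral_const]
    exact ENNReal.mul_ne_top (by simp) (by simp)
  have e : ∀ k, ∫⁻ q, ‖f k q‖ₑ ^ 2 ∂((volume : Measure ℝ).prod P)
      = ∫⁻ ω, (∫⁻ r, ‖f k (r, ω)‖ₑ ^ 2) ∂P := fun k => lintegral_prod_symm' _ (hm k)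
  simp_rw [e]
  have hin : ∀ᵐ ω ∂P, Tendsto (fun k => ∫⁻ r, ‖f k (r, ω)‖ₑ ^ 2) atTop (nhds 0) := by
    filter_upwards [hlim] with ω hω
    have := tendsto_lintegral_of_dominated_convergence (μ := (volume : Measure ℝ))
      (F := fun k r => ‖f k (r, ω)‖ₑ ^ 2) (f := fun _ => 0) _
      (fun k => (hm k).comp measurable_prodMk_right) (fun k => ae_of_all _ fun r => hb k (r, ω))
      hfin ?_
    · simpa using this
    · filter_upwards [hω] with r hr
      simpa using ENNReal.Tendsto.pow (n := 2) hr.enorm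
  have := tendsto_lintegral_of_dominated_convergence (μ := P)
    (F := fun k ω => ∫⁻ r, ‖f k (r, ω)‖ₑ ^ 2) (f := fun _ => 0)
    (fun _ => ∫⁻ r : ℝ, (Ioc 0 T).indicator (fun _ => ENNReal.ofReal C ^ 2) r)
    (fun k => (hm k).lintegral_prod_left') (fun k => ae_of_all _ fun ω => lintegral_mono fun r =>
      hb k (r, ω)) (by simpa using hfin) hin
  simpa using this

/-- The step process of preceding-cell averages on the uniform grid of `(0, T]` with `k + 1`
cells. -/
def avgStep {Ω : Type*} {d : ℕ} (T : ℝ) (k : ℕ) (h : ℝ → Ω → Fin d → ℝ) : ℝ → Ω → Fin d → ℝ :=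
  gridStep (T / (k + 1)) (k + 1) (prevAvg (T / (k + 1)) h)

theorem measurable_cellIdx (δ : ℝ) : Measurable (cellIdx δ) :=
  (Measurable.of_discrete (f := fun n : ℕ => n - 1)).comp
    (Nat.measurable_ceil.comp (measurable_id.div_const δ))

theorem measurable_gridStep {Ω : Type*} [MeasurableSpace Ω] {d : ℕ} (δ : ℝ) (N : ℕ)
    {ψ : ℕ → Ω → Fin d → ℝ} (hψ : ∀ i, Measurable (ψ i)) :
    Measurable (fun q : ℝ × Ω => gridStep δ N ψ q.1 q.2) := by
  refine Measurable.ite (measurable_fst measurableSet_Ioc) ?_ measurable_const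
  have h1 : Measurable (fun p : Ω × ℕ => ψ p.2 p.1) := measurable_from_prod_countable_left hψ
  exact h1.comp (measurable_snd.prodMk ((measurable_cellIdx δ).comp measurable_fst))

theorem abs_gridStep_le {Ω : Type*} {d : ℕ} {δ : ℝ} {N : ℕ} {ψ : ℕ → Ω → Fin d → ℝ} {C : ℝ}
    (hC : ∀ i ω j, |ψ i ω j| ≤ C) (r : ℝ) (ω : Ω) (j : Fin d) : |gridStep δ N ψ r ω j| ≤ C := by
  rw [gridStep]
  split_ifs
  · exact hC _ _ _
  · simpa using (abs_nonneg _).trans (hC 0 ω j)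

theorem avgStep_eq_of_notMem {Ω : Type*} {d : ℕ} {T : ℝ} (k : ℕ) (h : ℝ → Ω → Fin d → ℝ) {r : ℝ}
    (hr : r ∉ Ioc 0 T) (ω : Ω) : avgStep T k h r ω = 0 := by
  have hN : ((k + 1 : ℕ) : ℝ) * (T / ((k : ℝ) + 1)) = T := by
    push_cast; field_simp
  simp only [avgStep, gridStep, hN, hr, if_false]

theorem avgStep_eq_of_mem {Ω : Type*} {d : ℕ} {T : ℝ} (k : ℕ) (h : ℝ → Ω → Fin d → ℝ) {r : ℝ}
    (hr : r ∈ Ioc 0 T) (ω : Ω) :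
    avgStep T k h r ω = prevAvg (T / (k + 1)) h (cellIdx (T / (k + 1)) r) ω := by
  have hN : ((k + 1 : ℕ) : ℝ) * (T / ((k : ℝ) + 1)) = T := by
    push_cast; field_simp
  simp only [avgStep, gridStep, hN, hr, if_true]

theorem BddProg.locallyIntegrable {Ω : Type*} [mΩ : MeasurableSpace Ω] {d : ℕ}
    {F : ℝ → MeasurableSpace Ω} (hF : ∀ s, F s ≤ mΩ) {C T : ℝ} {h : ℝ → Ω → Fin d → ℝ}
    (hh : BddProg F C T h) (ω : Ω) (j : Fin d) : LocallyIntegrable (fun r => h r ω j) volume := by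
  have hm : Measurable fun r => h r ω j := (measurable_pi_apply j).comp
    ((hh.measurable_uncurry hF).comp measurable_prodMk_right)
  refine (locallyIntegrable_const C).mono hm.aestronglyMeasurable (ae_of_all _ fun r => ?_)
  exact (hh.bdd r ω j).trans (le_abs_self _)

theorem BddProg.ae_tendsto_avgStep {Ω : Type*} [mΩ : MeasurableSpace Ω] {d : ℕ}
    {F : ℝ → MeasurableSpace Ω} (hF : ∀ s, F s ≤ mΩ) {C T : ℝ}
    (hT : 0 < T) {h : ℝ → Ω → Fin d → ℝ} (hh : BddProg F C T h) (ω : Ω) :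
    ∀ᵐ r : ℝ, Tendsto (fun k => avgStep T k h r ω) atTop (nhds (h r ω)) := by
  filter_upwards [ae_all_iff.2 fun j =>
    ae_tendsto_prevAvg (hh.locallyIntegrable hF ω j) hT] with r hr
  by_cases hrT : r ∈ Ioc 0 T
  · refine tendsto_pi_nhds.2 fun j => (hr j hrT).congr fun k => ?_
    rw [avgStep_eq_of_mem k h hrT, prevAvg]
  · rw [hh.supp r ω hrT]
    exact tendsto_const_nhds.congr fun k => (avgStep_eq_of_notMem k h hrT ω).symm

theorem abs_avgStep_le {Ω : Type*} {d : ℕ} {C T : ℝ} (hT : 0 < T) {h : ℝ → Ω → Fin d → ℝ}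
    (hC : ∀ r ω j, |h r ω j| ≤ C) (k : ℕ) : ∀ r ω j, |avgStep T k h r ω j| ≤ C :=
  abs_gridStep_le (abs_prevAvg_le (by positivity) hC)

theorem BddProg.measurable_avgStep {Ω : Type*} [mΩ : MeasurableSpace Ω] {d : ℕ}
    {F : ℝ → MeasurableSpace Ω} (hF : ∀ s, F s ≤ mΩ) {C T : ℝ}
    (hT : 0 < T) {h : ℝ → Ω → Fin d → ℝ} (hh : BddProg F C T h) (k : ℕ) :
    Measurable (fun q : ℝ × Ω => avgStep T k h q.1 q.2) :=
  measurable_gridStep _ _ fun i => (hh.measurable_prevAvg (by positivity) i).mono (hF _) le_rfl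

theorem BddProg.tendsto_avgStep {Ω : Type*} [mΩ : MeasurableSpace Ω] {d : ℕ} {P : Measure Ω}
    [IsProbabilityMeasure P] {F : ℝ → MeasurableSpace Ω} (hF : ∀ s, F s ≤ mΩ) {C T : ℝ}
    (hT : 0 < T) {h : ℝ → Ω → Fin d → ℝ} (hh : BddProg F C T h) :
    Tendsto (fun k => eLpNorm (toEuclid (avgStep T k h) - toEuclid h) 2
      ((volume : Measure ℝ).prod P)) atTop (nhds 0) := by
  refine tendsto_eLpNorm_prod_zero (C := d * C + d * C) (T := T) (fun k => ?_) (fun k q => ?_)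
    (fun k q hq => ?_) (ae_of_all _ fun ω => ?_)
  · exact ((WithLp.measurable_toLp 2 _).comp (hh.measurable_avgStep hF hT k)).sub
      (hh.measurable_toEuclid hF)
  · exact (norm_sub_le _ _).trans (add_le_add (BddProg.norm_toEuclid_le
      (abs_avgStep_le hT hh.bdd k) q) (BddProg.norm_toEuclid_le hh.bdd q))
  · simp only [Pi.sub_apply, toEuclid, avgStep_eq_of_notMem k h hq, hh.supp _ q.2 hq, sub_self]
  · filter_upwards [hh.ae_tendsto_avgStep hF hT ω] with r hr
    have : Tendsto (fun k => toEuclid (avgStep T k h) (r, ω)) atTop (nhds (toEuclid h (r, ω))) :=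
      ((PiLp.continuous_toLp 2 _).tendsto _).comp hr
    simpa using this.sub_const (toEuclid h (r, ω))

theorem unifIntegrable_of_eLpNorm_two_le {α ι : Type*} [MeasurableSpace α] {μ : Measure α}
    {f : ι → α → ℝ} (hf : ∀ i, AEStronglyMeasurable (f i) μ)
    {M : NNReal} (hM : ∀ i, eLpNorm (f i) 2 μ ≤ M) : UnifIntegrable f 1 μ := by
  intro ε hε
  refine ⟨(ε / (M + 1)) ^ 2, by positivity, fun i s hs hμ => ?_⟩
  rw [eLpNorm_indicator_eq_eLpNorm_restrict hs]
  refine (eLpNorm_le_eLpNorm_mul_rpow_measure_univ (p := 1) (q := 2) (by norm_num)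
    (hf i).restrict).trans ?_
  have h1 : eLpNorm (f i) 2 (μ.restrict s) ≤ M :=
    (eLpNorm_mono_measure _ Measure.restrict_le_self).trans (hM i)
  have h2 : (μ.restrict s) univ ^ (1 / (1 : ENNReal).toReal - 1 / (2 : ENNReal).toReal)
      ≤ ENNReal.ofReal (ε / (M + 1)) := by
    have e : (1 / (1 : ENNReal).toReal - 1 / (2 : ENNReal).toReal) = (1 / 2 : ℝ) := by norm_num
    rw [e, Measure.restrict_apply_univ]
    refine (ENNReal.rpow_le_rpow hμ (by norm_num)).trans ?_
    rw [ENNReal.ofReal_rpow_of_nonneg (by positivity) (by norm_num), ← Real.sqrt_eq_rpow,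
      Real.sqrt_sq (by positivity)]
  refine (mul_le_mul' h1 h2).trans ?_
  rw [← ENNReal.ofReal_coe_nnreal, ← ENNReal.ofReal_mul M.coe_nonneg]
  refine ENNReal.ofReal_le_ofReal ?_
  rw [mul_div_assoc', div_le_iff₀ (by positivity)]
  nlinarith [M.coe_nonneg]

theorem tendsto_eLpNorm_one_of_tendstoInMeasure {α : Type*} [MeasurableSpace α] {μ : Measure α}
    [IsFiniteMeasure μ] {f : ℕ → α → ℝ} {g : α → ℝ} (hf : ∀ i, AEStronglyMeasurable (f i) μ)
    {M : NNReal} (hM : ∀ i, eLpNorm (f i) 2 μ ≤ M) (hfg : TendstoInMeasure μ f atTop g) :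
    eLpNorm g 2 μ ≤ M ∧ Tendsto (fun n => eLpNorm (f n - g) 1 μ) atTop (nhds 0) := by
  have h1 : eLpNorm g 2 μ ≤ M := by
    obtain ⟨ns, _, hae⟩ := hfg.exists_seq_tendsto_ae
    refine (Lp.eLpNorm_lim_le_liminf_eLpNorm (fun n => hf (ns n)) _ hae).trans ?_
    exact liminf_le_of_frequently_le' (Eventually.frequently (Eventually.of_forall fun n =>
      hM (ns n)))
  have mg : AEStronglyMeasurable g μ :=
    (TendstoInMeasure.aemeasurable (fun k => (hf k).aemeasurable) hfg).aestronglyMeasurable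
  have m2 : MemLp g 2 μ := ⟨mg, h1.trans_lt ENNReal.coe_lt_top⟩
  exact ⟨h1, tendsto_Lp_finite_of_tendstoInMeasure le_rfl ENNReal.one_ne_top hf
    (m2.mono_exponent (by norm_num)) (unifIntegrable_of_eLpNorm_two_le hf hM) hfg⟩

theorem MeasureTheory.Measure.ext_of_lintegral_exp {d : ℕ} {μ ν : Measure (Fin d → ℝ)}
    [IsFiniteMeasure μ] [IsFiniteMeasure ν]
    (h : ∀ ξ : Fin d → ℝ, ∫⁻ x, ENNReal.ofReal (Real.exp (∑ j, ξ j * x j)) ∂μ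
      = ∫⁻ x, ENNReal.ofReal (Real.exp (∑ j, ξ j * x j)) ∂ν)
    (hfin : ∀ ξ : Fin d → ℝ, ∫⁻ x, ENNReal.ofReal (Real.exp (∑ j, ξ j * x j)) ∂μ ≠ ⊤) :
    μ = ν := by
  have hinteg : ∀ (L : StrongDual ℝ (Fin d → ℝ)) (t : ℝ),
      Integrable (fun x => Real.exp (t * L x)) μ ∧
      ∫ x, Real.exp (t * L x) ∂μ = ∫ x, Real.exp (t * L x) ∂ν := by
    intro L t
    have e : ∀ x, t * L x = ∑ j, (t * L (Pi.single j 1)) * x j := fun x => by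
      conv_lhs => rw [← Finset.univ_sum_single x, _root_.map_sum, Finset.mul_sum]
      refine Finset.sum_congr rfl fun j _ => ?_
      have : Pi.single j (x j) = x j • (Pi.single j (1 : ℝ) : Fin d → ℝ) := by
        rw [← Pi.single_smul]; simp
      rw [this, map_smul, smul_eq_mul]; ring
    rw [show (fun x => Real.exp (t * L x)) = fun x => Real.exp (∑ j, (t * L (Pi.single j 1)) * x j)
      from funext fun x => by rw [e]]
    have hm : Measurable fun x : Fin d → ℝ => Real.exp (∑ j, (t * L (Pi.single j 1)) * x j) := by
      fun_prop
    refine ⟨⟨hm.aestronglyMeasurable, ?_⟩, ?_⟩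
    · rw [hasFiniteIntegral_iff_ofReal (ae_of_all _ fun x => (Real.exp_pos _).le)]
      exact (hfin _).lt_top
    · rw [integral_eq_lintegral_of_nonneg_ae (ae_of_all _ fun x => (Real.exp_pos _).le)
        hm.aestronglyMeasurable, integral_eq_lintegral_of_nonneg_ae
        (ae_of_all _ fun x => (Real.exp_pos _).le) hm.aestronglyMeasurable, h]
  have h0 : μ univ = ν univ := by simpa using h 0
  refine Measure.ext_of_charFunDual (funext fun L => ?_)
  rw [charFunDual_eq_charFun_map_one, charFunDual_eq_charFun_map_one,
    ← complexMGF_mul_I (by fun_prop), ← complexMGF_mul_I (by fun_prop)]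
  refine eqOn_complexMGF_of_mgf' (funext fun t => (hinteg L t).2) ?_ ?_
  · rw [← Measure.measure_univ_eq_zero, ← Measure.measure_univ_eq_zero, h0]
  · have : integrableExpSet L μ = univ := by
      ext t; simpa [integrableExpSet] using (hinteg L t).1
    simp [this]

/-- The logarithm of the discrete exponential martingale between grid indices `p` and `N`. -/
def gridExp {Ω : Type*} {d : ℕ} (B : ℝ → Ω → Fin d → ℝ) (δ : ℝ) (ψ : ℕ → Ω → Fin d → ℝ)
    (p N : ℕ) (ω : Ω) : ℝ :=
  ∑ i ∈ Finset.Ico p N, (∑ j, ψ i ω j * (B ((i + 1) * δ) ω j - B (i * δ) ω j)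
    - ∑ j, ψ i ω j ^ 2 * δ / 2)

namespace IsFilteredBM
variable {Ω : Type*} [mΩ : MeasurableSpace Ω] {d : ℕ} {P : Measure Ω}
    {F : ℝ → MeasurableSpace Ω} {B : ℝ → Ω → Fin d → ℝ} {δ : ℝ} {ψ : ℕ → Ω → Fin d → ℝ}

theorem measurable_gridExp (h : IsFilteredBM P F B) (hδ : 0 ≤ δ)
    (hψ : ∀ i : ℕ, Measurable[F (i * δ)] (ψ i)) (p N : ℕ) :
    Measurable[F (N * δ)] (gridExp B δ ψ p N) := by
  suffices hm : ∀ i ∈ Finset.Ico p N, Measurable[F (N * δ)] (ψ i) ∧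
      Measurable[F (N * δ)] (B ((i + 1) * δ)) ∧ Measurable[F (N * δ)] (B (i * δ)) by
    let _ := F (N * δ)
    unfold gridExp
    refine Finset.measurable_sum _ fun i hi => ?_
    obtain ⟨m0, m1, m2⟩ := hm i hi
    fun_prop
  intro i hi
  have hiN : ((i : ℝ) + 1) ≤ N := by exact_mod_cast (Finset.mem_Ico.1 hi).2
  have h1 : ((i : ℝ) + 1) * δ ≤ N * δ := mul_le_mul_of_nonneg_right hiN hδ
  have h2 : (i : ℝ) * δ ≤ N * δ := mul_le_mul_of_nonneg_right (by linarith) hδ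
  exact ⟨(hψ i).mono (h.mono _ _ h2) le_rfl, h.measurable_adapted (by positivity) h1,
    h.measurable_adapted (by positivity) h2⟩

theorem lintegral_mul_gridExp [IsProbabilityMeasure P] (h : IsFilteredBM P F B) (hδ : 0 < δ)
    (hψ : ∀ i : ℕ, Measurable[F (i * δ)] (ψ i)) {p N : ℕ} (hpN : p ≤ N) {η : Ω → ENNReal}
    (hη : Measurable[F (p * δ)] η) :
    ∫⁻ ω, η ω * ENNReal.ofReal (Real.exp (gridExp B δ ψ p N ω)) ∂P = ∫⁻ ω, η ω ∂P := by
  induction N, hpN using Nat.le_induction with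
  | base => simp [gridExp]
  | succ N hpN ih =>
    rw [← ih]
    have hle : (p : ℝ) * δ ≤ N * δ := by gcongr
    have hm : Measurable[F (N * δ)]
        (fun ω => η ω * ENNReal.ofReal (Real.exp (gridExp B δ ψ p N ω))) :=
      (hη.mono (h.mono _ _ hle) le_rfl).mul
        (ENNReal.measurable_ofReal.comp (Real.measurable_exp.comp
          (h.measurable_gridExp hδ.le hψ p N)))
    have := h.lintegral_exp_step (s := N * δ) (u := (N + 1) * δ) (by positivity) (by linarith)
      hm (hψ N)
    rw [← this]
    refine lintegral_congr fun ω => ?_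
    rw [gridExp, Finset.sum_Ico_succ_top hpN, Real.exp_add, ENNReal.ofReal_mul (Real.exp_pos _).le,
      ← mul_assoc, gridExp]
    have e1 : ((N : ℝ) + 1) * δ - N * δ = δ := by ring
    rw [e1]

theorem lintegral_gridExp_sq_le [IsProbabilityMeasure P] (h : IsFilteredBM P F B) (hδ : 0 < δ)
    (hψ : ∀ i : ℕ, Measurable[F (i * δ)] (ψ i)) {C : ℝ} (hC : ∀ i ω j, |ψ i ω j| ≤ C) (N : ℕ) :
    eLpNorm (fun ω => Real.exp (gridExp B δ ψ 0 N ω)) 2 P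
      ≤ (Real.exp (d * C ^ 2 * (N * δ))).toNNReal := by
  have hC2 : ∀ i ω j, ψ i ω j ^ 2 ≤ C ^ 2 := fun i ω j => sq_le_sq' (neg_le_of_abs_le (hC i ω j))
    (le_of_abs_le (hC i ω j))
  have h2ψ : ∀ i : ℕ, Measurable[F (i * δ)] (fun ω j => 2 * ψ i ω j) := fun i =>
    @measurable_pi_lambda _ _ _ (F (i * δ)) _ _ fun j =>
      ((measurable_pi_apply j).comp (hψ i)).const_mul 2
  have key := h.lintegral_mul_gridExp hδ h2ψ (Nat.zero_le N) (η := fun _ => 1) measurable_const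
  have hle : ∀ ω, ‖Real.exp (gridExp B δ ψ 0 N ω)‖ₑ ^ 2
      ≤ ENNReal.ofReal (Real.exp (d * C ^ 2 * (N * δ))) *
        (1 * ENNReal.ofReal (Real.exp (gridExp B δ (fun i ω j => 2 * ψ i ω j) 0 N ω))) := by
    intro ω
    rw [one_mul, ← ENNReal.ofReal_mul (Real.exp_pos _).le, ← ofReal_norm,
      ← ENNReal.ofReal_pow (norm_nonneg _), Real.norm_eq_abs, Real.abs_exp, ← Real.exp_nat_mul,
      ← Real.exp_add]
    refine ENNReal.ofReal_le_ofReal (Real.exp_le_exp.2 ?_)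
    have e : ((2 : ℕ) : ℝ) * gridExp B δ ψ 0 N ω
        = ∑ i ∈ Finset.Ico 0 N, ∑ j, ψ i ω j ^ 2 * δ
          + gridExp B δ (fun i ω j => 2 * ψ i ω j) 0 N ω := by
      simp only [gridExp, Finset.mul_sum, ← Finset.sum_add_distrib, ← Finset.sum_sub_distrib]
      refine Finset.sum_congr rfl fun i _ => Finset.sum_congr rfl fun j _ => ?_
      push_cast; ring
    rw [e]
    gcongr
    calc ∑ i ∈ Finset.Ico 0 N, ∑ j, ψ i ω j ^ 2 * δ
        ≤ ∑ i ∈ Finset.Ico 0 N, ∑ j : Fin d, C ^ 2 * δ := by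
          exact Finset.sum_le_sum fun i _ => Finset.sum_le_sum fun j _ =>
            mul_le_mul_of_nonneg_right (hC2 i ω j) hδ.le
      _ = d * C ^ 2 * (N * δ) := by simp; ring
  have h1 : 1 ≤ Real.exp (d * C ^ 2 * (N * δ)) := Real.one_le_exp (by positivity)
  have hsq : eLpNorm (fun ω => Real.exp (gridExp B δ ψ 0 N ω)) 2 P ^ 2
      ≤ ENNReal.ofReal (Real.exp (d * C ^ 2 * (N * δ))) ^ 2 := by
    rw [eLpNorm_two_sq]
    refine (lintegral_mono hle).trans ?_
    rw [lintegral_const_mul' _ _ ENNReal.ofReal_ne_top, key]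
    simp only [lintegral_const, measure_univ, mul_one]
    exact le_self_pow (by simpa using h1) two_ne_zero
  exact (ENNReal.pow_le_pow_left_iff two_ne_zero).1 hsq

end IsFilteredBM

theorem integral_comp_cellIdx {δ : ℝ} (hδ : 0 < δ) (c : ℕ → ℝ) (N : ℕ) :
    IntegrableOn (fun r => c (cellIdx δ r)) (Ioc 0 (N * δ)) ∧
      ∫ r in Ioc 0 (N * δ), c (cellIdx δ r) = ∑ i ∈ Finset.range N, c i * δ := by
  induction N with
  | zero => simp
  | succ N ih =>
    have hN : (0 : ℝ) ≤ N * δ := by positivity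
    have hN' : (N : ℝ) * δ ≤ (N + 1) * δ := by nlinarith
    have eqo : EqOn (fun r => c (cellIdx δ r)) (fun _ => c N) (Ioc (N * δ) ((N + 1) * δ)) := by
      intro r hr
      simp only [((mem_cell_iff hδ).1 hr).2]
    have hi : IntegrableOn (fun r => c (cellIdx δ r)) (Ioc (N * δ) ((N + 1) * δ)) :=
      (integrableOn_congr_fun eqo measurableSet_Ioc).2 (integrableOn_const (by simp) (by simp))
    have hv : ∫ r in Ioc (N * δ) ((N + 1) * δ), c (cellIdx δ r) = c N * δ := by
      rw [setIntegral_congr_fun measurableSet_Ioc eqo, setIntegral_const,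
        Real.volume_real_Ioc_of_le hN', smul_eq_mul]
      ring
    push_cast
    rw [← Ioc_union_Ioc_eq_Ioc hN hN', Finset.sum_range_succ]
    refine ⟨ih.1.union hi, ?_⟩
    rw [setIntegral_union (Ioc_disjoint_Ioc_of_le le_rfl) measurableSet_Ioc ih.1 hi, ih.2, hv]

theorem timeTrunc_avgStep {Ω : Type*} {d : ℕ} (T : ℝ) (k : ℕ) (h : ℝ → Ω → Fin d → ℝ) :
    timeTrunc T (avgStep T k h) = avgStep T k h := by
  ext1 r
  ext1 ω
  rw [timeTrunc]
  split_ifs with hr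
  · rfl
  · rw [avgStep_eq_of_notMem k h hr]

namespace BddProg
variable {Ω : Type*} [mΩ : MeasurableSpace Ω] {d : ℕ} {P : Measure Ω}
  {F : ℝ → MeasurableSpace Ω} {B : ℝ → Ω → Fin d → ℝ} {C T : ℝ} {h : ℝ → Ω → Fin d → ℝ}

theorem tendsto_sum_prevAvg_sq (hF : ∀ s, F s ≤ mΩ) (hT : 0 < T) (hh : BddProg F C T h) (ω : Ω) :
    Tendsto (fun k : ℕ => ∑ i ∈ Finset.range (k + 1),
      ∑ j, prevAvg (T / (k + 1)) h i ω j ^ 2 * (T / (k + 1))) atTop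
      (nhds (∫ r in Ioc 0 T, ∑ j, h r ω j ^ 2)) := by
  have e : ∀ k : ℕ, ∑ i ∈ Finset.range (k + 1),
      ∑ j, prevAvg (T / (k + 1)) h i ω j ^ 2 * (T / (k + 1))
      = ∫ r in Ioc 0 T, ∑ j, avgStep T k h r ω j ^ 2 := by
    intro k
    have hN : ((k + 1 : ℕ) : ℝ) * (T / ((k : ℝ) + 1)) = T := by
      push_cast; field_simp
    have := (integral_comp_cellIdx (δ := T / (k + 1)) (by positivity)
      (fun i => ∑ j, prevAvg (T / (k + 1)) h i ω j ^ 2) (k + 1)).2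
    rw [hN] at this
    refine (Finset.sum_congr rfl fun i _ => (Finset.sum_mul _ _ _).symm).trans (this.symm.trans ?_)
    refine setIntegral_congr_fun measurableSet_Ioc fun r hr => ?_
    simp only [avgStep_eq_of_mem k h hr]
  simp_rw [e]
  refine tendsto_integral_of_dominated_convergence (fun _ => d * C ^ 2) (fun k => ?_) ?_
    (fun k => ae_of_all _ fun r => ?_) ?_
  · have : Measurable fun r => avgStep T k h r ω :=
      (hh.measurable_avgStep hF hT k).comp measurable_prodMk_right
    have : Measurable fun r => ∑ j, avgStep T k h r ω j ^ 2 := by fun_prop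
    exact this.aestronglyMeasurable
  · exact integrable_const _
  · rw [Real.norm_of_nonneg (Finset.sum_nonneg fun _ _ => sq_nonneg _)]
    refine (Finset.sum_le_sum fun j _ => (sq_le_sq' (neg_le_of_abs_le
      (abs_avgStep_le hT hh.bdd k r ω j)) (le_of_abs_le (abs_avgStep_le hT hh.bdd k r ω j)))).trans ?_
    simp
  · filter_upwards [ae_restrict_of_ae (hh.ae_tendsto_avgStep hF hT ω)] with r hr
    exact tendsto_finsetSum _ fun j _ => (tendsto_pi_nhds.1 hr j).pow 2

theorem isIto_gridInt [IsProbabilityMeasure P] (hB : IsFilteredBM P F B) (hT : 0 < T)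
    (hh : BddProg F C T h) (k : ℕ) (s : ℝ) :
    IsIto P F B (toEuclid (timeTrunc s (avgStep T k h)))
      (gridInt B (T / (k + 1)) (k + 1) (prevAvg (T / (k + 1)) h) s) :=
  IsIto.of_mem_simpleSpan hB (gridInt_mem_simpleSpan (by positivity) (k + 1)
    (fun i => hh.measurable_prevAvg (by positivity) i) (abs_prevAvg_le (by positivity) hh.bdd) s)

theorem exists_isIto [IsProbabilityMeasure P] (hB : IsFilteredBM P F B) (hT : 0 < T)
    (hh : BddProg F C T h) : ∃ J : Ω → ℝ, Measurable J ∧ IsIto P F B (toEuclid h) J := by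
  have h1 := fun k => hh.isIto_gridInt hB hT k T
  simp_rw [timeTrunc_avgStep] at h1
  obtain ⟨J, mJ, hJ, -⟩ := IsIto.exists_of_tendsto hB
    (hh.measurable_toEuclid hB.le).aestronglyMeasurable h1 (hh.tendsto_avgStep hB.le hT)
  exact ⟨J, mJ, hJ⟩

theorem tendsto_gridInt [IsProbabilityMeasure P] (hB : IsFilteredBM P F B) (hT : 0 < T)
    (hh : BddProg F C T h) {J : Ω → ℝ} (hJ : IsIto P F B (toEuclid h) J) :
    TendstoInMeasure P (fun k : ℕ => gridInt B (T / (k + 1)) (k + 1) (prevAvg (T / (k + 1)) h) T)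
      atTop J := by
  have h1 := fun k => hh.isIto_gridInt hB hT k T
  simp_rw [timeTrunc_avgStep] at h1
  refine tendstoInMeasure_of_tendsto_eLpNorm (p := 2) (by norm_num)
    (fun k => ((h1 k).memLp hB).2.1) (hJ.memLp hB).2.1 ?_
  refine (hh.tendsto_avgStep (P := P) hB.le hT).congr fun k => ?_
  have h2 := (h1 k).sub hB hJ
  exact (h2.eLpNorm_eq hB).symm

/-- The stochastic exponential is the limit of discrete exponential martingales. -/
theorem exists_tendsto_gridExp [IsProbabilityMeasure P] (hB : IsFilteredBM P F B) (hT : 0 < T)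
    (hh : BddProg F C T h) {J : Ω → ℝ} (hJ : IsIto P F B (toEuclid h) J) :
    TendstoInMeasure P (fun k : ℕ => fun ω => Real.exp (gridExp B (T / (k + 1))
      (prevAvg (T / (k + 1)) h) 0 (k + 1) ω)) atTop
      (fun ω => Real.exp (J ω - (∫ r in Ioc 0 T, ∑ j, h r ω j ^ 2) / 2)) := by
  have hm : ∀ k : ℕ, Measurable (gridExp B (T / (k + 1)) (prevAvg (T / (k + 1)) h) 0 (k + 1)) :=
    fun k => (hB.measurable_gridExp (by positivity)
      (fun i => hh.measurable_prevAvg (by positivity) i) 0 (k + 1)).mono (hB.le _) le_rfl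
  refine (exists_seq_tendstoInMeasure_atTop_iff (fun k =>
    (hm k).exp.aestronglyMeasurable)).2 fun ns hns => ?_
  obtain ⟨ms, hms, hae⟩ := ((hh.tendsto_gridInt hB hT hJ).comp hns.tendsto_atTop).exists_seq_tendsto_ae
  refine ⟨ms, hms, ?_⟩
  filter_upwards [hae] with ω hω
  have h2 := ((hh.tendsto_sum_prevAvg_sq hB.le hT ω).comp (hns.comp hms).tendsto_atTop).div_const 2
  refine ((Real.continuous_exp.tendsto _).comp (hω.sub h2)).congr fun i => ?_
  set k := ns (ms i)
  have hδ : (0 : ℝ) < T / (k + 1) := by positivity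
  have hN : ((k : ℝ) + 1) * (T / ((k : ℝ) + 1)) = T := by field_simp
  simp only [Function.comp, gridInt, gridExp, Nat.Ico_zero_eq_range]
  rw [Finset.sum_sub_distrib, Finset.sum_div]
  congr 2
  · refine Finset.sum_congr rfl fun l hl => ?_
    have hl' : ((l : ℝ) + 1) ≤ k + 1 := by exact_mod_cast Finset.mem_range.1 hl
    have h3 : ((l : ℝ) + 1) * (T / (k + 1)) ≤ T := by
      nth_rewrite 2 [← hN]; exact mul_le_mul_of_nonneg_right hl' hδ.le
    have h4 : (l : ℝ) * (T / (k + 1)) ≤ T := by linarith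
    simp only [k] at h3 h4 ⊢
    rw [min_eq_left h3, min_eq_left h4]
  · refine Finset.sum_congr rfl fun l hl => ?_
    rw [Finset.sum_div]

end BddProg

theorem tendsto_setLIntegral_ofReal_of_eLpNorm_one {α : Type*} [MeasurableSpace α] {μ : Measure α}
    {f : ℕ → α → ℝ} {g : α → ℝ} (hf : ∀ k, Integrable (f k) μ) (hf0 : ∀ k x, 0 ≤ f k x)
    (hg : Integrable g μ) (hg0 : ∀ x, 0 ≤ g x)
    (h : Tendsto (fun k => eLpNorm (f k - g) 1 μ) atTop (nhds 0)) (G : Set α) :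
    Tendsto (fun k => ∫⁻ x in G, ENNReal.ofReal (f k x) ∂μ) atTop
      (nhds (∫⁻ x in G, ENNReal.ofReal (g x) ∂μ)) := by
  have h1 := (ENNReal.continuous_ofReal.tendsto _).comp
    (tendsto_setIntegral_of_L1' g hg.1 (Eventually.of_forall hf) h G)
  rw [ofReal_integral_eq_lintegral_ofReal hg.integrableOn (ae_of_all _ hg0)] at h1
  refine h1.congr fun k => ?_
  exact ofReal_integral_eq_lintegral_ofReal (hf k).integrableOn (ae_of_all _ (hf0 k))

/-- The stochastic exponential of a bounded integrand, given its stochastic integral `J`. -/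
def stochExp {Ω : Type*} {d : ℕ} (T : ℝ) (h : ℝ → Ω → Fin d → ℝ) (J : Ω → ℝ) (ω : Ω) : ℝ :=
  Real.exp (J ω - (∫ r in Ioc 0 T, ∑ j, h r ω j ^ 2) / 2)

namespace BddProg
variable {Ω : Type*} [mΩ : MeasurableSpace Ω] {d : ℕ} {P : Measure Ω}
  {F : ℝ → MeasurableSpace Ω} {B : ℝ → Ω → Fin d → ℝ} {C T : ℝ} {h h' : ℝ → Ω → Fin d → ℝ}
  {J J' : Ω → ℝ}

theorem eLpNorm_stochExp_le [IsProbabilityMeasure P] (hB : IsFilteredBM P F B) (hT : 0 < T)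
    (hh : BddProg F C T h) (hJ : IsIto P F B (toEuclid h) J) :
    eLpNorm (stochExp T h J) 2 P ≤ (Real.exp (d * C ^ 2 * T)).toNNReal ∧ ∀ G,
    Tendsto (fun k : ℕ => ∫⁻ ω in G, ENNReal.ofReal (Real.exp (gridExp B (T / (k + 1))
      (prevAvg (T / (k + 1)) h) 0 (k + 1) ω)) ∂P) atTop
      (nhds (∫⁻ ω in G, ENNReal.ofReal (stochExp T h J ω) ∂P)) := by
  have hm : ∀ k : ℕ, Measurable (gridExp B (T / (k + 1)) (prevAvg (T / (k + 1)) h) 0 (k + 1)) :=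
    fun k => (hB.measurable_gridExp (by positivity)
      (fun i => hh.measurable_prevAvg (by positivity) i) 0 (k + 1)).mono (hB.le _) le_rfl
  have hM : ∀ k : ℕ, eLpNorm (fun ω => Real.exp (gridExp B (T / (k + 1))
      (prevAvg (T / (k + 1)) h) 0 (k + 1) ω)) 2 P ≤ (Real.exp (d * C ^ 2 * T)).toNNReal := by
    intro k
    have hδ : (0 : ℝ) < T / (k + 1) := by positivity
    have hN : ((k + 1 : ℕ) : ℝ) * (T / ((k : ℝ) + 1)) = T := by
      push_cast; field_simp
    have := hB.lintegral_gridExp_sq_le hδ (fun i => hh.measurable_prevAvg hδ.le i)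
      (abs_prevAvg_le hδ hh.bdd) (k + 1)
    rwa [hN] at this
  have h1 := hh.exists_tendsto_gridExp hB hT hJ
  obtain ⟨h2, h3⟩ := tendsto_eLpNorm_one_of_tendstoInMeasure
    (fun k => (hm k).exp.aestronglyMeasurable) hM h1
  have mg : AEStronglyMeasurable (stochExp T h J) P :=
    (TendstoInMeasure.aemeasurable (fun k => (hm k).exp.aemeasurable) h1).aestronglyMeasurable
  refine ⟨h2, fun G => ?_⟩
  have i2 : MemLp (stochExp T h J) 2 P := ⟨mg, h2.trans_lt ENNReal.coe_lt_top⟩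
  have i1 : ∀ k : ℕ, MemLp (fun ω => Real.exp (gridExp B (T / (k + 1))
      (prevAvg (T / (k + 1)) h) 0 (k + 1) ω)) 2 P := fun k =>
    ⟨(hm k).exp.aestronglyMeasurable, (hM k).trans_lt ENNReal.coe_lt_top⟩
  exact tendsto_setLIntegral_ofReal_of_eLpNorm_one (fun k => (i1 k).integrable (by norm_num))
    (fun k ω => (Real.exp_pos _).le) (i2.integrable (by norm_num))
    (fun ω => (Real.exp_pos _).le) h3 G

/-- The stochastic exponential is a martingale: integrands that agree up to time `s` have
stochastic exponentials with the same integrals over `F s`-measurable sets. -/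
theorem setLIntegral_stochExp_eq [IsProbabilityMeasure P] (hB : IsFilteredBM P F B) (hT : 0 < T)
    (hh : BddProg F C T h) (hJ : IsIto P F B (toEuclid h) J)
    (hh' : BddProg F C T h') (hJ' : IsIto P F B (toEuclid h') J') {s : ℝ}
    (hsT : s ≤ T) (heq : ∀ r ω, r ≤ s → h r ω = h' r ω) {G : Set Ω} (hG : MeasurableSet[F s] G) :
    ∫⁻ ω in G, ENNReal.ofReal (stochExp T h J ω) ∂P
      = ∫⁻ ω in G, ENNReal.ofReal (stochExp T h' J' ω) ∂P := by
  refine tendsto_nhds_unique ((hh.eLpNorm_stochExp_le hB hT hJ).2 G)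
    (((hh'.eLpNorm_stochExp_le hB hT hJ').2 G).congr fun k => ?_)
  have hδ : (0 : ℝ) < T / (k + 1) := by positivity
  set δ := T / ((k : ℝ) + 1)
  have hN : ((k : ℝ) + 1) * δ = T := by simp only [δ]; field_simp
  set p := ⌈s / δ⌉₊ with hp
  have hsp : s ≤ p * δ := by
    rw [← div_le_iff₀ hδ]; exact Nat.le_ceil _
  have hpN : p ≤ k + 1 := by
    refine Nat.ceil_le.2 ?_
    rw [div_le_iff₀ hδ]; push_cast; linarith
  have key : ∀ h : ℝ → Ω → Fin d → ℝ, BddProg F C T h →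
      ∫⁻ ω in G, ENNReal.ofReal (Real.exp (gridExp B δ (prevAvg δ h) 0 (k + 1) ω)) ∂P
      = ∫⁻ ω in G, ENNReal.ofReal (Real.exp (gridExp B δ (prevAvg δ h) 0 p ω)) ∂P := by
    intro h hh
    have hψ := fun i : ℕ => hh.measurable_prevAvg hδ.le i
    have mη : Measurable[F (p * δ)] (G.indicator fun ω =>
        ENNReal.ofReal (Real.exp (gridExp B δ (prevAvg δ h) 0 p ω))) := by
      have m1 := hB.measurable_gridExp hδ.le hψ 0 p
      exact (ENNReal.measurable_ofReal.comp (Real.measurable_exp.comp m1)).indicator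
        (hB.mono _ _ hsp _ hG)
    have := hB.lintegral_mul_gridExp hδ hψ hpN mη
    rw [← lintegral_indicator (hB.le _ _ hG), ← lintegral_indicator (hB.le _ _ hG), ← this]
    refine lintegral_congr fun ω => ?_
    by_cases hω : ω ∈ G
    · simp only [indicator_of_mem hω]
      rw [← ENNReal.ofReal_mul (Real.exp_pos _).le, ← Real.exp_add, gridExp, gridExp, gridExp,
        Finset.sum_Ico_consecutive _ (Nat.zero_le p) hpN]
    · simp only [indicator_of_notMem hω, zero_mul]
  rw [key h hh, key h' hh']
  refine lintegral_congr fun ω => ?_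
  have e : ∀ i ∈ Finset.Ico 0 p, prevAvg δ h' i ω = prevAvg δ h i ω := by
    intro i hi
    ext j
    refine congrArg (δ⁻¹ * ·) (setIntegral_congr_fun measurableSet_Ioc fun r hr => ?_)
    have h1 : (i : ℝ) * δ < s := by
      have := Nat.lt_ceil.1 (Finset.mem_Ico.1 hi).2
      rwa [lt_div_iff₀ hδ] at this
    simp only [heq r ω (hr.2.trans h1.le)]
  congr 2
  exact Finset.sum_congr rfl fun i hi => by rw [e i hi]

end BddProg

/-- The deterministic process equal to `ξ` on `(s, u]`. -/
def constOn {Ω : Type*} {d : ℕ} (s u : ℝ) (ξ : Fin d → ℝ) (r : ℝ) (_ω : Ω) : Fin d → ℝ :=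
  if r ∈ Ioc s u then ξ else 0

theorem bddProg_constOn {Ω : Type*} {d : ℕ} (F : ℝ → MeasurableSpace Ω) {s u T : ℝ} (hs : 0 ≤ s)
    (huT : u ≤ T) (ξ : Fin d → ℝ) :
    BddProg F (∑ j, |ξ j|) T (constOn (Ω := Ω) s u ξ) where
  prog t _ := by
    let _ := F t
    exact Measurable.ite ((by fun_prop : Measurable fun q : ℝ × Ω => max 0 (min q.1 t))
      measurableSet_Ioc) measurable_const measurable_const
  bdd r ω j := by
    rw [constOn]
    split_ifs
    · exact Finset.single_le_sum (f := fun j => |ξ j|) (fun _ _ => abs_nonneg _) (Finset.mem_univ j)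
    · simpa using Finset.sum_nonneg fun _ _ => abs_nonneg _
  supp r ω hr := if_neg fun h => hr ⟨hs.trans_lt h.1, h.2.trans huT⟩

theorem isIto_constOn {Ω : Type*} [mΩ : MeasurableSpace Ω] {d : ℕ} {P : Measure Ω}
    [IsProbabilityMeasure P] {F : ℝ → MeasurableSpace Ω} {B : ℝ → Ω → Fin d → ℝ}
    (hB : IsFilteredBM P F B) {s u : ℝ} (hs : 0 ≤ s) (hsu : s ≤ u) (ξ : Fin d → ℝ) :
    IsIto P F B (toEuclid (constOn s u ξ)) (fun ω => ∑ j, ξ j * (B u ω j - B s ω j)) := by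
  have hmem : ∑ j, itoGen B s u j (fun _ => ξ j) ∈ simpleSpan F B :=
    Submodule.sum_mem _ fun j _ => Submodule.subset_span
      ⟨s, u, j, _, hs, hsu, measurable_const, ⟨|ξ j|, fun _ => le_rfl⟩, rfl⟩
  have := IsIto.of_mem_simpleSpan hB hmem
  have e1 : (∑ j, itoGen B s u j (fun _ => ξ j)).1 = toEuclid (constOn s u ξ) := by
    ext q j
    simp only [Prod.fst_sum, Finset.sum_apply, itoGen, toEuclid, constOn]
    rw [WithLp.ofLp_sum, Finset.sum_apply]
    simp only [PiLp.single_apply, Finset.sum_ite_eq, Finset.mem_univ, if_true, indicator]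
    split_ifs <;> rfl
  have e2 : (∑ j, itoGen B s u j (fun _ => ξ j)).2 = fun ω => ∑ j, ξ j * (B u ω j - B s ω j) := by
    ext ω
    simp [Prod.snd_sum, itoGen]
  rwa [e1, e2] at this

namespace BddProg
variable {Ω : Type*} {d : ℕ} {F : ℝ → MeasurableSpace Ω} {C C' T : ℝ} {h h' : ℝ → Ω → Fin d → ℝ}
  {J : Ω → ℝ}

theorem mono (hh : BddProg F C T h) {C₁ T₁ : ℝ} (hC : C ≤ C₁) (hT : T ≤ T₁) :
    BddProg F C₁ T₁ h :=
  ⟨hh.prog, fun r ω j => (hh.bdd r ω j).trans hC,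
    fun r ω hr => hh.supp r ω fun h2 => hr ⟨h2.1, h2.2.trans hT⟩⟩

theorem sub (hh : BddProg F C T h) (hh' : BddProg F C' T h') :
    BddProg F (C + C') T (fun r ω => h r ω - h' r ω) where
  prog t ht := by
    have h1 := hh.prog t ht
    have h2 := hh'.prog t ht
    let _ := F t
    exact h1.sub h2
  bdd r ω j := (abs_sub _ _).trans (add_le_add (hh.bdd r ω j) (hh'.bdd r ω j))
  supp r ω hr := by rw [hh.supp r ω hr, hh'.supp r ω hr, sub_zero]

theorem stochExp_mono (hh : BddProg F C T h) {T₁ : ℝ} (hT : T ≤ T₁) :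
    stochExp T₁ h J = stochExp T h J := by
  ext ω
  rw [stochExp, stochExp]
  congr 3
  refine setIntegral_eq_of_subset_of_forall_sdiff_eq_zero measurableSet_Ioc
    (Ioc_subset_Ioc_right hT) fun r hr => ?_
  simp [hh.supp r ω hr.2]

variable [mΩ : MeasurableSpace Ω] {P : Measure Ω} {B : ℝ → Ω → Fin d → ℝ}

theorem integrableOn (hF : ∀ s, F s ≤ mΩ) (hh : BddProg F C T h) (ω : Ω) (j : Fin d) (a b : ℝ) :
    IntegrableOn (fun r => h r ω j) (Ioc a b) :=
  ((hh.locallyIntegrable hF ω j).integrableOn_isCompact (isCompact_Icc (a := a) (b := b))).mono_set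
    Ioc_subset_Icc_self

theorem continuous_setIntegral (hF : ∀ s, F s ≤ mΩ) (hh : BddProg F C T h) (ω : Ω) (j : Fin d) :
    Continuous fun s => ∫ r in Ioc 0 s, h r ω j := by
  have h1 := (intervalIntegral.continuous_primitive (μ := volume) (f := fun r => h r ω j)
    (fun a b => ⟨hh.integrableOn hF ω j a b, hh.integrableOn hF ω j b a⟩) 0).comp
    (by fun_prop : Continuous fun s : ℝ => max s 0)
  refine h1.congr fun s => ?_
  simp only [Function.comp, intervalIntegral.integral_of_le (le_max_right s 0)]
  rcases le_total s 0 with hs | hs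
  · rw [max_eq_right hs, Ioc_self, Ioc_eq_empty (not_lt.2 hs)]
  · rw [max_eq_left hs]

theorem measurable_stochExp (hF : ∀ s, F s ≤ mΩ) (hh : BddProg F C T h) (mJ : Measurable J) :
    Measurable (stochExp T h J) := by
  have h1 : Measurable (fun q : ℝ × Ω => ∑ j, h q.1 q.2 j ^ 2) := by
    have := hh.measurable_uncurry hF
    fun_prop
  exact (mJ.sub ((measurable_setIntegral_left h1 _).div_const 2)).exp

theorem isProbabilityMeasure_withDensity [IsProbabilityMeasure P] (hB : IsFilteredBM P F B)
    (hT : 0 < T) (hh : BddProg F C T h) (hJ : IsIto P F B (toEuclid h) J) :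
    IsProbabilityMeasure (P.withDensity fun ω => ENNReal.ofReal (stochExp T h J ω)) := by
  have h0 := bddProg_constOn (Ω := Ω) F le_rfl hT.le (0 : Fin d → ℝ) (u := 0)
  have h1 := isIto_constOn hB le_rfl le_rfl (0 : Fin d → ℝ) (s := 0) (u := 0)
  have key := (hh.mono (le_max_left C (∑ j : Fin d, |(0 : Fin d → ℝ) j|)) le_rfl).setLIntegral_stochExp_eq
    hB hT hJ (h0.mono (le_max_right _ _) le_rfl) h1 hT.le (s := 0) (fun r ω hr => by
      rw [hh.supp r ω (by simp [hr]), h0.supp r ω (by simp [hr])]) MeasurableSet.univ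
  refine ⟨?_⟩
  rw [withDensity_apply _ MeasurableSet.univ, key]
  simp [stochExp, constOn]

theorem stochExp_mul_exp (hF : ∀ s, F s ≤ mΩ) (hh : BddProg F C T h) {s u : ℝ} (hs : 0 ≤ s)
    (hsu : s ≤ u) (huT : u ≤ T) (ξ : Fin d → ℝ) (ω : Ω) :
    stochExp T h J ω * Real.exp (∑ j, ξ j * ((B u ω j - ∫ r in Ioc 0 u, h r ω j)
        - (B s ω j - ∫ r in Ioc 0 s, h r ω j)))
      = Real.exp (∑ j, ξ j ^ 2 * (u - s) / 2) * stochExp T (fun r ω => h r ω - constOn s u (-ξ) r ω)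
        (J - fun ω => ∑ j, (-ξ) j * (B u ω j - B s ω j)) ω := by
  have hm : Measurable fun r => h r ω := (hh.measurable_uncurry hF).comp measurable_prodMk_right
  have hsub : Ioc s u ⊆ Ioc 0 T := Ioc_subset_Ioc hs huT
  have e1 : ∀ j, ∫ r in Ioc 0 u, h r ω j
      = (∫ r in Ioc 0 s, h r ω j) + ∫ r in Ioc s u, h r ω j := fun j => by
    rw [← setIntegral_union (Ioc_disjoint_Ioc_of_le le_rfl) measurableSet_Ioc
      (hh.integrableOn hF ω j 0 s) (hh.integrableOn hF ω j s u), Ioc_union_Ioc_eq_Ioc hs hsu]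
  have i1 : ∀ j, IntegrableOn (fun r => h r ω j ^ 2) (Ioc 0 T) := fun j => by
    refine Measure.integrableOn_of_bounded (M := C ^ 2) (by simp) (by fun_prop)
      (ae_of_all _ fun r => ?_)
    rw [Real.norm_of_nonneg (sq_nonneg _)]
    exact sq_le_sq' (neg_le_of_abs_le (hh.bdd r ω j)) (le_of_abs_le (hh.bdd r ω j))
  have i2 : ∀ j, IntegrableOn (fun r => 2 * ξ j * h r ω j + ξ j ^ 2) (Ioc s u) := fun j =>
    ((hh.integrableOn hF ω j s u).const_mul _).add (integrableOn_const (by simp) (by simp))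
  have i3 : ∀ j, IntegrableOn ((Ioc s u).indicator fun r => 2 * ξ j * h r ω j + ξ j ^ 2)
      (Ioc 0 T) := fun j => ((integrable_indicator_iff measurableSet_Ioc).2 (i2 j)).integrableOn
  have e2 : ∫ r in Ioc 0 T, ∑ j, (h r ω - constOn s u (-ξ) r ω) j ^ 2
      = (∫ r in Ioc 0 T, ∑ j, h r ω j ^ 2)
        + ∑ j, (2 * ξ j * (∫ r in Ioc s u, h r ω j) + ξ j ^ 2 * (u - s)) := by
    rw [integral_finsetSum _ fun j _ => i1 j, ← Finset.sum_add_distrib]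
    have : ∀ r, ∑ j, (h r ω - constOn s u (-ξ) r ω) j ^ 2
        = ∑ j, (h r ω j ^ 2 + (Ioc s u).indicator (fun r => 2 * ξ j * h r ω j + ξ j ^ 2) r) := by
      intro r
      refine Finset.sum_congr rfl fun j _ => ?_
      simp only [constOn, indicator, Pi.sub_apply]
      split_ifs <;> [(simp; ring); simp]
    simp_rw [this]
    have i4 : ∀ j, IntegrableOn (fun r => h r ω j ^ 2
        + (Ioc s u).indicator (fun r => 2 * ξ j * h r ω j + ξ j ^ 2) r) (Ioc 0 T) :=
      fun j => (i1 j).add (i3 j)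
    rw [integral_finsetSum _ fun j _ => i4 j]
    refine Finset.sum_congr rfl fun j _ => ?_
    rw [integral_add (i1 j) (i3 j), setIntegral_indicator measurableSet_Ioc,
      inter_eq_right.2 hsub, integral_add ((hh.integrableOn hF ω j s u).const_mul _)
      (integrableOn_const (by simp) (by simp)), integral_const_mul, setIntegral_const,
      Real.volume_real_Ioc_of_le hsu, smul_eq_mul]
    ring
  rw [stochExp, stochExp, ← Real.exp_add, ← Real.exp_add, e2]
  congr 1
  simp only [e1, Pi.sub_apply, Pi.neg_apply, add_div, Finset.sum_div]
  have e4 : ∑ j, ξ j * (B u ω j - ((∫ r in Ioc 0 s, h r ω j) + ∫ r in Ioc s u, h r ω j)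
        - (B s ω j - ∫ r in Ioc 0 s, h r ω j))
      = ∑ j, ξ j ^ 2 * (u - s) / 2 - ∑ j, -ξ j * (B u ω j - B s ω j)
        - ∑ j, (2 * ξ j * (∫ r in Ioc s u, h r ω j) / 2 + ξ j ^ 2 * (u - s) / 2) := by
    rw [← Finset.sum_sub_distrib, ← Finset.sum_sub_distrib]
    refine Finset.sum_congr rfl fun j _ => ?_
    ring
  rw [e4]
  ring

/-- The Girsanov shift of a process by the time integral of `h`. -/
def _root_.girsanovShift {Ω : Type*} {d : ℕ} (B h : ℝ → Ω → Fin d → ℝ) (s : ℝ) (ω : Ω)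
    (j : Fin d) : ℝ := B s ω j - ∫ r in Ioc 0 s, h r ω j

theorem measurable_girsanovShift (hB : IsFilteredBM P F B) (hh : BddProg F C T h) {s : ℝ}
    (hs : 0 ≤ s) : Measurable[F s] (girsanovShift B h s) :=
  @measurable_pi_lambda _ _ _ (F s) _ _ fun j =>
    ((measurable_pi_apply j).comp (hB.measurable_adapted hs le_rfl)).sub
      (hh.measurable_setIntegral_coord hs 0 j)

theorem setLIntegral_exp_girsanovShift [IsProbabilityMeasure P] (hB : IsFilteredBM P F B)
    (hT : 0 < T) (hh : BddProg F C T h) (mJ : Measurable J) (hJ : IsIto P F B (toEuclid h) J)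
    {s u : ℝ} (hs : 0 ≤ s) (hsu : s ≤ u) {G : Set Ω} (hG : MeasurableSet[F s] G)
    (ξ : Fin d → ℝ) :
    ∫⁻ ω in G, ENNReal.ofReal (Real.exp (∑ j, ξ j * (girsanovShift B h u ω j
        - girsanovShift B h s ω j))) ∂(P.withDensity fun ω => ENNReal.ofReal (stochExp T h J ω))
      = ENNReal.ofReal (Real.exp (∑ j, ξ j ^ 2 * (u - s) / 2))
        * (P.withDensity fun ω => ENNReal.ofReal (stochExp T h J ω)) G := by
  have mG := hB.le _ _ hG
  have m1 := (hh.measurable_girsanovShift hB hs).mono (hB.le _) le_rfl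
  have m2 := (hh.measurable_girsanovShift hB (hs.trans hsu)).mono (hB.le _) le_rfl
  have hT₁ : T ≤ max T u := le_max_left _ _
  have hξ : (0 : ℝ) ≤ ∑ j, |(-ξ) j| := Finset.sum_nonneg fun j _ => abs_nonneg _
  have hh₁ := hh.mono (le_add_of_nonneg_right hξ) hT₁
  have hsub := (hh.mono le_rfl hT₁).sub (bddProg_constOn F hs (le_max_right T u) (-ξ))
  rw [setLIntegral_withDensity_eq_setLIntegral_mul _
    (hh.measurable_stochExp hB.le mJ).ennreal_ofReal (by fun_prop) mG,
    withDensity_apply _ mG, ← hh.stochExp_mono hT₁, ← hsub.setLIntegral_stochExp_eq hB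
    (hT.trans_le hT₁) (hJ.sub hB (isIto_constOn hB hs hsu (-ξ))) hh₁ hJ
    (hsu.trans (le_max_right _ _)) (fun r ω hr => ?_) hG,
    ← lintegral_const_mul' _ _ ENNReal.ofReal_ne_top]
  · refine lintegral_congr fun ω => ?_
    rw [Pi.mul_apply, ← ENNReal.ofReal_mul (Real.exp_pos _).le,
      ← ENNReal.ofReal_mul (show 0 ≤ stochExp _ h J ω from (Real.exp_pos _).le)]
    exact congrArg _ ((hh.mono le_rfl hT₁).stochExp_mul_exp hB.le hs hsu (le_max_right _ _) ξ ω)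
  · simp [constOn, hr.not_gt]

/-- Girsanov's theorem for bounded integrands. -/
theorem isFilteredBM_girsanovShift [IsProbabilityMeasure P] (hB : IsFilteredBM P F B)
    (hT : 0 < T) (hh : BddProg F C T h) (mJ : Measurable J) (hJ : IsIto P F B (toEuclid h) J) :
    IsFilteredBM (P.withDensity fun ω => ENNReal.ofReal (stochExp T h J ω)) F
      (girsanovShift B h) := by
  have hprob := hh.isProbabilityMeasure_withDensity hB hT hJ
  refine ⟨hB.mono, hB.le, fun ω => ?_, fun ω => ?_, fun s hs =>
    hh.measurable_girsanovShift hB hs, fun s u hs hsu => ?_⟩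
  · ext j
    simp [girsanovShift, hB.bm.1]
  · exact continuous_pi fun j => ((continuous_apply j).comp (hB.bm.2.1 ω)).sub
      (hh.continuous_setIntegral hB.le ω j)
  have m1 := (hh.measurable_girsanovShift hB hs).mono (hB.le _) le_rfl
  have m2 := (hh.measurable_girsanovShift hB (hs.trans hsu.le)).mono (hB.le _) le_rfl
  have mD : Measurable fun ω => girsanovShift B h u ω - girsanovShift B h s ω := m2.sub m1
  set P' := P.withDensity fun ω => ENNReal.ofReal (stochExp T h J ω) with hP'
  have key : ∀ G, MeasurableSet[F s] G →
      (P'.restrict G).map (fun ω => girsanovShift B h u ω - girsanovShift B h s ω)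
        = P' G • Measure.pi (fun _ : Fin d => gaussianReal 0 ((u - s).toNNReal)) := by
    intro G hG
    have e : ∀ ξ : Fin d → ℝ, ∫⁻ x, ENNReal.ofReal (Real.exp (∑ j, ξ j * x j))
        ∂((P'.restrict G).map (fun ω => girsanovShift B h u ω - girsanovShift B h s ω))
        = ENNReal.ofReal (Real.exp (∑ j, ξ j ^ 2 * (u - s) / 2)) * P' G := by
      intro ξ
      rw [lintegral_map (by fun_prop) mD]
      exact hh.setLIntegral_exp_girsanovShift hB hT mJ hJ hs hsu.le hG ξ
    have : IsFiniteMeasure (P' G • Measure.pi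
        (fun _ : Fin d => gaussianReal 0 ((u - s).toNNReal))) := by
      refine ⟨?_⟩
      simp
    refine Measure.ext_of_lintegral_exp (fun ξ => ?_) fun ξ => ?_
    · rw [e, lintegral_smul_measure, lintegral_exp_dot_pi_gaussianReal,
        Real.coe_toNNReal _ (sub_nonneg.2 hsu.le), smul_eq_mul, mul_comm]
    · rw [e]
      exact ENNReal.mul_ne_top ENNReal.ofReal_ne_top (measure_ne_top _ _)
  have hlaw : P'.map (fun ω => girsanovShift B h u ω - girsanovShift B h s ω)
      = Measure.pi (fun _ : Fin d => gaussianReal 0 ((u - s).toNNReal)) := by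
    have := key univ MeasurableSet.univ
    rwa [Measure.restrict_univ, measure_univ, one_smul] at this
  refine ⟨hlaw, (Indep_iff _ _ _).2 ?_⟩
  rintro _ G ⟨S, hS, rfl⟩ hG
  have h1 := congrArg (fun ν => ν S) (key G hG)
  simp only [Measure.smul_apply, smul_eq_mul] at h1
  rw [← hlaw, Measure.map_apply mD hS, Measure.map_apply mD hS,
    Measure.restrict_apply (mD hS)] at h1
  rw [h1, mul_comm]

end BddProg

/-- Dilation is continuous in `L¹` on bounded time intervals. -/
theorem tendsto_lintegral_dilation {E : Type*} [NormedAddCommGroup E] [NormedSpace ℝ E]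
    [MeasurableSpace E] [BorelSpace E] [SecondCountableTopology E] {f : ℝ → E} (hf : Measurable f)
    {C : ℝ} (hC : ∀ r, ‖f r‖ ≤ C) {y : ℝ} (hy : 0 < y) (T : ℝ) :
    Tendsto (fun c => ∫⁻ s in Ioc 0 T, ‖f (s * c) - f (s * y)‖ₑ) (nhds y) (nhds 0) := by
  set f₀ : ℝ → E := (Icc 0 (T * (2 * y))).indicator f with hf₀
  have i₀ : Integrable f₀ := (integrable_indicator_iff measurableSet_Icc).2
    (Measure.integrableOn_of_bounded (M := C) (by simp) hf.aestronglyMeasurable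
      (ae_of_all _ hC))
  have hsc : ∀ c : ℝ, c ≠ 0 → ∀ u : ℝ → ENNReal, Measurable u →
      ∫⁻ s, u (s * c) = ENNReal.ofReal |c⁻¹| * ∫⁻ s, u s := by
    intro c hc u hu
    rw [← lintegral_map hu (measurable_mul_const c), Real.map_volume_mul_right hc,
      lintegral_smul_measure, smul_eq_mul]
  rw [ENNReal.tendsto_nhds_zero]
  intro ε hε
  set K : ENNReal := ENNReal.ofReal (2 / y) with hK
  have hK0 : K ≠ 0 := by
    simp only [hK, ne_eq, ENNReal.ofReal_eq_zero, not_le]; positivity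
  have hKt : K ≠ ⊤ := ENNReal.ofReal_ne_top
  obtain ⟨g, hgs, hg, hgc, -⟩ := i₀.exists_hasCompactSupport_lintegral_sub_le (ε := ε / 3 / K)
    (by simp [hε.ne', hKt])
  obtain ⟨D, hD⟩ := hgs.exists_bound_of_continuous hgc
  have hmid : Tendsto (fun c => ∫⁻ s in Ioc 0 T, ‖g (s * c) - g (s * y)‖ₑ) (nhds y) (nhds 0) := by
    have := tendsto_lintegral_filter_of_dominated_convergence (μ := volume.restrict (Ioc 0 T))
      (l := nhds y) (F := fun c s => ‖g (s * c) - g (s * y)‖ₑ) (f := fun _ => 0)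
      (fun _ => ENNReal.ofReal (D + D)) (Eventually.of_forall fun c => by fun_prop)
      (Eventually.of_forall fun c => ae_of_all _ fun s => ?_) ?_ (ae_of_all _ fun s => ?_)
    · simpa using this
    · rw [← ofReal_norm]
      exact ENNReal.ofReal_le_ofReal ((norm_sub_le _ _).trans (add_le_add (hD _) (hD _)))
    · rw [lintegral_const]
      exact ENNReal.mul_ne_top ENNReal.ofReal_ne_top (by simp)
    · have : Tendsto (fun c => ‖g (s * c) - g (s * y)‖ₑ) (nhds y)
          (nhds ‖g (s * y) - g (s * y)‖ₑ) :=
        Continuous.tendsto (f := fun c => ‖g (s * c) - g (s * y)‖ₑ) (by fun_prop) y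
      simpa using this
  have mfg : Measurable fun s => ‖f₀ s - g s‖ₑ :=
    ((hf.indicator measurableSet_Icc).sub hgc.measurable).enorm
  have hout : ∀ c, y / 2 < c → ∫⁻ s in Ioc 0 T, ‖f₀ (s * c) - g (s * c)‖ₑ ≤ ε / 3 := by
    intro c hc
    have hc0 : 0 < c := lt_trans (by positivity) hc
    calc ∫⁻ s in Ioc 0 T, ‖f₀ (s * c) - g (s * c)‖ₑ
        ≤ ∫⁻ s, ‖f₀ (s * c) - g (s * c)‖ₑ := setLIntegral_le_lintegral _ _
      _ = ENNReal.ofReal |c⁻¹| * ∫⁻ s, ‖f₀ s - g s‖ₑ := hsc c hc0.ne' _ mfg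
      _ ≤ K * (ε / 3 / K) := by
          gcongr
          rw [hK, abs_of_pos (inv_pos.2 hc0)]
          apply ENNReal.ofReal_le_ofReal
          rw [inv_le_comm₀ hc0 (by positivity), inv_div]
          exact hc.le
      _ = ε / 3 := ENNReal.mul_div_cancel hK0 hKt
  have h3 : (0 : ENNReal) < ε / 3 := ENNReal.div_pos hε.ne' (by simp)
  filter_upwards [hmid.eventually (ge_mem_nhds h3), Ioo_mem_nhds (half_lt_self hy)
    (by linarith : y < 2 * y)] with c h1 hc
  have hin : ∀ c ∈ Ioo (y / 2) (2 * y), ∀ s ∈ Ioc 0 T, f₀ (s * c) = f (s * c) := by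
    intro c hc s hs
    have hm : s * c ∈ Icc 0 (T * (2 * y)) := ⟨mul_nonneg hs.1.le (by linarith [hc.1]),
      mul_le_mul hs.2 hc.2.le (by linarith [hc.1]) (hs.1.le.trans hs.2)⟩
    exact indicator_of_mem hm _
  have hy2 : y ∈ Ioo (y / 2) (2 * y) := ⟨half_lt_self hy, by linarith⟩
  have mo : ∀ c : ℝ, Measurable fun s => ‖f₀ (s * c) - g (s * c)‖ₑ := fun c =>
    mfg.comp (measurable_mul_const c)
  calc ∫⁻ s in Ioc 0 T, ‖f (s * c) - f (s * y)‖ₑ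
      ≤ ∫⁻ s in Ioc 0 T, (‖f₀ (s * c) - g (s * c)‖ₑ + ‖g (s * c) - g (s * y)‖ₑ
        + ‖f₀ (s * y) - g (s * y)‖ₑ) := by
        refine setLIntegral_mono' measurableSet_Ioc fun s hs => ?_
        rw [← hin c hc s hs, ← hin y hy2 s hs]
        have e : f₀ (s * c) - f₀ (s * y) = (f₀ (s * c) - g (s * c)) + (g (s * c) - g (s * y))
          - (f₀ (s * y) - g (s * y)) := by abel
        rw [e]
        exact (enorm_sub_le).trans (by gcongr; exact enorm_add_le _ _)
    _ ≤ ε / 3 + ε / 3 + ε / 3 := by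
        rw [lintegral_add_right _ (mo y), lintegral_add_left (mo c)]
        gcongr
        · exact hout c hc.1
        · exact hout y hy2.1
    _ = ε := ENNReal.add_thirds ε

theorem tendsto_cellIdx_div {y : ℝ} (hy : 0 < y) :
    Tendsto (fun N : ℕ => (cellIdx (1 / ((N : ℝ) + 1)) y : ℝ) * (1 / ((N : ℝ) + 1))) atTop
      (nhds y) := by
  have h0 := tendsto_one_div_add_atTop_nhds_zero_nat (𝕜 := ℝ)
  have hm : ∀ N : ℕ, y ∈ Ioc ((cellIdx (1 / ((N : ℝ) + 1)) y : ℝ) * (1 / ((N : ℝ) + 1)))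
      (((cellIdx (1 / ((N : ℝ) + 1)) y : ℝ) + 1) * (1 / ((N : ℝ) + 1))) := fun N =>
    (mem_cell_iff (by positivity)).2 ⟨hy, rfl⟩
  refine tendsto_of_tendsto_of_tendsto_of_le_of_le (g := fun N : ℕ => y - 1 / ((N : ℝ) + 1))
    (h := fun _ => y) ?_ tendsto_const_nhds (fun N => ?_) fun N => (hm N).1.le
  · simpa using (tendsto_const_nhds (x := y)).sub h0
  · have := (hm N).2
    simp only
    linarith

theorem exists_subseq_ae_tendsto_dilation {Ω E : Type*} [MeasurableSpace Ω] {P : Measure Ω}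
    [IsProbabilityMeasure P] [NormedAddCommGroup E] [NormedSpace ℝ E] [MeasurableSpace E]
    [BorelSpace E] [SecondCountableTopology E] {k : ℝ × Ω → E} (hk : Measurable k) {C : ℝ}
    (hC : ∀ q, ‖k q‖ ≤ C) (T : ℝ) :
    ∃ ns : ℕ → ℕ, StrictMono ns ∧ ∀ᵐ s ∂(volume.restrict (Ioc 0 T)), ∀ᵐ ω ∂P,
      ∀ᵐ y ∂(volume.restrict (Ioc (0 : ℝ) 1)), Tendsto (fun i =>
        k (s * ((cellIdx (1 / ((ns i : ℝ) + 1)) y : ℝ) * (1 / ((ns i : ℝ) + 1))), ω)) atTop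
        (nhds (k (s * y, ω))) := by
  set c : ℕ → ℝ → ℝ := fun N y => (cellIdx (1 / ((N : ℝ) + 1)) y : ℝ) * (1 / ((N : ℝ) + 1))
  have mc : ∀ N, Measurable (c N) := fun N =>
    (((Measurable.of_discrete (f := fun n : ℕ => (n : ℝ))).comp (measurable_cellIdx _))).mul_const _
  set ν := P.prod (volume.restrict (Ioc (0 : ℝ) 1))
  set f : ℕ → ℝ × Ω × ℝ → E := fun N p => k (p.1 * c N p.2.2, p.2.1) - k (p.1 * p.2.2, p.2.1)
  have mf : ∀ N, Measurable (f N) := by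
    intro N
    refine (hk.comp ?_).sub (hk.comp ?_)
    · exact (measurable_fst.mul ((mc N).comp measurable_snd.snd)).prodMk measurable_snd.fst
    · exact (measurable_fst.mul measurable_snd.snd).prodMk measurable_snd.fst
  have hb : ∀ N p, ‖f N p‖ₑ ≤ ENNReal.ofReal (C + C) := fun N p => by
    rw [← ofReal_norm]
    exact ENNReal.ofReal_le_ofReal ((norm_sub_le _ _).trans (add_le_add (hC _) (hC _)))
  have hL : Tendsto (fun N => eLpNorm (f N - 0) 1 ((volume.restrict (Ioc 0 T)).prod ν)) atTop
      (nhds 0) := by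
    simp_rw [sub_zero, eLpNorm_one_eq_lintegral_enorm]
    have e : ∀ N, ∫⁻ p, ‖f N p‖ₑ ∂((volume.restrict (Ioc 0 T)).prod ν)
        = ∫⁻ z, (∫⁻ s in Ioc 0 T, ‖f N (s, z)‖ₑ) ∂ν := fun N => lintegral_prod_symm' _ (mf N).enorm
    simp_rw [e]
    have := tendsto_lintegral_of_dominated_convergence (μ := ν)
      (F := fun N z => ∫⁻ s in Ioc 0 T, ‖f N (s, z)‖ₑ) (f := fun _ => 0)
      (fun _ => ∫⁻ s in Ioc 0 T, ENNReal.ofReal (C + C))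
      (fun N => (mf N).enorm.lintegral_prod_left')
      (fun N => ae_of_all _ fun z => lintegral_mono fun s => hb N _) ?_ ?_
    · simpa using this
    · simp only [lintegral_const]
      exact ENNReal.mul_ne_top (ENNReal.mul_ne_top ENNReal.ofReal_ne_top (by simp))
        (measure_ne_top _ _)
    · have h1 : ∀ᵐ z ∂ν, z.2 ∈ Ioc (0 : ℝ) 1 := by
        refine Measure.quasiMeasurePreserving_snd.ae ?_
        exact ae_restrict_mem measurableSet_Ioc
      filter_upwards [h1] with z hz
      have mk : Measurable fun r => k (r, z.1) := hk.comp measurable_prodMk_right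
      have h2 := tendsto_lintegral_dilation mk (fun r => hC _) hz.1 T
      exact (h2.comp (tendsto_cellIdx_div hz.1)).congr fun N => rfl
  obtain ⟨ns, hns, hae⟩ := (tendstoInMeasure_of_tendsto_eLpNorm one_ne_zero
    (fun N => (mf N).aestronglyMeasurable) aestronglyMeasurable_const hL).exists_seq_tendsto_ae
  refine ⟨ns, hns, ?_⟩
  filter_upwards [Measure.ae_ae_of_ae_prod hae] with s hs
  filter_upwards [Measure.ae_ae_of_ae_prod hs] with ω hω
  filter_upwards [hω] with y hy
  have hy0 : Tendsto (fun i => f (ns i) (s, ω, y)) atTop (nhds (0 : E)) := hy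
  have := hy0.add_const (k (s * y, ω))
  rw [zero_add] at this
  refine this.congr fun i => ?_
  simp [f, c]

/-- The left-endpoint step approximation of `h` on the uniform grid of `(0, s]` with `N + 1`
cells. -/
def leftStep {Ω : Type*} {d : ℕ} (s : ℝ) (N : ℕ) (h : ℝ → Ω → Fin d → ℝ) : ℝ → Ω → Fin d → ℝ :=
  gridStep (s / (N + 1)) (N + 1) (fun i => h (i * (s / (N + 1))))

/-- The left-endpoint Riemann sums of `∫ h dB` on `(0, s]`. -/
def riemannSum {Ω : Type*} {d : ℕ} (h B : ℝ → Ω → Fin d → ℝ) (s : ℝ) (N : ℕ) (ω : Ω) : ℝ :=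
  ∑ i ∈ Finset.range N, ∑ j, h (s * i / N) ω j * (B (s * (i + 1) / N) ω j - B (s * i / N) ω j)

section
variable {Ω : Type*} {d : ℕ} {B : ℝ → Ω → Fin d → ℝ} {C : ℝ} {h : ℝ → Ω → Fin d → ℝ}

theorem gridInt_eq_riemannSum {s : ℝ} (hs : 0 ≤ s) (N : ℕ) :
    gridInt B (s / (N + 1)) (N + 1) (fun i => h (i * (s / (N + 1)))) s
      = riemannSum h B s (N + 1) := by
  ext ω
  refine Finset.sum_congr rfl fun i hi => Finset.sum_congr rfl fun j _ => ?_
  have hN : (0 : ℝ) < (N : ℝ) + 1 := by positivity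
  have hi' : (i : ℝ) + 1 ≤ N + 1 := by exact_mod_cast Finset.mem_range.1 hi
  have e1 : (i : ℝ) * (s / (N + 1)) = s * i / ((N + 1 : ℕ) : ℝ) := by push_cast; ring
  have e2 : ((i : ℝ) + 1) * (s / (N + 1)) = s * (i + 1) / ((N + 1 : ℕ) : ℝ) := by push_cast; ring
  have l2 : s * ((i : ℝ) + 1) / ((N + 1 : ℕ) : ℝ) ≤ s := by
    push_cast
    rw [div_le_iff₀ hN]
    exact mul_le_mul_of_nonneg_left hi' hs
  have l1 : s * (i : ℝ) / ((N + 1 : ℕ) : ℝ) ≤ s := by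
    refine le_trans ?_ l2
    gcongr
    linarith
  simp only [e1, e2, min_eq_left l1, min_eq_left l2]

theorem timeTrunc_leftStep (s : ℝ) (N : ℕ) : timeTrunc s (leftStep s N h) = leftStep s N h := by
  have hN : ((N + 1 : ℕ) : ℝ) * (s / ((N : ℝ) + 1)) = s := by
    push_cast; field_simp
  ext1 r
  ext1 ω
  simp only [timeTrunc, leftStep, gridStep, hN]
  split_ifs <;> rfl

theorem leftStep_eq_of_notMem {s r : ℝ} (hr : r ∉ Ioc 0 s) (N : ℕ) (ω : Ω) :
    leftStep s N h r ω = 0 := by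
  rw [← timeTrunc_leftStep, timeTrunc, if_neg hr]

theorem leftStep_eq_of_mem {s r : ℝ} (hr : r ∈ Ioc 0 s) (N : ℕ) (ω : Ω) :
    leftStep s N h r ω = h (cellIdx (s / (N + 1)) r * (s / (N + 1))) ω := by
  have hN : ((N + 1 : ℕ) : ℝ) * (s / ((N : ℝ) + 1)) = s := by
    push_cast; field_simp
  simp only [leftStep, gridStep, hN, hr, if_true]

theorem abs_leftStep_le (hb : ∀ r ω j, |h r ω j| ≤ C) (s : ℝ) (N : ℕ) (r : ℝ) (ω : Ω) (j : Fin d) :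
    |leftStep s N h r ω j| ≤ C :=
  abs_gridStep_le (fun _ ω j => hb _ ω j) r ω j

end

section
variable {Ω : Type*} [mΩ : MeasurableSpace Ω] {d : ℕ} {P : Measure Ω}
    {F : ℝ → MeasurableSpace Ω} {B : ℝ → Ω → Fin d → ℝ} {C T : ℝ} {h : ℝ → Ω → Fin d → ℝ}

theorem isIto_leftStep [IsProbabilityMeasure P] (hB : IsFilteredBM P F B) (hp : ClampedProg F h)
    (hb : ∀ r ω j, |h r ω j| ≤ C) {s : ℝ} (hs : 0 < s) (N : ℕ) :
    IsIto P F B (toEuclid (leftStep s N h)) (riemannSum h B s (N + 1)) := by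
  have := IsIto.of_mem_simpleSpan hB (gridInt_mem_simpleSpan (B := B) (F := F)
    (δ := s / (N + 1)) (by positivity) (N + 1)
    (ψ := fun i => h (i * (s / (N + 1))))
    (fun i => hp.measurable_apply (by positivity)) (fun i ω j => hb _ ω j) s)
  rwa [gridInt_eq_riemannSum hs.le, ← leftStep, timeTrunc_leftStep] at this

theorem measurable_leftStep (hF : ∀ s, F s ≤ mΩ) (hp : ClampedProg F h) {s : ℝ} (hs : 0 < s)
    (N : ℕ) : Measurable fun q : ℝ × Ω => leftStep s N h q.1 q.2 :=
  measurable_gridStep _ _ fun i => (hp.measurable_apply (by positivity)).mono (hF _) le_rfl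

/-- Along a subsequence, for almost every `s` the left-endpoint step approximations of `h` on
`(0, s]` converge to `h` in `L²`. -/
theorem ClampedProg.exists_subseq_tendsto_leftStep [IsProbabilityMeasure P] (hF : ∀ s, F s ≤ mΩ)
    (hp : ClampedProg F h) (hb : ∀ r ω j, |h r ω j| ≤ C) (hT : 0 ≤ T) :
    ∃ ns : ℕ → ℕ, StrictMono ns ∧ ∀ᵐ s, s ∈ Ioc 0 T →
      Tendsto (fun k => eLpNorm (toEuclid (leftStep s (ns k) h) - toEuclid (timeTrunc s h)) 2
        ((volume : Measure ℝ).prod P)) atTop (nhds 0) := by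
  have mk : Measurable fun q : ℝ × Ω => toEuclid h (max 0 (min q.1 T), q.2) :=
    (WithLp.measurable_toLp 2 _).comp ((hp T hT).mono
      (sup_le_sup le_rfl (MeasurableSpace.comap_mono (hF _))) le_rfl)
  obtain ⟨ns, hns, H⟩ := exists_subseq_ae_tendsto_dilation (P := P) mk
    (fun q => BddProg.norm_toEuclid_le hb _) T
  refine ⟨ns, hns, ?_⟩
  rw [ae_restrict_iff' measurableSet_Ioc] at H
  filter_upwards [H] with s hs hsT
  have hsb := hp.bddProg_timeTrunc hb s
  have hl := fun N => abs_leftStep_le hb s N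
  refine tendsto_eLpNorm_prod_zero (C := d * C + d * C) (T := s) (fun k => ?_) (fun k q => ?_)
    (fun k q hq => ?_) ?_
  · exact ((WithLp.measurable_toLp 2 _).comp (measurable_leftStep hF hp hsT.1 _)).sub
      (hsb.measurable_toEuclid hF)
  · exact (norm_sub_le _ _).trans (add_le_add (BddProg.norm_toEuclid_le (hl _) q)
      (BddProg.norm_toEuclid_le hsb.bdd q))
  · simp only [Pi.sub_apply, toEuclid, leftStep_eq_of_notMem hq, hsb.supp _ q.2 hq, sub_self]
  filter_upwards [hs hsT] with ω hω
  have hs0 : s⁻¹ ≠ 0 := inv_ne_zero hsT.1.ne'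
  have hq : Measure.QuasiMeasurePreserving (fun r : ℝ => s⁻¹ * r) volume volume := by
    refine ⟨measurable_const_mul _, ?_⟩
    rw [Real.map_volume_mul_left hs0]
    exact Measure.smul_absolutelyContinuous
  rw [ae_restrict_iff' measurableSet_Ioc] at hω
  filter_upwards [hq.ae hω] with r hr
  by_cases hrs : r ∈ Ioc 0 s
  · have hy : s⁻¹ * r ∈ Ioc (0 : ℝ) 1 :=
      ⟨mul_pos (inv_pos.2 hsT.1) hrs.1, by rw [inv_mul_le_iff₀ hsT.1]; simpa using hrs.2⟩
    have hr := hr hy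
    rw [mul_inv_cancel_left₀ hsT.1.ne', min_eq_left (hrs.2.trans hsT.2), max_eq_right hrs.1.le]
      at hr
    have h2 := hr.sub_const (toEuclid h (r, ω))
    rw [sub_self] at h2
    refine h2.congr fun k => ?_
    have hc : cellIdx (1 / ((ns k : ℝ) + 1)) (s⁻¹ * r) = cellIdx (s / ((ns k : ℝ) + 1)) r := by
      have : s⁻¹ * r / (1 / ((ns k : ℝ) + 1)) = r / (s / ((ns k : ℝ) + 1)) := by
        have := hsT.1.ne'
        field_simp
      rw [cellIdx, cellIdx, this]
    have hm := (mem_cell_iff (i := cellIdx (s / ((ns k : ℝ) + 1)) r)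
      (show 0 < s / ((ns k : ℝ) + 1) by have := hsT.1; positivity)).2 ⟨hrs.1, rfl⟩
    have e : s * ((cellIdx (s / ((ns k : ℝ) + 1)) r : ℝ) * (1 / ((ns k : ℝ) + 1)))
        = (cellIdx (s / ((ns k : ℝ) + 1)) r : ℝ) * (s / ((ns k : ℝ) + 1)) := by ring
    have h0 : (0 : ℝ) ≤ (cellIdx (s / ((ns k : ℝ) + 1)) r : ℝ) * (s / ((ns k : ℝ) + 1)) := by
      have := hsT.1; positivity
    rw [hc, e, min_eq_left (hm.1.le.trans (hrs.2.trans hsT.2)), max_eq_right h0, Pi.sub_apply]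
    simp only [toEuclid, leftStep_eq_of_mem hrs, timeTrunc, if_pos hrs]
  · simp only [Pi.sub_apply, toEuclid, leftStep_eq_of_notMem hrs, hsb.supp r ω hrs, sub_self,
      tendsto_const_nhds_iff]

/-- Continuity of truncation in `L²`. -/
theorem ClampedProg.tendsto_timeTrunc [IsProbabilityMeasure P] (hF : ∀ s, F s ≤ mΩ)
    (hp : ClampedProg F h) (hb : ∀ r ω j, |h r ω j| ≤ C) {ss : ℕ → ℝ} {s : ℝ}
    (hss : Tendsto ss atTop (nhds s)) (hbd : ∀ k, ss k ≤ T) :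
    Tendsto (fun k => eLpNorm (toEuclid (timeTrunc (ss k) h) - toEuclid (timeTrunc s h)) 2
        ((volume : Measure ℝ).prod P)) atTop (nhds 0) := by
  have hsT : s ≤ T := le_of_tendsto' hss hbd
  have hsb := hp.bddProg_timeTrunc hb
  refine tendsto_eLpNorm_prod_zero (C := d * C + d * C) (T := T) (fun k => ?_) (fun k q => ?_)
    (fun k q hq => ?_) (ae_of_all _ fun ω => ?_)
  · exact ((hsb _).measurable_toEuclid hF).sub ((hsb _).measurable_toEuclid hF)
  · exact (norm_sub_le _ _).trans (add_le_add (BddProg.norm_toEuclid_le (hsb _).bdd q)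
      (BddProg.norm_toEuclid_le (hsb _).bdd q))
  · simp only [Pi.sub_apply, toEuclid]
    rw [(hsb _).supp _ _ fun h2 => hq ⟨h2.1, h2.2.trans (hbd k)⟩,
      (hsb _).supp _ _ fun h2 => hq ⟨h2.1, h2.2.trans hsT⟩, sub_self]
  · have : ∀ᵐ r : ℝ, r ≠ s := by simp [ae_iff]
    filter_upwards [this] with r hr
    refine (tendsto_congr' ?_).2 (tendsto_const_nhds (x := (0 : EuclideanSpace ℝ (Fin d))))
    rcases lt_or_gt_of_ne hr with hlt | hgt
    · filter_upwards [hss.eventually (lt_mem_nhds hlt)] with k hk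
      simp [toEuclid, timeTrunc, hk.le, hlt.le]
    · filter_upwards [hss.eventually (gt_mem_nhds hgt)] with k hk
      simp [toEuclid, timeTrunc, hk.not_ge, hgt.not_ge]

/-- A continuous process which at each time is the limit in probability of left-endpoint Riemann
sums of a bounded progressive integrand is the Itô integral. -/
theorem ClampedProg.isIto_of_tendsto_riemannSum [IsProbabilityMeasure P]
    (hB : IsFilteredBM P F B) (hT : 0 < T) (hp : ClampedProg F h)
    (hb : ∀ r ω j, |h r ω j| ≤ C) {M : ℝ → Ω → ℝ} (hMc : ∀ ω, ContinuousOn (fun s => M s ω) (Icc 0 T))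
    (hM : ∀ s ∈ Icc 0 T, TendstoInMeasure P (riemannSum h B s) atTop (M s)) {s : ℝ}
    (hs : s ∈ Icc 0 T) : IsIto P F B (toEuclid (timeTrunc s h)) (M s) := by
  have hsb := hp.bddProg_timeTrunc hb
  obtain ⟨ns, hns, H⟩ := hp.exists_subseq_tendsto_leftStep (P := P) hB.le hb hT.le
  have key : ∀ᵐ s, s ∈ Ioc 0 T → IsIto P F B (toEuclid (timeTrunc s h)) (M s) := by
    filter_upwards [H] with s hs hsT
    refine IsIto.of_tendsto hB ((hsb s).measurable_toEuclid hB.le).aestronglyMeasurable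
      (fun k => isIto_leftStep hB hp hb hsT.1 (ns k)) (hs hsT) ?_
    exact (hM s ⟨hsT.1.le, hsT.2⟩).comp ((tendsto_add_atTop_nat 1).comp hns.tendsto_atTop)
  have hdense : ∀ s ∈ Icc 0 T, ∃ ss : ℕ → ℝ, (∀ k, ss k ∈ Ioc 0 T ∧
      IsIto P F B (toEuclid (timeTrunc (ss k) h)) (M (ss k))) ∧ Tendsto ss atTop (nhds s) := by
    intro s hs
    have hcl : s ∈ closure {u | u ∈ Ioc 0 T ∧ IsIto P F B (toEuclid (timeTrunc u h)) (M u)} := by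
      rw [mem_closure_iff]
      intro o ho hso
      have hne : (o ∩ Ioo 0 T).Nonempty := by
        have : s ∈ closure (Ioo 0 T) := by rwa [closure_Ioo hT.ne]
        exact mem_closure_iff.1 this o ho hso
      have hpos : 0 < volume (o ∩ Ioo 0 T) := (ho.inter isOpen_Ioo).measure_pos _ hne
      by_contra hemp
      refine hpos.ne' (measure_mono_null (fun u hu => ?_) (ae_iff.1 key))
      intro hu2
      exact hemp ⟨u, hu.1, ⟨hu.2.1, hu.2.2.le⟩, hu2 ⟨hu.2.1, hu.2.2.le⟩⟩
    obtain ⟨ss, h1, h2⟩ := mem_closure_iff_seq_limit.1 hcl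
    exact ⟨ss, h1, h2⟩
  obtain ⟨ss, h1, h2⟩ := hdense s hs
  refine IsIto.of_tendsto hB ((hsb s).measurable_toEuclid hB.le).aestronglyMeasurable
    (fun k => (h1 k).2) (hp.tendsto_timeTrunc hB.le hb h2 fun k => (h1 k).1.2) ?_
  refine tendstoInMeasure_of_tendsto_ae (fun k => (h1 k).2.2.1) (ae_of_all _ fun ω => ?_)
  exact ((hMc ω) s hs).tendsto.comp (tendsto_nhdsWithin_iff.2
    ⟨h2, Eventually.of_forall fun k => Ioc_subset_Icc_self (h1 k).1⟩)

end

/-- Convergence in measure is stable under continuous maps of two variables. -/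
theorem MeasureTheory.TendstoInMeasure.map_prod {α E E' G : Type*} [MeasurableSpace α]
    {μ : Measure α} [IsFiniteMeasure μ] [PseudoMetricSpace E] [PseudoMetricSpace E']
    [PseudoMetricSpace G] {f : ℕ → α → E} {f' : ℕ → α → E'} {g : α → E} {g' : α → E'}
    (hf : TendstoInMeasure μ f atTop g) (hf' : TendstoInMeasure μ f' atTop g')
    (mf : ∀ n, AEStronglyMeasurable (f n) μ) (mf' : ∀ n, AEStronglyMeasurable (f' n) μ)
    {φ : E × E' → G} (hφ : Continuous φ) :
    TendstoInMeasure μ (fun n x => φ (f n x, f' n x)) atTop (fun x => φ (g x, g' x)) := by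
  refine (exists_seq_tendstoInMeasure_atTop_iff (fun n =>
    hφ.comp_aestronglyMeasurable ((mf n).prodMk (mf' n)))).2 fun ns hns => ?_
  obtain ⟨ms, hms, h1⟩ := (hf.comp hns.tendsto_atTop).exists_seq_tendsto_ae
  obtain ⟨ls, hls, h2⟩ := (hf'.comp (hns.comp hms).tendsto_atTop).exists_seq_tendsto_ae
  refine ⟨ms ∘ ls, hms.comp hls, ?_⟩
  filter_upwards [h1, h2] with x hx hx'
  exact (hφ.tendsto _).comp ((hx.comp hls.tendsto_atTop).prodMk_nhds hx')

theorem sq_le_exp_add_exp_neg (x : ℝ) : x ^ 2 ≤ 2 * (Real.exp x + Real.exp (-x)) := by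
  rcases le_total 0 x with h | h
  · have := Real.quadratic_le_exp_of_nonneg h
    nlinarith [Real.exp_pos (-x)]
  · have := Real.quadratic_le_exp_of_nonneg (neg_nonneg.2 h)
    nlinarith [Real.exp_pos x]

section
variable {Ω : Type*} {d : ℕ} {B : ℝ → Ω → Fin d → ℝ} {δ : ℝ} {ψ : ℕ → Ω → Fin d → ℝ}

theorem gridInt_eq_gridExp_add (hδ : 0 ≤ δ) (N : ℕ) (ω : Ω) :
    gridInt B δ N ψ (N * δ) ω
      = gridExp B δ ψ 0 N ω + ∑ i ∈ Finset.range N, ∑ j, ψ i ω j ^ 2 * δ / 2 := by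
  rw [gridInt, gridExp, Nat.Ico_zero_eq_range, Finset.sum_sub_distrib, sub_add_cancel]
  refine Finset.sum_congr rfl fun i hi => ?_
  have hi' : ((i : ℝ) + 1) ≤ N := by exact_mod_cast Finset.mem_range.1 hi
  rw [min_eq_left (mul_le_mul_of_nonneg_right hi' hδ),
    min_eq_left (mul_le_mul_of_nonneg_right (by linarith) hδ)]

theorem gridInt_sub {φ : ℕ → Ω → Fin d → ℝ} (N : ℕ) (s : ℝ) :
    gridInt B δ N (fun i => ψ i - φ i) s = gridInt B δ N ψ s - gridInt B δ N φ s := by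
  ext ω
  simp only [gridInt, Pi.sub_apply, ← Finset.sum_sub_distrib, sub_mul]

theorem gridInt_neg (N : ℕ) (s : ℝ) :
    gridInt B δ N (fun i => - ψ i) s = - gridInt B δ N ψ s := by
  ext ω
  simp only [gridInt, Pi.neg_apply, neg_mul, Finset.sum_neg_distrib]

theorem exp_gridInt_le {C : ℝ} (hδ : 0 ≤ δ) (hC : ∀ i ω j, |ψ i ω j| ≤ C) (N : ℕ) (ω : Ω) :
    Real.exp (gridInt B δ N ψ (N * δ) ω)
      ≤ Real.exp (d * C ^ 2 * (N * δ)) * Real.exp (gridExp B δ ψ 0 N ω) := by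
  rw [gridInt_eq_gridExp_add hδ, ← Real.exp_add, Real.exp_le_exp, add_comm]
  gcongr
  have h1 : ∀ i ∈ Finset.range N, ∑ j, ψ i ω j ^ 2 * δ / 2 ≤ d * C ^ 2 * δ := by
    intro i _
    calc ∑ j, ψ i ω j ^ 2 * δ / 2 ≤ ∑ _j : Fin d, C ^ 2 * δ := by
          refine Finset.sum_le_sum fun j _ => ?_
          have h2 : ψ i ω j ^ 2 ≤ C ^ 2 := sq_le_sq' (by linarith [neg_abs_le (ψ i ω j), hC i ω j])
            (le_of_abs_le (hC i ω j))
          nlinarith [mul_le_mul_of_nonneg_right h2 hδ, mul_nonneg (sq_nonneg C) hδ]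
      _ = d * C ^ 2 * δ := by simp [mul_assoc]
  refine (Finset.sum_le_sum h1).trans (le_of_eq ?_)
  simp
  ring
end

theorem IsFilteredBM.eLpNorm_gridInt_sq_le {Ω : Type*} [mΩ : MeasurableSpace Ω] {d : ℕ}
    {P : Measure Ω} [IsProbabilityMeasure P] {F : ℝ → MeasurableSpace Ω} {B : ℝ → Ω → Fin d → ℝ}
    (hB : IsFilteredBM P F B) {δ : ℝ} (hδ : 0 < δ) {ψ : ℕ → Ω → Fin d → ℝ}
    (hψ : ∀ i : ℕ, Measurable[F (i * δ)] (ψ i)) {C : ℝ} (hC : ∀ i ω j, |ψ i ω j| ≤ C) (N : ℕ) :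
    eLpNorm (fun ω => gridInt B δ N ψ (N * δ) ω ^ 2) 2 P
      ≤ ((4 * Real.exp (d * C ^ 2 * (N * δ)) ^ 2).toNNReal : ENNReal) := by
  set E := Real.exp (d * C ^ 2 * (N * δ))
  have hE : 0 < E := Real.exp_pos _
  have hψ' : ∀ i : ℕ, Measurable[F (i * δ)] (fun ω => - ψ i ω) := fun i => (hψ i).neg
  have hC' : ∀ i ω j, |(-ψ i) ω j| ≤ C := fun i ω j => by simpa using hC i ω j
  have m1 := ((hB.measurable_gridExp hδ.le hψ 0 N).mono (hB.le _) le_rfl).exp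
  have m2 := ((hB.measurable_gridExp hδ.le hψ' 0 N).mono (hB.le _) le_rfl).exp
  have b1 := hB.lintegral_gridExp_sq_le hδ hψ hC N
  have b2 := hB.lintegral_gridExp_sq_le hδ hψ' hC' N
  have key : eLpNorm (fun ω => gridInt B δ N ψ (N * δ) ω ^ 2) 2 P ≤ ENNReal.ofReal (4 * E ^ 2) := by
    calc eLpNorm (fun ω => gridInt B δ N ψ (N * δ) ω ^ 2) 2 P
      _ ≤ eLpNorm (fun ω => (2 * E) * (Real.exp (gridExp B δ ψ 0 N ω)
            + Real.exp (gridExp B δ (fun i ω => - ψ i ω) 0 N ω))) 2 P := by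
          refine eLpNorm_mono_real fun ω => ?_
          rw [Real.norm_eq_abs, abs_of_nonneg (sq_nonneg _)]
          refine (sq_le_exp_add_exp_neg _).trans ?_
          have h1 := exp_gridInt_le (B := B) hδ.le hC N ω
          have h2 := exp_gridInt_le (B := B) hδ.le hC' N ω
          rw [gridInt_neg, Pi.neg_apply] at h2
          have h3 : gridExp B δ (fun i => - ψ i) 0 N ω = gridExp B δ (fun i ω => - ψ i ω) 0 N ω := rfl
          rw [h3] at h2
          simp only [E]
          linarith
      _ ≤ ENNReal.ofReal (2 * E) * (E.toNNReal + E.toNNReal) := by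
          have e := eLpNorm_const_smul (2 * E) (fun ω => Real.exp (gridExp B δ ψ 0 N ω)
            + Real.exp (gridExp B δ (fun i ω => - ψ i ω) 0 N ω)) 2 P
          refine (le_of_eq e).trans ?_
          rw [Real.enorm_eq_ofReal (by positivity)]
          gcongr
          exact (eLpNorm_add_le m1.aestronglyMeasurable m2.aestronglyMeasurable (by norm_num)).trans
            (add_le_add b1 b2)
      _ = ENNReal.ofReal (4 * E ^ 2) := by
          change ENNReal.ofReal (2 * E) * (ENNReal.ofReal E + ENNReal.ofReal E)
            = ENNReal.ofReal (4 * E ^ 2)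
          rw [← ENNReal.ofReal_add hE.le hE.le, ← ENNReal.ofReal_mul (by positivity)]
          ring_nf
  exact key

section
variable {Ω : Type*} [mΩ : MeasurableSpace Ω] {d : ℕ} {P : Measure Ω}
    {F : ℝ → MeasurableSpace Ω} {B : ℝ → Ω → Fin d → ℝ} {C T : ℝ} {h : ℝ → Ω → Fin d → ℝ}

/-- If the left-endpoint Riemann sums converge to the Itô integral in probability, then the step
approximations converge in `L²`. -/
theorem ClampedProg.tendsto_leftStep [IsProbabilityMeasure P] (hB : IsFilteredBM P F B)
    (hp : ClampedProg F h) (hb : ∀ r ω j, |h r ω j| ≤ C) {s : ℝ} (hs : 0 < s) {M : Ω → ℝ}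
    (hI : IsIto P F B (toEuclid (timeTrunc s h)) M)
    (hM : TendstoInMeasure P (riemannSum h B s) atTop M) :
    Tendsto (fun N => eLpNorm (toEuclid (leftStep s N h) - toEuclid (timeTrunc s h)) 2
      ((volume : Measure ℝ).prod P)) atTop (nhds 0) := by
  have hsb := hp.bddProg_timeTrunc hb s
  have hl := fun N => isIto_leftStep hB hp hb hs N
  have ha := fun N => hsb.isIto_gridInt hB hs N s
  simp_rw [timeTrunc_avgStep] at ha
  set D : ℕ → Ω → ℝ := fun N => riemannSum h B s (N + 1)
    - gridInt B (s / (N + 1)) (N + 1) (prevAvg (s / (N + 1)) (timeTrunc s h)) s with hD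
  have hDI := fun N => (hl N).sub hB (ha N)
  have hDm : TendstoInMeasure P D atTop (fun _ => (0 : ℝ)) := by
    have := (hM.comp (tendsto_add_atTop_nat 1)).map_prod (hsb.tendsto_gridInt hB hs hI)
      (fun N => (hl N).2.1) (fun N => (ha N).2.1) (φ := fun p : ℝ × ℝ => p.1 - p.2) (by fun_prop)
    simpa [D, Pi.sub_def] using this
  have hD2m : TendstoInMeasure P (fun N ω => D N ω ^ 2) atTop (fun _ => (0 : ℝ)) := by
    have := hDm.map_prod hDm (fun N => (hDI N).2.1) (fun N => (hDI N).2.1)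
      (φ := fun p : ℝ × ℝ => p.1 ^ 2) (by fun_prop)
    simpa using this
  have hDb : ∀ N, eLpNorm (fun ω => D N ω ^ 2) 2 P
      ≤ ((4 * Real.exp (d * (C + C) ^ 2 * s) ^ 2).toNNReal : ENNReal) := by
    intro N
    have hN : ((N + 1 : ℕ) : ℝ) * (s / ((N : ℝ) + 1)) = s := by
      push_cast; field_simp
    have e : D N = gridInt B (s / (N + 1)) (N + 1) (fun i => h (i * (s / (N + 1)))
        - prevAvg (s / (N + 1)) (timeTrunc s h) i) s := by
      rw [gridInt_sub, gridInt_eq_riemannSum hs.le]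
    have := hB.eLpNorm_gridInt_sq_le (δ := s / (N + 1)) (by positivity)
      (ψ := fun i => h (i * (s / (N + 1))) - prevAvg (s / (N + 1)) (timeTrunc s h) i)
      (fun i => Measurable.sub (hp.measurable_apply (by positivity))
        (hsb.measurable_prevAvg (by positivity) i)) (C := C + C)
      (fun i ω j => (abs_sub _ _).trans (add_le_add (hb _ _ _)
        (abs_prevAvg_le (by positivity) hsb.bdd i ω j))) (N + 1)
    rw [hN] at this
    simpa only [e] using this
  have hD1 := (tendsto_eLpNorm_one_of_tendstoInMeasure
    (fun N => ((hDI N).2.1.pow 2)) hDb hD2m).2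
  have hD2 : Tendsto (fun N => eLpNorm (D N) 2 P) atTop (nhds 0) := by
    refine ENNReal.tendsto_zero_of_tendsto_sq_zero (hD1.congr fun N => ?_)
    rw [eLpNorm_two_sq, eLpNorm_one_eq_lintegral_enorm]
    simp [enorm_pow]
    rfl
  have hav := hsb.tendsto_avgStep (P := P) hB.le hs
  refine tendsto_of_tendsto_of_tendsto_of_le_of_le tendsto_const_nhds
    (by simpa using hD2.add hav) (fun _ => zero_le) fun N => ?_
  simp only
  rw [(hDI N).eLpNorm_eq hB]
  exact eLpNorm_sub_le_add_sub (hl N).1 (ha N).1 hI.1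

end

/-- Convergence in measure passes to a finite measure given by a density. -/
theorem MeasureTheory.TendstoInMeasure.withDensity {α ι E : Type*} [MeasurableSpace α]
    {μ : Measure α} [PseudoMetricSpace E] {l : Filter ι} {f : ι → α → E} {g : α → E}
    (hf : TendstoInMeasure μ f l g) {ρ : α → ENNReal} (hρ : ∫⁻ x, ρ x ∂μ ≠ ⊤) :
    TendstoInMeasure (μ.withDensity ρ) f l g := by
  intro ε hε
  have h1 : Tendsto (fun i => ∫⁻ x in toMeasurable μ {x | ε ≤ edist (f i x) (g x)}, ρ x ∂μ) l
      (nhds 0) := tendsto_setLIntegral_zero hρ (by simpa [Function.comp_def] using hf ε hε)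
  refine tendsto_of_tendsto_of_tendsto_of_le_of_le tendsto_const_nhds h1 (fun _ => zero_le)
    fun i => ?_
  rw [← withDensity_apply _ (measurableSet_toMeasurable _ _)]
  exact measure_mono (subset_toMeasurable _ _)

theorem setIntegral_comp_cellIdx_mul {δ : ℝ} (hδ : 0 < δ) (c : ℕ → ℝ) {f : ℝ → ℝ}
    (hf : ∀ a b, IntegrableOn f (Ioc a b)) (N : ℕ) :
    IntegrableOn (fun r => c (cellIdx δ r) * f r) (Ioc 0 (N * δ)) ∧
      ∫ r in Ioc 0 (N * δ), c (cellIdx δ r) * f r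
        = ∑ i ∈ Finset.range N, c i * ((∫ r in Ioc 0 ((i + 1) * δ), f r)
          - ∫ r in Ioc 0 (i * δ), f r) := by
  induction N with
  | zero => simp
  | succ N ih =>
    have hN : (0 : ℝ) ≤ N * δ := by positivity
    have hN' : (N : ℝ) * δ ≤ (N + 1) * δ := by nlinarith
    have eqo : EqOn (fun r => c (cellIdx δ r) * f r) (fun r => c N * f r)
        (Ioc (N * δ) ((N + 1) * δ)) := by
      intro r hr
      simp only [((mem_cell_iff hδ).1 hr).2]
    have hi : IntegrableOn (fun r => c (cellIdx δ r) * f r) (Ioc (N * δ) ((N + 1) * δ)) :=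
      (integrableOn_congr_fun eqo measurableSet_Ioc).2 ((hf _ _).const_mul _)
    have hv : ∫ r in Ioc (N * δ) ((N + 1) * δ), c (cellIdx δ r) * f r
        = c N * ((∫ r in Ioc 0 ((N + 1) * δ), f r) - ∫ r in Ioc 0 (N * δ), f r) := by
      rw [setIntegral_congr_fun measurableSet_Ioc eqo, integral_const_mul,
        ← Ioc_union_Ioc_eq_Ioc hN hN', setIntegral_union (Ioc_disjoint_Ioc_of_le le_rfl)
          measurableSet_Ioc (hf _ _) (hf _ _), add_sub_cancel_left]
    push_cast
    rw [← Ioc_union_Ioc_eq_Ioc hN hN', Finset.sum_range_succ]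
    refine ⟨ih.1.union hi, ?_⟩
    rw [setIntegral_union (Ioc_disjoint_Ioc_of_le le_rfl) measurableSet_Ioc ih.1 hi, ih.2, hv]

theorem riemannSum_girsanovShift {Ω : Type*} {d : ℕ} {B h θ : ℝ → Ω → Fin d → ℝ} {s : ℝ}
    (hs : 0 < s) {ω : Ω} (hθ : ∀ j a b, IntegrableOn (fun r => θ r ω j) (Ioc a b)) (N : ℕ) :
    riemannSum h (girsanovShift B θ) s (N + 1) ω = riemannSum h B s (N + 1) ω
      - ∫ r in Ioc 0 s, ∑ j, leftStep s N h r ω j * θ r ω j := by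
  have hδ : 0 < s / ((N : ℝ) + 1) := by positivity
  have hN : ((N + 1 : ℕ) : ℝ) * (s / ((N : ℝ) + 1)) = s := by
    push_cast; field_simp
  have key := fun j => setIntegral_comp_cellIdx_mul hδ
    (fun i => h (i * (s / (N + 1))) ω j) (hθ j) (N + 1)
  simp only [hN] at key
  have e : ∫ r in Ioc 0 s, ∑ j, leftStep s N h r ω j * θ r ω j
      = ∫ r in Ioc 0 s, ∑ j, h (cellIdx (s / (N + 1)) r * (s / (N + 1))) ω j * θ r ω j :=
    setIntegral_congr_fun measurableSet_Ioc fun r hr => by simp only [leftStep_eq_of_mem hr]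
  rw [e, integral_finsetSum _ fun j _ => (key j).1, Finset.sum_congr rfl fun j _ => (key j).2,
    Finset.sum_comm, riemannSum, riemannSum, ← Finset.sum_sub_distrib]
  refine Finset.sum_congr rfl fun i _ => ?_
  rw [← Finset.sum_sub_distrib]
  refine Finset.sum_congr rfl fun j _ => ?_
  have e1 : (i : ℝ) * (s / (N + 1)) = s * i / ((N + 1 : ℕ) : ℝ) := by push_cast; ring
  have e2 : ((i : ℝ) + 1) * (s / (N + 1)) = s * (i + 1) / ((N + 1 : ℕ) : ℝ) := by push_cast; ring
  simp only [e1, e2, girsanovShift]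
  ring

theorem eLpNorm_setIntegral_le {Ω E : Type*} [MeasurableSpace Ω] {P : Measure Ω} [SFinite P]
    [NormedAddCommGroup E] [NormedSpace ℝ E] {f : ℝ × Ω → E} {S : Set ℝ}
    (hf : AEStronglyMeasurable f ((volume.restrict S).prod P)) :
    eLpNorm (fun ω => ∫ r in S, f (r, ω)) 1 P ≤ eLpNorm f 1 ((volume.restrict S).prod P) := by
  rw [eLpNorm_one_eq_lintegral_enorm, eLpNorm_one_eq_lintegral_enorm,
    lintegral_prod_symm _ hf.enorm]
  exact lintegral_mono fun ω => enorm_integral_le_lintegral_enorm _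

theorem abs_sum_mul_le_norm {d : ℕ} (x : EuclideanSpace ℝ (Fin d)) {y : Fin d → ℝ} {C : ℝ}
    (hy : ∀ j, |y j| ≤ C) : |∑ j, x j * y j| ≤ d * C * ‖x‖ := by
  calc |∑ j, x j * y j| ≤ ∑ j : Fin d, |x j * y j| := Finset.abs_sum_le_sum_abs _ _
    _ ≤ ∑ _j : Fin d, C * ‖x‖ := by
        refine Finset.sum_le_sum fun j _ => ?_
        rw [abs_mul, mul_comm]
        exact mul_le_mul (hy j) (PiLp.norm_apply_le x j) (abs_nonneg _)
          ((abs_nonneg _).trans (hy j))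
    _ = d * C * ‖x‖ := by simp [mul_assoc]

section
variable {Ω : Type*} [mΩ : MeasurableSpace Ω] {d : ℕ} {P : Measure Ω}
    {F : ℝ → MeasurableSpace Ω} {B : ℝ → Ω → Fin d → ℝ} {C C' T : ℝ} {h θ : ℝ → Ω → Fin d → ℝ}

theorem ClampedProg.tendsto_riemannSum_girsanovShift [IsProbabilityMeasure P]
    (hB : IsFilteredBM P F B) (hp : ClampedProg F h) (hb : ∀ r ω j, |h r ω j| ≤ C)
    (hθ : BddProg F C' T θ) {s : ℝ} (hs : 0 < s) {M : Ω → ℝ}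
    (hI : IsIto P F B (toEuclid (timeTrunc s h)) M)
    (hM : TendstoInMeasure P (riemannSum h B s) atTop M) :
    TendstoInMeasure P (riemannSum h (girsanovShift B θ) s) atTop
      (fun ω => M ω - ∫ r in Ioc 0 s, ∑ j, h r ω j * θ r ω j) := by
  have hl := fun N => isIto_leftStep hB hp hb hs N
  have hsb := hp.bddProg_timeTrunc hb s
  have mθ := hθ.measurable_uncurry hB.le
  have mh := hsb.measurable_uncurry hB.le
  have ml := fun N => measurable_leftStep hB.le hp hs N
  set ν := ((volume : Measure ℝ).restrict (Ioc 0 s)).prod P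
  have hν : ν ≤ (volume : Measure ℝ).prod P := Measure.prod_mono Measure.restrict_le_self le_rfl
  have hD := hp.tendsto_leftStep hB hb hs hI hM
  have hm1 : ∀ N, Measurable fun q : ℝ × Ω => ∑ j, leftStep s N h q.1 q.2 j * θ q.1 q.2 j := by
    intro N
    have := ml N
    fun_prop
  have hm2 : Measurable fun q : ℝ × Ω => ∑ j, timeTrunc s h q.1 q.2 j * θ q.1 q.2 j := by
    fun_prop
  have hinteg : TendstoInMeasure P
      (fun N ω => ∫ r in Ioc 0 s, ∑ j, leftStep s N h r ω j * θ r ω j) atTop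
      (fun ω => ∫ r in Ioc 0 s, ∑ j, timeTrunc s h r ω j * θ r ω j) := by
    refine tendstoInMeasure_of_tendsto_eLpNorm (p := 1) one_ne_zero
      (fun N => (measurable_setIntegral_left (hm1 N) _).aestronglyMeasurable)
      (measurable_setIntegral_left hm2 _).aestronglyMeasurable ?_
    have hlim : Tendsto (fun N => ENNReal.ofReal (d * C') * (eLpNorm (toEuclid (leftStep s N h)
        - toEuclid (timeTrunc s h)) 2 ((volume : Measure ℝ).prod P) *
          ν univ ^ (1 / (1 : ENNReal).toReal - 1 / (2 : ENNReal).toReal))) atTop (nhds 0) := by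
      have hc : ν univ ^ (1 / (1 : ENNReal).toReal - 1 / (2 : ENNReal).toReal) ≠ ⊤ := by
        refine ENNReal.rpow_ne_top_of_nonneg (by norm_num) ?_
        simp [ν, Measure.prod_apply]
      have := ENNReal.Tendsto.const_mul (a := ENNReal.ofReal (d * C'))
        (ENNReal.Tendsto.mul_const hD (Or.inr hc)) (Or.inr ENNReal.ofReal_ne_top)
      simpa using this
    refine tendsto_of_tendsto_of_tendsto_of_le_of_le tendsto_const_nhds hlim (fun _ => zero_le)
      fun N => ?_
    have e : (fun ω => ∫ r in Ioc 0 s, ∑ j, leftStep s N h r ω j * θ r ω j)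
        - (fun ω => ∫ r in Ioc 0 s, ∑ j, timeTrunc s h r ω j * θ r ω j)
        = fun ω => ∫ r in Ioc 0 s, ((∑ j, leftStep s N h r ω j * θ r ω j)
          - ∑ j, timeTrunc s h r ω j * θ r ω j) := by
      have hfin : ∀ {f : ℝ → ℝ} {K : ℝ}, Measurable f → (∀ r, |f r| ≤ K) →
          IntegrableOn f (Ioc 0 s) := fun mf hf => Measure.integrableOn_of_bounded (by simp)
            mf.aestronglyMeasurable (ae_of_all _ hf)
      have hbd : ∀ {k : ℝ → Ω → Fin d → ℝ}, (∀ r ω j, |k r ω j| ≤ C) → ∀ ω r,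
          |∑ j, k r ω j * θ r ω j| ≤ d * (C * C') := by
        intro k hk ω r
        refine (Finset.abs_sum_le_sum_abs _ _).trans ?_
        calc _ ≤ ∑ _j : Fin d, C * C' := Finset.sum_le_sum fun j _ => by
              rw [abs_mul]
              exact mul_le_mul (hk _ _ _) (hθ.bdd _ _ _) (abs_nonneg _)
                ((abs_nonneg _).trans (hk r ω j))
          _ = _ := by simp
      ext ω
      exact (integral_sub (hfin ((hm1 N).comp measurable_prodMk_right)
        (hbd (abs_leftStep_le hb s N) ω)) (hfin (hm2.comp measurable_prodMk_right)
        (hbd hsb.bdd ω))).symm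
    simp only
    rw [e]
    refine (eLpNorm_setIntegral_le (f := fun q : ℝ × Ω =>
      (∑ j, leftStep s N h q.1 q.2 j * θ q.1 q.2 j)
          - ∑ j, timeTrunc s h q.1 q.2 j * θ q.1 q.2 j)
      ((hm1 N).sub hm2).aestronglyMeasurable).trans ?_
    have hle : ∀ q : ℝ × Ω, ‖(∑ j, leftStep s N h q.1 q.2 j * θ q.1 q.2 j)
          - ∑ j, timeTrunc s h q.1 q.2 j * θ q.1 q.2 j‖ ≤ (d * C')
          * ‖(toEuclid (leftStep s N h) - toEuclid (timeTrunc s h)) q‖ := by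
      intro q
      refine le_trans (le_of_eq ?_) (abs_sum_mul_le_norm
        ((toEuclid (leftStep s N h) - toEuclid (timeTrunc s h)) q) (hθ.bdd q.1 q.2))
      rw [← Finset.sum_sub_distrib, Real.norm_eq_abs]
      simp [toEuclid, sub_mul]
    refine (eLpNorm_le_mul_eLpNorm_of_ae_le_mul (ae_of_all _ hle) 1).trans ?_
    gcongr
    refine (eLpNorm_le_eLpNorm_mul_rpow_measure_univ (p := 1) (q := 2) (by norm_num)
      (((hl N).1.sub hI.1).mono_measure hν)).trans ?_
    gcongr
  have h2 := (hM.comp (tendsto_add_atTop_nat 1)).map_prod hinteg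
      (fun N => (hl N).2.1) (fun N => (measurable_setIntegral_left (hm1 N) _).aestronglyMeasurable)
      (φ := fun p : ℝ × ℝ => p.1 - p.2) (by fun_prop)
  have e3 : (fun ω => M ω - ∫ r in Ioc 0 s, ∑ j, h r ω j * θ r ω j)
      = fun ω => M ω - ∫ r in Ioc 0 s, ∑ j, timeTrunc s h r ω j * θ r ω j := by
    ext ω
    congr 1
    refine setIntegral_congr_fun measurableSet_Ioc fun r hr => ?_
    simp only [timeTrunc, if_pos hr]
  rw [e3]
  intro ε hε
  refine (tendsto_add_atTop_iff_nat 1).1 ((h2 ε hε).congr fun N => ?_)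
  simp only [riemannSum_girsanovShift hs (hθ.integrableOn hB.le _), Function.comp_apply]

end

/-- A non-anticipative functional along an adapted process is progressively measurable. -/
theorem ClampedProg.comp_path {Ω E G : Type*} [MeasurableSpace E] [MeasurableSpace G] {n : ℕ}
    {F : ℝ → MeasurableSpace Ω} (hF : ∀ s u, s ≤ u → F s ≤ F u) {Y : ℝ → Ω → Fin n → ℝ}
    (hY : ∀ t, 0 ≤ t → Measurable[F t] (Y t)) {α : ℝ → Ω → G} (hα : ClampedProg F α)
    {k : ℝ → (ℝ → Fin n → ℝ) → G → E}
    (hk : Measurable fun p : ℝ × (ℝ → Fin n → ℝ) × G => k p.1 p.2.1 p.2.2)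
    (hka : ∀ s x y a, (∀ r ∈ Icc (0 : ℝ) s, x r = y r) → k s x a = k s y a) :
    ClampedProg F (fun r ω => k r (fun u => Y u ω) (α r ω)) := by
  intro t ht
  have hY' : ∀ u, Measurable[F t] (Y (max 0 (min u t))) := fun u =>
    (hY _ (le_max_left _ _)).mono (hF _ _ (max_le ht (min_le_right _ _))) le_rfl
  have hα' := hα t ht
  let _ := F t
  have m : Measurable fun q : ℝ × Ω =>
      (max 0 (min q.1 t), (fun u => Y (max 0 (min u t)) q.2), α (max 0 (min q.1 t)) q.2) := by
    refine Measurable.prodMk (by fun_prop) (Measurable.prodMk ?_ hα')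
    exact measurable_pi_lambda _ fun u => (hY' u).comp measurable_snd
  refine (congrArg _ ?_).mp (hk.comp m)
  ext q
  refine hka _ _ _ _ fun r hr => ?_
  have hrt : r ≤ t := hr.2.trans (max_le ht (min_le_right _ _))
  simp only [min_eq_left hrt, max_eq_right hr.1]

theorem clampedProg_const {Ω E : Type*} [MeasurableSpace E] {F : ℝ → MeasurableSpace Ω} (c : E) :
    ClampedProg F (fun _ (_ : Ω) => c) := fun t _ => by
  let _ := F t
  exact measurable_const

/-- Coefficients `σ` and `lam` that are non-anticipative, bounded by `K` and Lipschitz in the path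
with constant `L`. -/
structure GirsanovCoeff {n d m : ℕ} (T : ℝ) (A : Set (Fin m → ℝ))
    (σ : ℝ → (ℝ → Fin n → ℝ) → Matrix (Fin n) (Fin d) ℝ)
    (lam : ℝ → (ℝ → Fin n → ℝ) → (Fin m → ℝ) → Fin d → ℝ) (K L : ℝ) : Prop where
  T_pos : 0 < T
  L_nonneg : 0 ≤ L
  K_nonneg : 0 ≤ K
  σ_bdd : ∀ s x i j, |σ s x i j| ≤ K
  σ_meas : Measurable fun p : ℝ × (ℝ → Fin n → ℝ) =>
      (fun i j => σ p.1 p.2 i j : Fin n → Fin d → ℝ)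
  σ_adapted : ∀ s x y, (∀ r ∈ Set.Icc (0 : ℝ) s, x r = y r) → σ s x = σ s y
  σ_lip : ∀ s x y (C : ℝ), (∀ r ∈ Set.Icc (0 : ℝ) T, ∀ i, |x r i - y r i| ≤ C) →
      ∀ i j, |σ s x i j - σ s y i j| ≤ L * C
  lam_bdd : ∀ s x a j, |lam s x a j| ≤ K
  lam_meas : Measurable fun p : ℝ × (ℝ → Fin n → ℝ) × (Fin m → ℝ) => lam p.1 p.2.1 p.2.2
  lam_adapted : ∀ s x y a, (∀ r ∈ Set.Icc (0 : ℝ) s, x r = y r) → lam s x a = lam s y a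
  lam_cont : ∀ s x, ContinuousOn (fun a => lam s x a) A
  lam_lip : ∀ s x y a (C : ℝ), (∀ r ∈ Set.Icc (0 : ℝ) T, ∀ i, |x r i - y r i| ≤ C) →
      ∀ j, |lam s x a j - lam s y a j| ≤ L * C

section
variable {Ω : Type*} {n d m : ℕ} {T : ℝ} {x₀ : Fin n → ℝ} {A : Set (Fin m → ℝ)}
    {σ : ℝ → (ℝ → Fin n → ℝ) → Matrix (Fin n) (Fin d) ℝ}
    {lam : ℝ → (ℝ → Fin n → ℝ) → (Fin m → ℝ) → Fin d → ℝ} {K L : ℝ}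

/-- The rows of the diffusion coefficient along a process. -/
def diffRow (σ : ℝ → (ℝ → Fin n → ℝ) → Matrix (Fin n) (Fin d) ℝ) (Y : ℝ → Ω → Fin n → ℝ)
    (i : Fin n) (r : ℝ) (ω : Ω) : Fin d → ℝ := σ r (fun u => Y u ω) i

/-- The drift coefficient along a process. -/
def driftAlong (σ : ℝ → (ℝ → Fin n → ℝ) → Matrix (Fin n) (Fin d) ℝ)
    (lam : ℝ → (ℝ → Fin n → ℝ) → (Fin m → ℝ) → Fin d → ℝ) (Y : ℝ → Ω → Fin n → ℝ)
    (α : ℝ → Ω → Fin m → ℝ) (r : ℝ) (ω : Ω) : Fin n → ℝ :=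
  fun i => ∑ j, σ r (fun u => Y u ω) i j * lam r (fun u => Y u ω) (α r ω) j

namespace GirsanovCoeff
variable {F : ℝ → MeasurableSpace Ω} {Y : ℝ → Ω → Fin n → ℝ} {α : ℝ → Ω → Fin m → ℝ}

theorem clampedProg_diffRow (H : GirsanovCoeff T A σ lam K L) (hF : ∀ s u, s ≤ u → F s ≤ F u)
    (hY : ∀ t, 0 ≤ t → Measurable[F t] (Y t)) (i : Fin n) : ClampedProg F (diffRow σ Y i) :=
  ClampedProg.comp_path hF hY (clampedProg_const ()) (k := fun s x _ => (σ s x i : Fin d → ℝ))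
    (((measurable_pi_apply i).comp H.σ_meas).comp (measurable_fst.prodMk
      (measurable_fst.comp measurable_snd)))
    fun s x y _ h => by rw [H.σ_adapted s x y h]

theorem clampedProg_lam (H : GirsanovCoeff T A σ lam K L) (hF : ∀ s u, s ≤ u → F s ≤ F u)
    (hY : ∀ t, 0 ≤ t → Measurable[F t] (Y t)) (hα : ClampedProg F α) :
    ClampedProg F (fun r ω => lam r (fun u => Y u ω) (α r ω)) :=
  ClampedProg.comp_path hF hY hα H.lam_meas H.lam_adapted

theorem clampedProg_driftAlong (H : GirsanovCoeff T A σ lam K L)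
    (hF : ∀ s u, s ≤ u → F s ≤ F u) (hY : ∀ t, 0 ≤ t → Measurable[F t] (Y t))
    (hα : ClampedProg F α) : ClampedProg F (driftAlong σ lam Y α) := by
  refine ClampedProg.comp_path hF hY hα
    (k := fun s x a => fun i => ∑ j, σ s x i j * lam s x a j) ?_ fun s x y a h => ?_
  · refine measurable_pi_lambda _ fun i => Finset.measurable_sum _ fun j _ => ?_
    exact (((measurable_pi_apply j).comp ((measurable_pi_apply i).comp H.σ_meas)).comp
      (measurable_fst.prodMk (measurable_fst.comp measurable_snd))).mul
      ((measurable_pi_apply j).comp H.lam_meas)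
  · rw [H.σ_adapted s x y h, H.lam_adapted s x y a h]

theorem abs_driftAlong_le (H : GirsanovCoeff T A σ lam K L) (r : ℝ) (ω : Ω) (i : Fin n) :
    |driftAlong σ lam Y α r ω i| ≤ d * (K * K) := by
  refine (Finset.abs_sum_le_sum_abs _ _).trans ?_
  calc _ ≤ ∑ _j : Fin d, K * K := Finset.sum_le_sum fun j _ => by
        rw [abs_mul]
        exact mul_le_mul (H.σ_bdd _ _ _ _) (H.lam_bdd _ _ _ _) (abs_nonneg _) H.K_nonneg
    _ = _ := by simp

end GirsanovCoeff

/-- Weak solutions of the controlled equation, coordinatewise. -/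
structure IsWeakSol [MeasurableSpace Ω] (T : ℝ) (x₀ : Fin n → ℝ) (A : Set (Fin m → ℝ))
    (σ : ℝ → (ℝ → Fin n → ℝ) → Matrix (Fin n) (Fin d) ℝ)
    (lam : ℝ → (ℝ → Fin n → ℝ) → (Fin m → ℝ) → Fin d → ℝ)
    (P : Measure Ω) (F : ℝ → MeasurableSpace Ω) (B : ℝ → Ω → Fin d → ℝ)
    (X : ℝ → Ω → Fin n → ℝ) (α : ℝ → Ω → Fin m → ℝ) : Prop where
  bm : IsFilteredBM P F B
  cont : ∀ ω, Continuous fun s => X s ω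
  X_prog : ClampedProg F X
  α_prog : ClampedProg F α
  α_mem : ∀ s ω, α s ω ∈ A
  sde : ∀ i, ∀ s ∈ Icc 0 T, TendstoInMeasure P (riemannSum (diffRow σ X i) B s) atTop
    (fun ω => X s ω i - x₀ i - ∫ r in Ioc 0 s, driftAlong σ lam X α r ω i)

theorem riemannSum_zero_time (h B : ℝ → Ω → Fin d → ℝ) : riemannSum h B 0 = 0 := by
  ext N ω
  simp [riemannSum]

variable [mΩ : MeasurableSpace Ω] {P : Measure Ω}
  {F : ℝ → MeasurableSpace Ω} {B : ℝ → Ω → Fin d → ℝ} {X : ℝ → Ω → Fin n → ℝ}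
  {α α' : ℝ → Ω → Fin m → ℝ}

theorem IsWeakSol.adapted (hS : IsWeakSol T x₀ A σ lam P F B X α) (t : ℝ) (ht : 0 ≤ t) :
    Measurable[F t] (X t) := hS.X_prog.measurable_apply ht

theorem GirsanovCoeff.integrableOn_driftAlong (H : GirsanovCoeff T A σ lam K L)
    (hS : IsWeakSol T x₀ A σ lam P F B X α) (hα' : ClampedProg F α') (ω : Ω) (i : Fin n)
    {s : ℝ} : IntegrableOn (fun r => driftAlong σ lam X α' r ω i) (Ioc 0 s) := by
  have h1 := (H.clampedProg_driftAlong hS.bm.mono hS.adapted hα').bddProg_timeTrunc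
    (H.abs_driftAlong_le) s
  refine (integrableOn_congr_fun (fun r hr => ?_) measurableSet_Ioc).1
    (h1.integrableOn hS.bm.le ω i 0 s)
  simp only [timeTrunc, if_pos hr]

theorem GirsanovCoeff.continuousOn_integral_driftAlong (H : GirsanovCoeff T A σ lam K L)
    (hS : IsWeakSol T x₀ A σ lam P F B X α) (ω : Ω) (i : Fin n) :
    ContinuousOn (fun s => ∫ r in Ioc 0 s, driftAlong σ lam X α r ω i) (Icc 0 T) := by
  have h1 := (H.clampedProg_driftAlong hS.bm.mono hS.adapted hS.α_prog).bddProg_timeTrunc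
    (H.abs_driftAlong_le) T
  refine (h1.continuous_setIntegral hS.bm.le ω i).continuousOn.congr fun s hs => ?_
  refine setIntegral_congr_fun measurableSet_Ioc fun r hr => ?_
  simp only [timeTrunc, if_pos (Ioc_subset_Ioc_right hs.2 hr)]

/-- The martingale part of a weak solution is an Itô integral. -/
theorem GirsanovCoeff.isIto [IsProbabilityMeasure P] (H : GirsanovCoeff T A σ lam K L)
    (hS : IsWeakSol T x₀ A σ lam P F B X α) (i : Fin n) {s : ℝ} (hs : s ∈ Icc 0 T) :
    IsIto P F B (toEuclid (timeTrunc s (diffRow σ X i)))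
      (fun ω => X s ω i - x₀ i - ∫ r in Ioc 0 s, driftAlong σ lam X α r ω i) := by
  refine ClampedProg.isIto_of_tendsto_riemannSum hS.bm H.T_pos
    (H.clampedProg_diffRow hS.bm.mono hS.adapted i) (fun r ω j => H.σ_bdd _ _ _ _)
    (M := fun s ω => X s ω i - x₀ i - ∫ r in Ioc 0 s, driftAlong σ lam X α r ω i)
    (fun ω => ?_) (hS.sde i) hs
  exact (((continuous_apply i).comp (hS.cont ω)).sub continuous_const).continuousOn.sub
    (H.continuousOn_integral_driftAlong hS ω i)

/-- The market price of risk process of a change of control from `α` to `α'`. -/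
def controlShift (T : ℝ) (lam : ℝ → (ℝ → Fin n → ℝ) → (Fin m → ℝ) → Fin d → ℝ)
    (X : ℝ → Ω → Fin n → ℝ) (α α' : ℝ → Ω → Fin m → ℝ) : ℝ → Ω → Fin d → ℝ :=
  timeTrunc T fun r ω => lam r (fun u => X u ω) (α' r ω) - lam r (fun u => X u ω) (α r ω)

theorem GirsanovCoeff.bddProg_controlShift (H : GirsanovCoeff T A σ lam K L)
    (hS : IsWeakSol T x₀ A σ lam P F B X α) (hα' : ClampedProg F α') :
    BddProg F (K + K) T (controlShift T lam X α α') := by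
  refine ClampedProg.bddProg_timeTrunc (fun t ht => ?_) (fun r ω j => ?_) T
  · have h1 := H.clampedProg_lam hS.bm.mono hS.adapted hα' t ht
    have h2 := H.clampedProg_lam hS.bm.mono hS.adapted hS.α_prog t ht
    let _ := F t
    exact h1.sub h2
  · exact (abs_sub _ _).trans (add_le_add (H.lam_bdd _ _ _ _) (H.lam_bdd _ _ _ _))

/-- Girsanov change of control: under the shifted measure, the same process solves the equation
with another control. -/
theorem GirsanovCoeff.isWeakSol_changeControl [IsProbabilityMeasure P]
    (H : GirsanovCoeff T A σ lam K L)
    (hS : IsWeakSol T x₀ A σ lam P F B X α) (hα' : ClampedProg F α') (hmem : ∀ s ω, α' s ω ∈ A)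
    {J : Ω → ℝ} (mJ : Measurable J)
    (hJ : IsIto P F B (toEuclid (controlShift T lam X α α')) J) :
    IsWeakSol T x₀ A σ lam
      (P.withDensity fun ω => ENNReal.ofReal (stochExp T (controlShift T lam X α α') J ω)) F
      (girsanovShift B (controlShift T lam X α α')) X α' := by
  have hθ := H.bddProg_controlShift hS hα'
  have hprob := hθ.isProbabilityMeasure_withDensity hS.bm H.T_pos hJ
  refine ⟨hθ.isFilteredBM_girsanovShift hS.bm H.T_pos mJ hJ, hS.cont, hS.X_prog, hα', hmem,
    fun i s hs => TendstoInMeasure.withDensity ?_ ?_⟩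
  · rcases hs.1.eq_or_lt with rfl | h0
    · have := hS.sde i 0 hs
      simp only [riemannSum_zero_time, Ioc_self, Measure.restrict_empty, integral_zero_measure]
        at this ⊢
      exact this
    · have h1 := (H.clampedProg_diffRow hS.bm.mono hS.adapted i).tendsto_riemannSum_girsanovShift
        hS.bm (fun r ω j => H.σ_bdd _ _ _ _) hθ h0 (H.isIto hS i hs) (hS.sde i s hs)
      refine (congrArg (TendstoInMeasure P _ atTop) ?_).mp h1
      ext ω
      rw [sub_sub, ← integral_add (H.integrableOn_driftAlong hS hS.α_prog ω i)]
      · congr 1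
        refine setIntegral_congr_fun measurableSet_Ioc fun r hr => ?_
        simp only [driftAlong, controlShift, timeTrunc, if_pos (Ioc_subset_Ioc_right hs.2 hr),
          diffRow, ← Finset.sum_add_distrib, Pi.sub_apply]
        refine Finset.sum_congr rfl fun j _ => by ring
      · have h2 := (H.integrableOn_driftAlong hS hα' ω i (s := s)).sub
          (H.integrableOn_driftAlong hS hS.α_prog ω i)
        refine (integrableOn_congr_fun (fun r hr => ?_) measurableSet_Ioc).1 h2
        simp only [driftAlong, controlShift, timeTrunc, if_pos (Ioc_subset_Ioc_right hs.2 hr),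
          diffRow, ← Finset.sum_sub_distrib, Pi.sub_apply]
        refine Finset.sum_congr rfl fun j _ => by ring
  · have := hprob.measure_univ
    rw [withDensity_apply _ MeasurableSet.univ, setLIntegral_univ] at this
    rw [this]
    exact ENNReal.one_ne_top

end

/-- The running maximum of a sequence. -/
def runMax (s : ℕ → ℝ) : ℕ → ℝ
  | 0 => s 0
  | k + 1 => max (runMax s k) (s (k + 1))

theorem le_runMax (s : ℕ → ℝ) {i k : ℕ} (hik : i ≤ k) : s i ≤ runMax s k := by
  induction k with
  | zero => rw [Nat.le_zero.1 hik, runMax]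
  | succ k ih =>
    rcases Nat.of_le_succ hik with h | h
    · exact (ih h).trans (le_max_left _ _)
    · rw [h]
      exact le_max_right _ _

theorem two_mul_sum_runMax_le (s : ℕ → ℝ) (k : ℕ) :
    2 * (∑ i ∈ Finset.range k, runMax s i * (s (i + 1) - s i)) + runMax s k ^ 2
      ≤ 2 * runMax s k * s k + s 0 ^ 2 - s 0 ^ 2 := by
  induction k with
  | zero =>
    simp only [runMax, Finset.range_zero, Finset.sum_empty]
    nlinarith [sq_nonneg (s 0)]
  | succ k ih =>
    rw [Finset.sum_range_succ]
    simp only [runMax]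
    rcases le_total (runMax s k) (s (k + 1)) with h | h
    · rw [max_eq_right h]
      nlinarith [sq_nonneg (s (k + 1) - runMax s k)]
    · rw [max_eq_left h]
      nlinarith

/-- Pathwise form of Doob's inequality. -/
theorem runMax_sq_le (x : ℕ → ℝ) (k : ℕ) :
    runMax (fun i => |x i|) k ^ 2 + 4 * (∑ i ∈ Finset.range k,
      runMax (fun i => |x i|) i * (if 0 ≤ x i then 1 else -1) * (x (i + 1) - x i))
      ≤ 4 * x k ^ 2 := by
  have h1 := two_mul_sum_runMax_le (fun i => |x i|) k
  have h2 : ∑ i ∈ Finset.range k,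
      runMax (fun i => |x i|) i * (if 0 ≤ x i then 1 else -1) * (x (i + 1) - x i)
      ≤ ∑ i ∈ Finset.range k, runMax (fun i => |x i|) i * (|x (i + 1)| - |x i|) := by
    refine Finset.sum_le_sum fun i _ => ?_
    have h0 : 0 ≤ runMax (fun i => |x i|) i := (abs_nonneg (x i)).trans
      (le_runMax (fun i => |x i|) le_rfl)
    rw [mul_assoc]
    refine mul_le_mul_of_nonneg_left ?_ h0
    split_ifs with hx
    · rw [abs_of_nonneg hx]
      linarith [le_abs_self (x (i + 1))]
    · rw [abs_of_neg (not_le.1 hx)]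
      linarith [neg_abs_le (x (i + 1))]
  have h3 : |x k| ^ 2 = x k ^ 2 := sq_abs _
  nlinarith [sq_nonneg (runMax (fun i => |x i|) k - 2 * |x k|)]

theorem measurable_runMax {Ω : Type*} [MeasurableSpace Ω] {x : ℕ → Ω → ℝ} {k : ℕ}
    (hx : ∀ i ≤ k, Measurable (x i)) : Measurable fun ω => runMax (fun i => x i ω) k := by
  induction k with
  | zero => exact hx 0 le_rfl
  | succ k ih => exact (ih fun i hi => hx i (hi.trans k.le_succ)).max (hx _ le_rfl)

theorem memLp_runMax {Ω : Type*} [MeasurableSpace Ω] {P : Measure Ω} {x : ℕ → Ω → ℝ} {k : ℕ}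
    (hx : ∀ i ≤ k, MemLp (x i) 2 P) : MemLp (fun ω => runMax (fun i => x i ω) k) 2 P := by
  induction k with
  | zero => exact hx 0 le_rfl
  | succ k ih => exact (ih fun i hi => hx i (hi.trans k.le_succ)).sup (hx _ le_rfl)

theorem timeTrunc_sub_timeTrunc_eq_zero {Ω : Type*} {d : ℕ} {h : ℝ → Ω → Fin d → ℝ} {r u : ℝ}
    (hru : r ≤ u) (q : ℝ × Ω) (hq : q.1 ≤ r) :
    (toEuclid (timeTrunc u h) - toEuclid (timeTrunc r h)) q = 0 := by
  have : q.1 ∈ Ioc 0 u ↔ q.1 ∈ Ioc 0 r :=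
    ⟨fun h => ⟨h.1, hq⟩, fun h => ⟨h.1, hq.trans hru⟩⟩
  simp [toEuclid, timeTrunc, this]

section
variable {Ω : Type*} [mΩ : MeasurableSpace Ω] {d : ℕ} {P : Measure Ω} [IsProbabilityMeasure P]
    {F : ℝ → MeasurableSpace Ω} {B : ℝ → Ω → Fin d → ℝ} {h : ℝ → Ω → Fin d → ℝ}
    {M : ℝ → Ω → ℝ} {b : ℝ}

theorem IsIto.lintegral_runMax_sq_le (hB : IsFilteredBM P F B)
    (hM : ∀ r ∈ Icc 0 b, Measurable[F r] (M r))
    (hI : ∀ r ∈ Icc 0 b, IsIto P F B (toEuclid (timeTrunc r h)) (M r))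
    {t : ℕ → ℝ} (ht : Monotone t) {k : ℕ} (htb : ∀ i ≤ k, t i ∈ Icc 0 b) :
    ∫⁻ ω, ENNReal.ofReal (runMax (fun i => |M (t i) ω|) k ^ 2) ∂P
      ≤ 4 * eLpNorm (M (t k)) 2 P ^ 2 := by
  have hL : ∀ i ≤ k, MemLp (M (t i)) 2 P := fun i hi => ((hI _ (htb i hi)).memLp hB).2
  have hR : ∀ i ≤ k, MemLp (fun ω => runMax (fun i => |M (t i) ω|) i) 2 P := fun i hi =>
    memLp_runMax (x := fun i ω => |M (t i) ω|) fun l hl => (hL l (hl.trans hi)).abs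
  have key : ∀ i < k, Integrable (fun ω => runMax (fun i => |M (t i) ω|) i
      * (if 0 ≤ M (t i) ω then 1 else -1) * (M (t (i + 1)) ω - M (t i) ω)) P
      ∧ ∫ ω, runMax (fun i => |M (t i) ω|) i
      * (if 0 ≤ M (t i) ω then 1 else -1) * (M (t (i + 1)) ω - M (t i) ω) ∂P = 0 := by
    intro i hi
    have hη : Measurable[F (t i)] (fun ω => runMax (fun i => |M (t i) ω|) i
        * (if 0 ≤ M (t i) ω then 1 else -1)) := by
      have h1 : ∀ l ≤ i, Measurable[F (t i)] (M (t l)) := fun l hl =>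
        (hM _ (htb l (hl.trans hi.le))).mono (hB.mono _ _ (ht hl)) le_rfl
      let _ := F (t i)
      exact (measurable_runMax (x := fun i ω => |M (t i) ω|) fun l hl => (h1 l hl).abs).mul
        (Measurable.ite (measurableSet_le measurable_const (h1 i le_rfl)) measurable_const
          measurable_const)
    have hη2 : MemLp (fun ω => runMax (fun i => |M (t i) ω|) i
        * (if 0 ≤ M (t i) ω then 1 else -1)) 2 P := by
      refine (hR i hi.le).of_le (hη.mono (hB.le _) le_rfl).aestronglyMeasurable
        (ae_of_all _ fun ω => ?_)
      rw [norm_mul]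
      split_ifs <;> simp
    refine ⟨hη2.integrable_mul ((hL _ hi).sub (hL _ hi.le)), ?_⟩
    exact ((hI _ (htb _ hi)).sub hB (hI _ (htb _ hi.le))).integral_mul_eq_zero hB
      (htb i hi.le).1 (timeTrunc_sub_timeTrunc_eq_zero (ht i.le_succ)) hη hη2
  have hinteg := (hR k le_rfl).integrable_sq
  have hsum := integrable_finsetSum (Finset.range k) fun i hi => (key i (Finset.mem_range.1 hi)).1
  have h1 := integral_mono (hinteg.add (hsum.const_mul 4)) ((hL k le_rfl).integrable_sq.const_mul 4)
    fun ω => runMax_sq_le (fun i => M (t i) ω) k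
  rw [integral_add' hinteg (hsum.const_mul 4), integral_const_mul, integral_const_mul,
    integral_finsetSum _ fun i hi => (key i (Finset.mem_range.1 hi)).1,
    Finset.sum_eq_zero fun i hi => (key i (Finset.mem_range.1 hi)).2, mul_zero, add_zero] at h1
  rw [← ofReal_integral_eq_lintegral_ofReal hinteg (ae_of_all _ fun ω => sq_nonneg _)]
  refine (ENNReal.ofReal_le_ofReal h1).trans (le_of_eq ?_)
  rw [ENNReal.ofReal_mul (by norm_num), ofReal_integral_eq_lintegral_ofReal
    (hL k le_rfl).integrable_sq (ae_of_all _ fun ω => sq_nonneg _), eLpNorm_two_sq]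
  congr 1
  · simp
  · refine lintegral_congr fun ω => ?_
    rw [← enorm_pow, Real.enorm_eq_ofReal (sq_nonneg _)]

/-- Doob's `L²` inequality for continuous Itô integrals. -/
theorem IsIto.exists_dominating (hB : IsFilteredBM P F B) (hb : 0 < b)
    (hM : ∀ r ∈ Icc 0 b, Measurable[F r] (M r))
    (hI : ∀ r ∈ Icc 0 b, IsIto P F B (toEuclid (timeTrunc r h)) (M r))
    (hc : ∀ ω, ContinuousOn (fun r => M r ω) (Icc 0 b)) :
    ∃ V : Ω → ENNReal, Measurable V ∧ (∀ ω, ∀ r ∈ Icc 0 b, ‖M r ω‖ₑ ^ 2 ≤ V ω) ∧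
      ∫⁻ ω, V ω ∂P ≤ 4 * eLpNorm (toEuclid (timeTrunc b h)) 2 ((volume : Measure ℝ).prod P) ^ 2 := by
  set t : ℕ → ℕ → ℝ := fun N i => b * (i / ((N : ℝ) + 1)) with ht
  have htb : ∀ N i, i ≤ N + 1 → t N i ∈ Icc 0 b := by
    intro N i hi
    have : (i : ℝ) / ((N : ℝ) + 1) ≤ 1 := by
      rw [div_le_one (by positivity)]
      exact_mod_cast hi
    exact ⟨by positivity, mul_le_of_le_one_right hb.le this⟩
  have htN : ∀ N, t N (N + 1) = b := by
    intro N
    simp only [ht]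
    push_cast
    field_simp
  have hmono : ∀ N, Monotone (t N) := by
    intro N i j hij
    have : (i : ℝ) ≤ j := by exact_mod_cast hij
    simp only [ht]
    gcongr
  set W : ℕ → Ω → ENNReal := fun N ω =>
    ENNReal.ofReal (runMax (fun i => |M (t N i) ω|) (N + 1) ^ 2) with hW
  have mW : ∀ N, Measurable (W N) := fun N =>
    ((measurable_runMax (x := fun i ω => |M (t N i) ω|) fun i hi =>
      ((hM _ (htb N i hi)).mono (hB.le _) le_rfl).abs).pow_const 2).ennreal_ofReal
  refine ⟨fun ω => liminf (fun N => W N ω) atTop, Measurable.liminf mW, fun ω r hr => ?_, ?_⟩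
  · set l : ℕ → ℕ := fun N => ⌊r / b * ((N : ℝ) + 1)⌋₊ with hl
    have hr1 : r / b ≤ 1 := (div_le_one hb).2 hr.2
    have hlN : ∀ N, l N ≤ N + 1 := by
      intro N
      refine Nat.floor_le_of_le ?_
      push_cast
      nlinarith [show (0 : ℝ) ≤ (N : ℝ) + 1 by positivity]
    have hlim : Tendsto (fun N => t N (l N)) atTop (nhds r) := by
      have h1 := (tendsto_nat_floor_mul_div_atTop (R := ℝ) (div_nonneg hr.1 hb.le)).comp
        (tendsto_atTop_add_const_right _ (1 : ℝ) tendsto_natCast_atTop_atTop)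
      have h2 := h1.const_mul b
      rwa [mul_div_cancel₀ _ hb.ne'] at h2
    have hlim2 : Tendsto (fun N => ‖M (t N (l N)) ω‖ₑ ^ 2) atTop (nhds (‖M r ω‖ₑ ^ 2)) := by
      refine ENNReal.Tendsto.pow (Tendsto.enorm ?_)
      exact (hc ω r hr).tendsto.comp (tendsto_nhdsWithin_iff.2
        ⟨hlim, Eventually.of_forall fun N => htb N _ (hlN N)⟩)
    rw [← hlim2.liminf_eq]
    refine liminf_le_liminf (Eventually.of_forall fun N => ?_)
    rw [← enorm_pow, Real.enorm_eq_ofReal (sq_nonneg _), ← sq_abs]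
    refine ENNReal.ofReal_le_ofReal (pow_le_pow_left₀ (abs_nonneg _) ?_ 2)
    exact le_runMax (fun i => |M (t N i) ω|) (hlN N)
  · refine (lintegral_liminf_le mW).trans ?_
    rw [← (hI b ⟨hb.le, le_rfl⟩).eLpNorm_eq hB]
    refine liminf_le_of_frequently_le' (Frequently.of_forall fun N => ?_)
    have := lintegral_runMax_sq_le hB hM hI (hmono N) (htb N)
    rwa [htN] at this

end

section
variable {Ω E : Type*} {d : ℕ} {F : ℝ → MeasurableSpace Ω} {B : ℝ → Ω → Fin d → ℝ}

theorem measurable_inf_iff [MeasurableSpace E] {m₁ m₂ : MeasurableSpace Ω} {f : Ω → E} :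
    Measurable[m₁ ⊓ m₂] f ↔ Measurable[m₁] f ∧ Measurable[m₂] f := by
  refine ⟨fun h => ⟨fun s hs => ?_, fun s hs => ?_⟩, fun h s hs => ?_⟩
  · exact (MeasurableSpace.measurableSet_inf.1 (h hs)).1
  · exact (MeasurableSpace.measurableSet_inf.1 (h hs)).2
  · exact MeasurableSpace.measurableSet_inf.2 ⟨h.1 hs, h.2 hs⟩

theorem ClampedProg.mono_filtration [MeasurableSpace E] {F' : ℝ → MeasurableSpace Ω}
    {u : ℝ → Ω → E} (hu : ClampedProg F' u) (h : ∀ s, F' s ≤ F s) : ClampedProg F u := by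
  intro t ht
  refine (hu t ht).mono ?_ le_rfl
  exact sup_le_sup le_rfl (MeasurableSpace.comap_mono (h t))

theorem BddProg.mono_filtration {F' : ℝ → MeasurableSpace Ω} {C T : ℝ} {h : ℝ → Ω → Fin d → ℝ}
    (hh : BddProg F' C T h) (hF : ∀ s, F' s ≤ F s) : BddProg F C T h :=
  ⟨hh.prog.mono_filtration hF, hh.bdd, hh.supp⟩

/-- A filtration that is generated by `B`, or smaller than the filtration of `B`, measures the grid
sums. -/
theorem measurable_gridInt {G : ℝ → MeasurableSpace Ω} (hG : ∀ s u, s ≤ u → G s ≤ G u)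
    (hBG : ∀ s, 0 ≤ s → Measurable[G s] (B s)) {δ : ℝ} (hδ : 0 ≤ δ) {N : ℕ}
    {ψ : ℕ → Ω → Fin d → ℝ} (hψ : ∀ i : ℕ, Measurable[G (i * δ)] (ψ i)) {s : ℝ} (hs : 0 ≤ s) :
    Measurable[G s] (gridInt B δ N ψ s) := by
  unfold gridInt
  refine Finset.measurable_sum _ fun i _ => Finset.measurable_sum _ fun j _ => ?_
  have hi : 0 ≤ (i : ℝ) * δ := by positivity
  have hi1 : 0 ≤ ((i : ℝ) + 1) * δ := by positivity
  by_cases his : (i : ℝ) * δ ≤ s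
  · have h1 : Measurable[G s] (ψ i) := (hψ i).mono (hG _ _ his) le_rfl
    have h2 : ∀ v, 0 ≤ v → Measurable[G s] (B (min v s)) := fun v hv =>
      (hBG _ (le_min hv hs)).mono (hG _ _ (min_le_right _ _)) le_rfl
    have h3 := h2 _ hi
    have h4 := h2 _ hi1
    let _ := G s
    exact ((measurable_pi_apply j).comp h1).mul
      (((measurable_pi_apply j).comp h4).sub ((measurable_pi_apply j).comp h3))
  · have h1 : (i : ℝ) * δ ≤ ((i : ℝ) + 1) * δ := by nlinarith
    rw [min_eq_right (not_le.1 his).le, min_eq_right ((not_le.1 his).le.trans h1)]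
    simp

end

section
variable {Ω E : Type*} {m : MeasurableSpace Ω} [mΩ : MeasurableSpace Ω] {P : Measure Ω}

theorem measurable_of_ae_eq_of_null [MeasurableSpace E] (hm : ∀ s, P s = 0 → MeasurableSet[m] s)
    {f g : Ω → E} (hg : Measurable[m] g) (hfg : f =ᵐ[P] g) : Measurable[m] f := by
  intro A hA
  have hN : P {ω | ¬ f ω = g ω} = 0 := hfg
  have h : f ⁻¹' A = (g ⁻¹' A \ {ω | ¬ f ω = g ω}) ∪ (f ⁻¹' A ∩ {ω | ¬ f ω = g ω}) := by
    ext ω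
    by_cases h : f ω = g ω <;> simp [h]
  rw [h]
  exact MeasurableSet.union (MeasurableSet.diff (hg hA) (hm _ hN))
    (hm _ (measure_mono_null inter_subset_right hN))

theorem measurable_of_tendsto_ae_of_null [TopologicalSpace E] [TopologicalSpace.MetrizableSpace E]
    [MeasurableSpace E] [BorelSpace E] [Zero E] (hm : ∀ s, P s = 0 → MeasurableSet[m] s)
    {f : ℕ → Ω → E} {g : Ω → E} (hf : ∀ k, Measurable[m] (f k))
    (hfg : ∀ᵐ ω ∂P, Tendsto (fun k => f k ω) atTop (nhds (g ω))) : Measurable[m] g := by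
  set N := {ω | ¬ Tendsto (fun k => f k ω) atTop (nhds (g ω))} with hNdef
  have hN : P N = 0 := hfg
  have h1 : Measurable[m] (Nᶜ.indicator g) := by
    have hmN := hm _ hN
    have h2 : ∀ k, Measurable[m] (Nᶜ.indicator (f k)) := fun k =>
      Measurable.indicator (hf k) hmN.compl
    let _ := m
    refine measurable_of_tendsto_metrizable h2 (tendsto_pi_nhds.2 fun ω => ?_)
    by_cases hω : ω ∈ N
    · simp [hω]
    · simp only [indicator_of_mem (show ω ∈ Nᶜ from hω)]
      exact not_not.1 hω
  refine measurable_of_ae_eq_of_null hm h1 ?_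
  filter_upwards [hfg] with ω hω
  exact (indicator_of_mem (show ω ∈ Nᶜ from fun h => h hω) g).symm

theorem measurableSet_augFilt_of_null [MeasurableSpace E] (u : ℝ → Ω → E) (r : ℝ) {s : Set Ω}
    (hs : P s = 0) : MeasurableSet[augFilt P u r] s :=
  (le_sup_right : nullSets P ≤ augFilt P u r) _ (MeasurableSpace.measurableSet_generateFrom hs)

theorem augFilt_mono [MeasurableSpace E] (u : ℝ → Ω → E) {r s : ℝ} (hrs : r ≤ s) :
    augFilt P u r ≤ augFilt P u s :=
  sup_le_sup (biSup_mono fun _ ht => ⟨ht.1, ht.2.trans hrs⟩) le_rfl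

theorem measurable_augFilt [MeasurableSpace E] (u : ℝ → Ω → E) {r s : ℝ} (hr : 0 ≤ r)
    (hrs : r ≤ s) : Measurable[augFilt P u s] (u r) := by
  refine Measurable.mono (comap_measurable (u r)) ?_ le_rfl
  exact (le_biSup (fun r => MeasurableSpace.comap (u r) inferInstance)
    (show r ∈ Icc 0 s from ⟨hr, hrs⟩)).trans le_sup_left

/-- The augmented filtration of `u` is contained in any σ-algebra that contains the null sets and
makes `u` measurable. -/
theorem augFilt_le [MeasurableSpace E] {u : ℝ → Ω → E} {s : ℝ}
    (hm : ∀ s, P s = 0 → MeasurableSet[m] s) (hu : ∀ r ∈ Icc 0 s, Measurable[m] (u r)) :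
    augFilt P u s ≤ m :=
  sup_le (iSup₂_le fun r hr => (hu r hr).comap_le) (MeasurableSpace.generateFrom_le hm)

/-- The trace of the augmented Brownian filtration on the filtration `F`. -/
abbrev bmTrace (P : Measure Ω) {d : ℕ} (F : ℝ → MeasurableSpace Ω) (B : ℝ → Ω → Fin d → ℝ) (r : ℝ) :
    MeasurableSpace Ω := F r ⊓ augFilt P B r

variable {d : ℕ} {F : ℝ → MeasurableSpace Ω} {B : ℝ → Ω → Fin d → ℝ}

theorem bmTrace_mono (hB : IsFilteredBM P F B) (s u : ℝ) (hsu : s ≤ u) :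
    bmTrace P F B s ≤ bmTrace P F B u := inf_le_inf (hB.mono s u hsu) (augFilt_mono B hsu)

theorem bmTrace_le (s : ℝ) : bmTrace P F B s ≤ F s := inf_le_left

end

section
variable {Ω : Type*} {d : ℕ}

/-- Restriction of a process to the times after `a`. -/
def timeAfter (a : ℝ) (h : ℝ → Ω → Fin d → ℝ) (r : ℝ) (ω : Ω) : Fin d → ℝ :=
  if a < r then h r ω else 0

theorem ClampedProg.timeAfter {F : ℝ → MeasurableSpace Ω} {h : ℝ → Ω → Fin d → ℝ}
    (hh : ClampedProg F h) (a : ℝ) : ClampedProg F (timeAfter a h) := by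
  intro t ht
  have h1 := hh t ht
  let _ := F t
  have hc : Measurable (fun q : ℝ × Ω => max 0 (min q.1 t)) := by fun_prop
  exact Measurable.ite (hc measurableSet_Ioi) h1 measurable_const

theorem abs_timeAfter_le {h : ℝ → Ω → Fin d → ℝ} {K : ℝ} (hK : 0 ≤ K)
    (hb : ∀ r ω j, |h r ω j| ≤ K) (a r : ℝ) (ω : Ω) (j : Fin d) : |timeAfter a h r ω j| ≤ K := by
  unfold timeAfter
  split_ifs
  · exact hb _ _ _
  · simpa using hK

theorem enorm_toEuclid_sq (h : ℝ → Ω → Fin d → ℝ) (q : ℝ × Ω) :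
    ‖toEuclid h q‖ₑ ^ 2 = ∑ j, ‖h q.1 q.2 j‖ₑ ^ 2 := by
  have h1 := EuclideanSpace.norm_sq_eq (toEuclid h q)
  have h2 : ∀ j, (toEuclid h q) j = h q.1 q.2 j := fun j => rfl
  rw [← ofReal_norm, ← ENNReal.ofReal_pow (norm_nonneg _), h1,
    ENNReal.ofReal_sum_of_nonneg fun _ _ => by positivity]
  refine Finset.sum_congr rfl fun j _ => ?_
  rw [h2, ENNReal.ofReal_pow (norm_nonneg _), ofReal_norm]

theorem continuous_gridInt {B : ℝ → Ω → Fin d → ℝ} {δ : ℝ} {N : ℕ} {ψ : ℕ → Ω → Fin d → ℝ} {ω : Ω}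
    (hB : Continuous fun s => B s ω) : Continuous fun s => gridInt B δ N ψ s ω := by
  unfold gridInt
  have h : ∀ j, Continuous fun s => B s ω j := fun j => (continuous_apply j).comp hB
  refine continuous_finsetSum _ fun i _ => continuous_finsetSum _ fun j _ => ?_
  exact continuous_const.mul (((h j).comp (by fun_prop)).sub ((h j).comp (by fun_prop)))

end

section
variable {Ω : Type*} [mΩ : MeasurableSpace Ω] {P : Measure Ω} [IsProbabilityMeasure P] {d : ℕ}
  {F : ℝ → MeasurableSpace Ω} {B : ℝ → Ω → Fin d → ℝ}

theorem eLpNorm_toEuclid_sq_le_of_le {h : ℝ → Ω → Fin d → ℝ} {a b : ℝ} {W : Ω → ENNReal}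
    (mW : Measurable W) (h0 : ∀ r ω, r ∉ Ioc a b → h r ω = 0)
    (hW : ∀ r ∈ Ioc a b, ∀ ω j, ‖h r ω j‖ₑ ^ 2 ≤ W ω) :
    eLpNorm (toEuclid h) 2 ((volume : Measure ℝ).prod P) ^ 2
      ≤ ENNReal.ofReal (b - a) * (d * ∫⁻ ω, W ω ∂P) := by
  rw [eLpNorm_two_sq]
  calc ∫⁻ q, ‖toEuclid h q‖ₑ ^ 2 ∂((volume : Measure ℝ).prod P)
      ≤ ∫⁻ q, (Ioc a b).indicator 1 q.1 * (d * W q.2) ∂((volume : Measure ℝ).prod P) := by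
        refine lintegral_mono fun q => ?_
        rw [enorm_toEuclid_sq]
        by_cases hq : q.1 ∈ Ioc a b
        · rw [indicator_of_mem hq, Pi.one_apply, one_mul]
          exact (Finset.sum_le_sum fun j _ => hW _ hq _ _).trans (by simp)
        · simp [h0 _ _ hq]
    _ = _ := by
        rw [lintegral_prod_mul (f := (Ioc a b).indicator 1) (g := fun ω => d * W ω)
          ((measurable_one.indicator measurableSet_Ioc).aemeasurable)
          (mW.const_mul _).aemeasurable, lintegral_indicator_one measurableSet_Ioc,
          Real.volume_Ioc, lintegral_const_mul _ mW]

/-- On the block `(a, b]`, an Itô integral is approximated in `L²`, uniformly in time, by a process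
that is adapted to a smaller filtration, up to the error made on the integrand. -/
theorem IsIto.exists_block_approx (hB : IsFilteredBM P F B) {G : ℝ → MeasurableSpace Ω}
    (hG : ∀ s u, s ≤ u → G s ≤ G u) (hGF : ∀ s, G s ≤ F s)
    (hBG : ∀ s, 0 ≤ s → Measurable[G s] (B s)) {a b K : ℝ} (ha : 0 ≤ a) (hab : a < b) (hK : 0 ≤ K)
    {D D' : ℝ → Ω → Fin d → ℝ} (hD : ClampedProg F D) (hDb : ∀ r ω j, |D r ω j| ≤ K)
    (hD' : ClampedProg G D') (hD'b : ∀ r ω j, |D' r ω j| ≤ K) {W : Ω → ENNReal} (mW : Measurable W)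
    (hW : ∀ r ∈ Ioc a b, ∀ ω j, ‖D r ω j - D' r ω j‖ₑ ^ 2 ≤ W ω) {M : ℝ → Ω → ℝ}
    (hM : ∀ r ∈ Icc 0 b, Measurable[F r] (M r))
    (hI : ∀ r ∈ Icc 0 b, IsIto P F B (toEuclid (timeTrunc r D)) (M r))
    (hc : ∀ ω, ContinuousOn (fun r => M r ω) (Icc 0 b)) {ε : ENNReal} (hε : 0 < ε) :
    ∃ N : ℝ → Ω → ℝ, (∀ r, 0 ≤ r → Measurable[G r] (N r)) ∧
      ∃ V : Ω → ENNReal, Measurable V ∧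
        (∀ ω, ∀ r ∈ Icc 0 b, ‖M r ω - M (min r a) ω - N r ω‖ₑ ^ 2 ≤ V ω) ∧
        ∫⁻ ω, V ω ∂P ≤ 8 * (ENNReal.ofReal (b - a) * (d * ∫⁻ ω, W ω ∂P)) + ε := by
  have hb : 0 < b := ha.trans_lt hab
  set h := timeTrunc b (timeAfter a D') with hh
  have hhG : BddProg G K b h := (hD'.timeAfter a).bddProg_timeTrunc (abs_timeAfter_le hK hD'b a) b
  have hhF : BddProg F K b h := hhG.mono_filtration hGF
  have h1 := hhF.tendsto_avgStep (P := P) hB.le hb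
  have h2 : Tendsto (fun k => 8 * eLpNorm (toEuclid (avgStep b k h) - toEuclid h) 2
      ((volume : Measure ℝ).prod P) ^ 2) atTop (nhds 0) := by
    have := ENNReal.Tendsto.const_mul (a := 8) (ENNReal.Tendsto.pow (n := 2) h1) (Or.inr (by norm_num))
    simpa using this
  obtain ⟨k, hk⟩ := (h2.eventually (ge_mem_nhds hε)).exists
  set I := gridInt B (b / (k + 1)) (k + 1) (prevAvg (b / (k + 1)) h) with hIdef
  have mI : ∀ r, 0 ≤ r → Measurable[G r] (I r) := fun r hr =>
    measurable_gridInt hG hBG (by positivity) (fun i => hhG.measurable_prevAvg (by positivity) i) hr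
  set E : ℝ → Ω → Fin d → ℝ := fun r ω => timeAfter a D r ω - avgStep b k h r ω with hE
  have htt : ∀ r ∈ Icc 0 b, toEuclid (timeTrunc r D) - toEuclid (timeTrunc (min r a) D)
      - toEuclid (timeTrunc r (avgStep b k h)) = toEuclid (timeTrunc r E) := by
    intro r hr
    ext q j
    simp only [toEuclid, timeTrunc, timeAfter, hE, Pi.sub_apply, PiLp.sub_apply, mem_Ioc, le_min_iff]
    by_cases h0 : 0 < q.1 <;> by_cases h3 : q.1 ≤ r <;> by_cases h4 : q.1 ≤ a <;>
      simp [h0, h3, h4, not_lt.2, not_le.1]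
  have hcI : ∀ ω, Continuous fun r => I r ω := fun ω => continuous_gridInt (hB.bm.2.1 ω)
  have hmin : ∀ r ∈ Icc 0 b, min r a ∈ Icc 0 b := fun r hr =>
    ⟨le_min hr.1 ha, (min_le_left _ _).trans hr.2⟩
  obtain ⟨V, mV, hV, hV2⟩ := IsIto.exists_dominating (h := E)
    (M := fun r ω => M r ω - M (min r a) ω - I r ω) hB hb
    (fun r hr => by
      have e1 := hM r hr
      have e2 := (hM _ (hmin r hr)).mono (hB.mono _ _ (min_le_left r a)) le_rfl
      have e3 := (mI r hr.1).mono (hGF r) le_rfl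
      let _ := F r
      exact (e1.sub e2).sub e3)
    (fun r hr => by
      rw [← htt r hr]
      exact ((hI r hr).sub hB (hI _ (hmin r hr))).sub hB (hhF.isIto_gridInt hB hb k r))
    (fun ω => ((hc ω).sub ((hc ω).comp (by fun_prop) fun r hr => hmin r hr)).sub
      (hcI ω).continuousOn)
  refine ⟨I, mI, V, mV, hV, hV2.trans ?_⟩
  have hDF : BddProg F K b (timeTrunc b (timeAfter a D)) :=
    (hD.timeAfter a).bddProg_timeTrunc (abs_timeAfter_le hK hDb a) b
  have e0 : toEuclid (timeTrunc b E) =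
      toEuclid (timeTrunc b (timeAfter a D)) - toEuclid (avgStep b k h) := by
    rw [← timeTrunc_avgStep]
    ext q j
    simp only [toEuclid, timeTrunc, hE, Pi.sub_apply, PiLp.sub_apply]
    split_ifs <;> simp
  have e1 := eLpNorm_sub_le_add_sub (μ := (volume : Measure ℝ).prod P)
    (hDF.measurable_toEuclid hB.le).aestronglyMeasurable
    (hhF.measurable_toEuclid hB.le).aestronglyMeasurable
    (f := toEuclid (timeTrunc b (timeAfter a D))) (g := toEuclid h) (k := toEuclid (avgStep b k h))
    ((WithLp.measurable_toLp 2 _).comp (hhF.measurable_avgStep hB.le hb k)).aestronglyMeasurable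
  rw [e0]
  have e2 : eLpNorm (toEuclid (timeTrunc b (timeAfter a D)) - toEuclid h) 2
      ((volume : Measure ℝ).prod P) ^ 2 ≤ ENNReal.ofReal (b - a) * (d * ∫⁻ ω, W ω ∂P) := by
    have := eLpNorm_toEuclid_sq_le_of_le (P := P) (a := a) (b := b)
      (h := fun r ω => timeTrunc b (timeAfter a D) r ω - h r ω) mW (fun r ω hr => ?_)
      (fun r hr ω j => ?_)
    · exact this
    · simp only [hh, timeTrunc, timeAfter]
      split_ifs with h5 h6
      · exact absurd ⟨h6, h5.2⟩ hr
      all_goals simp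
    · have h5 : r ∈ Ioc 0 b := ⟨ha.trans_lt hr.1, hr.2⟩
      simpa only [hh, timeTrunc, timeAfter, if_pos h5, if_pos hr.1, Pi.sub_apply] using hW r hr ω j
  rw [eLpNorm_sub_comm] at hk
  set x := eLpNorm (toEuclid (timeTrunc b (timeAfter a D)) - toEuclid h) 2
      ((volume : Measure ℝ).prod P)
  set y := eLpNorm (toEuclid h - toEuclid (avgStep b k h)) 2 ((volume : Measure ℝ).prod P)
  have e3 : (x + y) ^ 2 ≤ 2 * (x ^ 2 + y ^ 2) := by
    have := ENNReal.rpow_add_le_mul_rpow_add_rpow x y (p := 2) (by norm_num)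
    norm_num at this
    exact_mod_cast this
  calc 4 * eLpNorm (toEuclid (timeTrunc b (timeAfter a D)) - toEuclid (avgStep b k h)) 2
        ((volume : Measure ℝ).prod P) ^ 2 ≤ 4 * (x + y) ^ 2 := by gcongr
    _ ≤ 4 * (2 * (x ^ 2 + y ^ 2)) := by gcongr
    _ = 8 * x ^ 2 + 8 * y ^ 2 := by ring
    _ ≤ _ := by gcongr

end

theorem enorm_setIntegral_sq_le {f : ℝ → ℝ} {a b : ℝ} {w : ENNReal}
    (hf : ∀ r ∈ Ioc a b, ‖f r‖ₑ ^ 2 ≤ w) :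
    ‖∫ r in Ioc a b, f r‖ₑ ^ 2 ≤ ENNReal.ofReal (b - a) ^ 2 * w := by
  have hw : (w ^ (2⁻¹ : ℝ)) ^ 2 = w := by
    rw [← ENNReal.rpow_natCast, ← ENNReal.rpow_mul]
    norm_num
  have h1 : ‖∫ r in Ioc a b, f r‖ₑ ≤ ENNReal.ofReal (b - a) * w ^ (2⁻¹ : ℝ) := by
    refine (enorm_integral_le_lintegral_enorm _).trans ?_
    calc ∫⁻ r in Ioc a b, ‖f r‖ₑ ≤ ∫⁻ r in Ioc a b, w ^ (2⁻¹ : ℝ) := by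
          refine setLIntegral_mono measurable_const fun r hr => ?_
          refine (ENNReal.pow_right_strictMono (n := 2) (by norm_num)).le_iff_le.1 ?_
          exact (hf r hr).trans hw.ge
      _ = _ := by rw [setLIntegral_const, Real.volume_Ioc, mul_comm]
  calc _ ≤ (ENNReal.ofReal (b - a) * w ^ (2⁻¹ : ℝ)) ^ 2 := by gcongr
    _ = _ := by rw [mul_pow, hw]

theorem ENNReal.add_sq_le (x y : ENNReal) : (x + y) ^ 2 ≤ 2 * x ^ 2 + 2 * y ^ 2 := by
  have := ENNReal.rpow_add_le_mul_rpow_add_rpow x y (p := 2) (by norm_num)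
  norm_num at this
  rw [← mul_add]
  exact_mod_cast this

section
variable {Ω : Type*} {n d m : ℕ} {T : ℝ} {x₀ : Fin n → ℝ} {A : Set (Fin m → ℝ)}
    {σ : ℝ → (ℝ → Fin n → ℝ) → Matrix (Fin n) (Fin d) ℝ}
    {lam : ℝ → (ℝ → Fin n → ℝ) → (Fin m → ℝ) → Fin d → ℝ} {K L : ℝ}
    [mΩ : MeasurableSpace Ω] {P : Measure Ω} [IsProbabilityMeasure P]
    {F : ℝ → MeasurableSpace Ω} {B : ℝ → Ω → Fin d → ℝ} {X Y : ℝ → Ω → Fin n → ℝ}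
    {α α' : ℝ → Ω → Fin m → ℝ} {a b : ℝ}

/-- The contraction factor of a Picard step on a block of length `δ`. -/
def picardFactor (n d : ℕ) (δ : ℝ) : ENNReal :=
  2 * ENNReal.ofReal δ ^ 2 + 16 * n * (ENNReal.ofReal δ * d)

theorem GirsanovCoeff.exists_picard_step (H : GirsanovCoeff T A σ lam K L)
    (hS : IsWeakSol T x₀ A σ lam P F B X α) {G : ℝ → MeasurableSpace Ω}
    (hG : ∀ s u, s ≤ u → G s ≤ G u) (hGF : ∀ s, G s ≤ F s)
    (hBG : ∀ s, 0 ≤ s → Measurable[G s] (B s)) (ha : 0 ≤ a) (hab : a < b)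
    (hbT : b ≤ T) (hXa : ∀ t ∈ Icc 0 a, Measurable[G t] (X t)) (hα' : ClampedProg G α')
    (hY : ∀ t, 0 ≤ t → Measurable[G t] (Y t)) {W : Ω → ENNReal} (mW : Measurable W)
    (hW₁ : ∀ r ∈ Ioc a b, ∀ ω i j, ‖diffRow σ X i r ω j - diffRow σ Y i r ω j‖ₑ ^ 2 ≤ W ω)
    (hW₂ : ∀ r ∈ Ioc a b, ∀ ω i,
      ‖driftAlong σ lam X α r ω i - driftAlong σ lam Y α' r ω i‖ₑ ^ 2 ≤ W ω)
    {ε : ENNReal} (hε : 0 < ε) :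
    ∃ Y' : ℝ → Ω → Fin n → ℝ, (∀ t, 0 ≤ t → Measurable[G t] (Y' t)) ∧
      ∃ V : Ω → ENNReal, Measurable V ∧
        (∀ ω, ∀ r ∈ Icc 0 b, ∀ i, ‖X r ω i - Y' r ω i‖ₑ ^ 2 ≤ V ω) ∧
        ∫⁻ ω, V ω ∂P ≤ picardFactor n d (b - a) * ∫⁻ ω, W ω ∂P + ε := by
  have hb : 0 < b := ha.trans_lt hab
  set M : Fin n → ℝ → Ω → ℝ := fun i r ω =>
    X r ω i - x₀ i - ∫ u in Ioc 0 r, driftAlong σ lam X α u ω i with hM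
  have hdr := (H.clampedProg_driftAlong hS.bm.mono hS.adapted hS.α_prog).bddProg_timeTrunc
    (H.abs_driftAlong_le) b
  have hinteg : ∀ ω i (s : ℝ), IntegrableOn (fun r => driftAlong σ lam X α r ω i) (Ioc 0 s) :=
    fun ω i s => H.integrableOn_driftAlong hS hS.α_prog ω i
  have mM : ∀ i, ∀ r ∈ Icc 0 b, Measurable[F r] (M i r) := by
    intro i r hr
    have e1 := hS.adapted r hr.1
    have e2 := hdr.measurable_setIntegral_coord hr.1 0 i
    have e3 : (fun ω => ∫ u in Ioc 0 r, timeTrunc b (driftAlong σ lam X α) u ω i)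
        = fun ω => ∫ u in Ioc 0 r, driftAlong σ lam X α u ω i := by
      ext ω
      refine setIntegral_congr_fun measurableSet_Ioc fun u hu => ?_
      simp only [timeTrunc, if_pos (Ioc_subset_Ioc_right hr.2 hu)]
    rw [e3] at e2
    let _ := F r
    exact (((measurable_pi_apply i).comp e1).sub measurable_const).sub e2
  have hε' : 0 < ε / (2 * (n + 1)) := ENNReal.div_pos hε.ne' (by finiteness)
  have key := fun i => IsIto.exists_block_approx hS.bm hG hGF hBG ha hab H.K_nonneg
    (H.clampedProg_diffRow hS.bm.mono hS.adapted i) (fun r ω j => H.σ_bdd _ _ _ _)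
    (H.clampedProg_diffRow hG hY i) (fun r ω j => H.σ_bdd _ _ _ _) mW
    (fun r hr ω j => hW₁ r hr ω i j) (mM i)
    (fun r hr => H.isIto hS i ⟨hr.1, hr.2.trans hbT⟩)
    (fun ω => ((((continuous_apply i).comp (hS.cont ω)).sub continuous_const).continuousOn.sub
      (H.continuousOn_integral_driftAlong hS ω i)).mono (Icc_subset_Icc_right hbT)) hε'
  choose N mN V mV hV hV2 using key
  have hdY := (H.clampedProg_driftAlong hG hY hα').bddProg_timeTrunc (H.abs_driftAlong_le) b
  have hintY : ∀ ω i s, IntegrableOn (fun r => timeTrunc b (driftAlong σ lam Y α') r ω i)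
      (Ioc a s) := fun ω i s => hdY.integrableOn (fun s => (hGF s).trans (hS.bm.le s)) ω i a s
  refine ⟨fun t ω i => X (min t a) ω i +
    (∫ r in Ioc a t, timeTrunc b (driftAlong σ lam Y α') r ω i) + N i t ω, fun t ht => ?_,
    fun ω => 2 * (ENNReal.ofReal (b - a) ^ 2 * W ω) + ∑ i, 2 * V i ω, ?_, fun ω r hr i => ?_, ?_⟩
  · have e1 := (hXa (min t a) ⟨le_min ht ha, min_le_right _ _⟩).mono (hG _ _ (min_le_left t a)) le_rfl
    have e2 := hdY.measurable_setIntegral_coord ht a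
    have e3 := fun i => mN i t ht
    let _ := G t
    exact measurable_pi_lambda _ fun i => (((measurable_pi_apply i).comp e1).add (e2 i)).add (e3 i)
  · fun_prop
  · have e1 : X r ω i - (X (min r a) ω i +
        (∫ u in Ioc a r, timeTrunc b (driftAlong σ lam Y α') u ω i) + N i r ω)
        = (∫ u in Ioc a r, (driftAlong σ lam X α u ω i -
          timeTrunc b (driftAlong σ lam Y α') u ω i)) + (M i r ω - M i (min r a) ω - N i r ω) := by
      have e3 : IntegrableOn (fun r => driftAlong σ lam X α r ω i) (Ioc a r) :=
        (hinteg ω i r).mono_set (Ioc_subset_Ioc_left ha)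
      have e2 : (∫ u in Ioc 0 r, driftAlong σ lam X α u ω i)
          = (∫ u in Ioc 0 (min r a), driftAlong σ lam X α u ω i) +
            ∫ u in Ioc a r, driftAlong σ lam X α u ω i := by
        rcases le_total r a with h | h
        · rw [min_eq_left h, Ioc_eq_empty (not_lt.2 h)]
          simp
        · rw [min_eq_right h, ← setIntegral_union (Ioc_disjoint_Ioc_of_le le_rfl) measurableSet_Ioc
            (hinteg ω i a) e3, Ioc_union_Ioc_eq_Ioc ha h]
      rw [integral_sub e3 (hintY ω i r), hM]
      simp only [e2]
      ring
    rw [e1]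
    have e2 : ‖∫ u in Ioc a r, (driftAlong σ lam X α u ω i -
          timeTrunc b (driftAlong σ lam Y α') u ω i)‖ₑ ^ 2 ≤ ENNReal.ofReal (b - a) ^ 2 * W ω := by
      refine (enorm_setIntegral_sq_le (w := W ω) fun u hu => ?_).trans ?_
      · have hu' : u ∈ Ioc 0 b := ⟨ha.trans_lt hu.1, hu.2.trans hr.2⟩
        simp only [timeTrunc, if_pos hu']
        exact hW₂ u ⟨hu.1, hu.2.trans hr.2⟩ ω i
      · gcongr
        exact hr.2
    calc _ ≤ (‖∫ u in Ioc a r, (driftAlong σ lam X α u ω i -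
          timeTrunc b (driftAlong σ lam Y α') u ω i)‖ₑ + ‖M i r ω - M i (min r a) ω - N i r ω‖ₑ) ^ 2 := by
          gcongr
          exact enorm_add_le _ _
      _ ≤ _ := ENNReal.add_sq_le _ _
      _ ≤ 2 * (ENNReal.ofReal (b - a) ^ 2 * W ω) + 2 * V i ω := by
          gcongr
          exact hV i ω r hr
      _ ≤ _ := add_le_add le_rfl (Finset.single_le_sum (f := fun i => 2 * V i ω)
          (fun _ _ => zero_le) (Finset.mem_univ i))
  · rw [lintegral_add_left (by fun_prop), lintegral_finsetSum _ (fun i _ => by fun_prop),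
      lintegral_const_mul _ (by fun_prop), lintegral_const_mul _ mW]
    simp_rw [lintegral_const_mul 2 (mV _)]
    set I := ∫⁻ ω, W ω ∂P
    set D := ENNReal.ofReal (b - a)
    have e1 : 2 * n * (ε / (2 * (n + 1))) ≤ ε := by
      calc 2 * n * (ε / (2 * (n + 1))) ≤ 2 * ((n : ENNReal) + 1) * (ε / (2 * (n + 1))) := by
            gcongr
            exact le_self_add
        _ ≤ ε := ENNReal.mul_div_le
    calc _ ≤ 2 * (D ^ 2 * I) + ∑ _i : Fin n, 2 * (8 * (D * (d * I)) + ε / (2 * (n + 1))) := by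
          gcongr with i
          exact hV2 i
      _ = picardFactor n d (b - a) * I + 2 * n * (ε / (2 * (n + 1))) := by
          rw [Finset.sum_const, Finset.card_univ, Fintype.card_fin, nsmul_eq_mul, picardFactor]
          ring
      _ ≤ _ := by gcongr

end

section
variable {Ω : Type*} {n d m : ℕ} {T : ℝ} {x₀ : Fin n → ℝ} {A : Set (Fin m → ℝ)}
    {σ : ℝ → (ℝ → Fin n → ℝ) → Matrix (Fin n) (Fin d) ℝ}
    {lam : ℝ → (ℝ → Fin n → ℝ) → (Fin m → ℝ) → Fin d → ℝ} {K L : ℝ}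
    {X Y : ℝ → Ω → Fin n → ℝ} {α α' : ℝ → Ω → Fin m → ℝ} {a b : ℝ}

/-- A Lipschitz constant, in the square, for both coefficients. -/
def lipFactor (d : ℕ) (K L : ℝ) : ENNReal := ENNReal.ofReal (1 + L ^ 2 + (2 * d * K * L) ^ 2)

theorem enorm_sq_le_lipFactor {z c : ℝ} {V : ENNReal} (d : ℕ) (K L : ℝ)
    (hc : c ^ 2 ≤ L ^ 2 + (2 * d * K * L) ^ 2) (h : V ≠ ⊤ → |z| ≤ c * √V.toReal) :
    ‖z‖ₑ ^ 2 ≤ lipFactor d K L * V := by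
  by_cases hV : V = ⊤
  · have h0 : lipFactor d K L ≠ 0 := by
      rw [lipFactor, Ne, ENNReal.ofReal_eq_zero, not_le]
      positivity
    rw [hV, ENNReal.mul_top h0]
    exact le_top
  · have h1 := h hV
    have h2 : |z| ^ 2 ≤ (c * √V.toReal) ^ 2 := pow_le_pow_left₀ (abs_nonneg _) h1 2
    rw [mul_pow, Real.sq_sqrt ENNReal.toReal_nonneg] at h2
    rw [Real.enorm_eq_ofReal_abs, ← ENNReal.ofReal_pow (abs_nonneg _), lipFactor,
      ← ENNReal.ofReal_toReal hV, ← ENNReal.ofReal_mul (by positivity)]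
    refine ENNReal.ofReal_le_ofReal (h2.trans ?_)
    exact mul_le_mul_of_nonneg_right (by linarith) ENNReal.toReal_nonneg

theorem abs_le_sqrt_of_enorm_sq_le {z : ℝ} {V : ENNReal} (hV : V ≠ ⊤) (h : ‖z‖ₑ ^ 2 ≤ V) :
    |z| ≤ √V.toReal := by
  refine Real.le_sqrt_of_sq_le ?_
  rw [Real.enorm_eq_ofReal_abs, ← ENNReal.ofReal_pow (abs_nonneg _)] at h
  exact (ENNReal.ofReal_le_iff_le_toReal hV).1 h

namespace GirsanovCoeff

theorem abs_σ_sub_le (H : GirsanovCoeff T A σ lam K L) {x y : ℝ → Fin n → ℝ} {C r : ℝ}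
    (hr : 0 ≤ r) (h : ∀ u ∈ Icc 0 r, ∀ i, |x u i - y u i| ≤ C) (i : Fin n) (j : Fin d) :
    |σ r x i j - σ r y i j| ≤ L * C := by
  have hc : ∀ z : ℝ → Fin n → ℝ, σ r z = σ r (fun u => z (min u r)) := fun z =>
    H.σ_adapted r _ _ fun u hu => by rw [min_eq_left hu.2]
  rw [hc x, hc y]
  exact H.σ_lip _ _ _ _ (fun u hu i => h _ ⟨le_min hu.1 hr, min_le_right _ _⟩ i) _ _

theorem abs_lam_sub_le (H : GirsanovCoeff T A σ lam K L) {x y : ℝ → Fin n → ℝ} {C r : ℝ}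
    (hr : 0 ≤ r) (h : ∀ u ∈ Icc 0 r, ∀ i, |x u i - y u i| ≤ C) (v : Fin m → ℝ) (j : Fin d) :
    |lam r x v j - lam r y v j| ≤ L * C := by
  have hc : ∀ z : ℝ → Fin n → ℝ, lam r z v = lam r (fun u => z (min u r)) v := fun z =>
    H.lam_adapted r _ _ _ fun u hu => by rw [min_eq_left hu.2]
  rw [hc x, hc y]
  exact H.lam_lip _ _ _ _ _ (fun u hu i => h _ ⟨le_min hu.1 hr, min_le_right _ _⟩ i) _

theorem enorm_diffRow_sub_sq_le (H : GirsanovCoeff T A σ lam K L) {V : ENNReal} {r : ℝ}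
    (hr : 0 ≤ r) {ω : Ω} (h : ∀ u ∈ Icc 0 r, ∀ i, ‖X u ω i - Y u ω i‖ₑ ^ 2 ≤ V) (i : Fin n)
    (j : Fin d) : ‖diffRow σ X i r ω j - diffRow σ Y i r ω j‖ₑ ^ 2 ≤ lipFactor d K L * V :=
  enorm_sq_le_lipFactor d K L (c := L) (by nlinarith [sq_nonneg (2 * d * K * L)]) fun hV =>
    H.abs_σ_sub_le hr (fun u hu i => abs_le_sqrt_of_enorm_sq_le hV (h u hu i)) i j

theorem enorm_driftAlong_sub_sq_le (H : GirsanovCoeff T A σ lam K L) {V : ENNReal} {r : ℝ}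
    (hr : 0 ≤ r) {ω : Ω} (h : ∀ u ∈ Icc 0 r, ∀ i, ‖X u ω i - Y u ω i‖ₑ ^ 2 ≤ V)
    (hα : α r ω = α' r ω) (i : Fin n) :
    ‖driftAlong σ lam X α r ω i - driftAlong σ lam Y α' r ω i‖ₑ ^ 2 ≤ lipFactor d K L * V := by
  refine enorm_sq_le_lipFactor d K L (c := 2 * d * K * L) (by nlinarith [sq_nonneg L]) fun hV => ?_
  have hC := fun u hu i => abs_le_sqrt_of_enorm_sq_le hV (h u hu i)
  set C := √V.toReal
  have hC0 : 0 ≤ C := Real.sqrt_nonneg _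
  simp only [driftAlong]
  rw [← Finset.sum_sub_distrib, hα]
  refine (Finset.abs_sum_le_sum_abs _ _).trans ?_
  calc _ ≤ ∑ _j : Fin d, 2 * (K * (L * C)) := Finset.sum_le_sum fun j _ => ?_
    _ = _ := by
      simp only [Finset.sum_const, Finset.card_univ, Fintype.card_fin, nsmul_eq_mul]
      ring
  have e1 := H.abs_σ_sub_le (x := fun u => X u ω) (y := fun u => Y u ω) hr hC i j
  have e2 := H.abs_lam_sub_le (x := fun u => X u ω) (y := fun u => Y u ω) hr hC (α' r ω) j
  have e3 := H.lam_bdd r (fun u => X u ω) (α' r ω) j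
  have e4 := H.σ_bdd r (fun u => Y u ω) i j
  have hLC : 0 ≤ L * C := mul_nonneg H.L_nonneg hC0
  have e5 : ∀ p q p' q' : ℝ, p * q - p' * q' = (p - p') * q + p' * (q - q') := fun _ _ _ _ => by ring
  rw [e5]
  refine (abs_add_le _ _).trans ?_
  rw [abs_mul, abs_mul]
  have e6 := mul_le_mul e1 e3 (abs_nonneg _) hLC
  have e7 := mul_le_mul e4 e2 (abs_nonneg _) H.K_nonneg
  linarith

variable [mΩ : MeasurableSpace Ω] {P : Measure Ω}
    {F : ℝ → MeasurableSpace Ω} {B : ℝ → Ω → Fin d → ℝ}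

theorem _root_.IsWeakSol.ae_eq_zero_time (hS : IsWeakSol T x₀ A σ lam P F B X α) (hT : 0 < T) :
    X 0 =ᵐ[P] fun _ => x₀ := by
  have h1 : ∀ i, ∀ᵐ ω ∂P, X 0 ω i - x₀ i - ∫ r in Ioc (0 : ℝ) 0, driftAlong σ lam X α r ω i = 0 := by
    intro i
    have e1 := hS.sde i 0 ⟨le_rfl, hT.le⟩
    rw [riemannSum_zero_time] at e1
    have e2 : TendstoInMeasure P (0 : ℕ → Ω → ℝ) atTop (fun _ => (0 : ℝ)) := by
      intro ε hε
      simp [hε.not_ge]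
    exact tendstoInMeasure_ae_unique e1 e2
  filter_upwards [ae_all_iff.2 h1] with ω hω
  ext i
  have := hω i
  simp only [Ioc_self, Measure.restrict_empty, integral_zero_measure, sub_zero] at this
  linarith

variable [IsProbabilityMeasure P]

theorem exists_approx_of_block (H : GirsanovCoeff T A σ lam K L)
    (hS : IsWeakSol T x₀ A σ lam P F B X α) {G : ℝ → MeasurableSpace Ω}
    (hG : ∀ s u, s ≤ u → G s ≤ G u) (hGF : ∀ s, G s ≤ F s)
    (hBG : ∀ s, 0 ≤ s → Measurable[G s] (B s)) (ha : 0 ≤ a) (hab : a < b)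
    (hbT : b ≤ T) (hXa : ∀ t ∈ Icc 0 a, Measurable[G t] (X t)) (hα' : ClampedProg G α')
    (hαα : ∀ r ∈ Ioc a b, ∀ ω, α r ω = α' r ω)
    (hsmall : picardFactor n d (b - a) * lipFactor d K L ≤ 2⁻¹) :
    ∃ ρ : NNReal, ∀ k : ℕ, ∃ Y : ℝ → Ω → Fin n → ℝ, (∀ t, 0 ≤ t → Measurable[G t] (Y t)) ∧
      ∃ V : Ω → ENNReal, Measurable V ∧
        (∀ ω, ∀ r ∈ Icc 0 b, ∀ i, ‖X r ω i - Y r ω i‖ₑ ^ 2 ≤ V ω) ∧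
        ∫⁻ ω, V ω ∂P ≤ ((3 / 4 : NNReal) ^ k * ρ : NNReal) := by
  have h0 := H.exists_picard_step hS (Y := fun _ _ => 0) hG hGF hBG ha hab hbT hXa hα'
    (fun t ht => measurable_const)
    (W := fun _ => ENNReal.ofReal ((K + K) + (d * (K * K) + d * (K * K))) ^ 2) measurable_const
    (fun r hr ω i j => ?_) (fun r hr ω i => ?_) one_pos
  rotate_left
  · rw [Real.enorm_eq_ofReal_abs]
    gcongr
    have e1 := H.σ_bdd r (fun u => X u ω) i j
    have e2 := H.σ_bdd r (fun _ => 0) i j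
    have e3 : 0 ≤ (d : ℝ) * (K * K) := by have := H.K_nonneg; positivity
    exact (abs_sub _ _).trans (by simp only [diffRow]; linarith)
  · rw [Real.enorm_eq_ofReal_abs]
    gcongr
    have e1 := H.abs_driftAlong_le (Y := X) (α := α) r ω i
    have e2 := H.abs_driftAlong_le (Y := fun _ _ => 0) (α := α') r ω i
    have e3 := H.K_nonneg
    exact (abs_sub _ _).trans (by linarith)
  obtain ⟨Y, hY, V, mV, hV, hV2⟩ := h0
  have hfin : picardFactor n d (b - a) ≠ ⊤ := by
    unfold picardFactor
    finiteness
  have hfin2 : ∫⁻ ω, V ω ∂P ≠ ⊤ := by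
    refine ne_top_of_le_ne_top ?_ hV2
    rw [lintegral_const, measure_univ]
    finiteness
  obtain ⟨ρ, hρ, hρV⟩ : ∃ ρ : NNReal, 0 < ρ ∧ ∫⁻ ω, V ω ∂P ≤ ρ := by
    refine ⟨(∫⁻ ω, V ω ∂P).toNNReal + 1, by positivity, ?_⟩
    rw [ENNReal.coe_add, ENNReal.coe_toNNReal hfin2]
    exact le_self_add
  refine ⟨ρ, fun k => ?_⟩
  induction k with
  | zero => exact ⟨Y, hY, V, mV, hV, by simpa using hρV⟩
  | succ k ih =>
    obtain ⟨Y, hY, V, mV, hV, hV2⟩ := ih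
    set ρ' : NNReal := (3 / 4) ^ k * ρ with hρ'
    have hpos : 0 < ρ' := by positivity
    have hsub : ∀ r ∈ Ioc a b, ∀ ω, ∀ u ∈ Icc 0 r, ∀ i, ‖X u ω i - Y u ω i‖ₑ ^ 2 ≤ V ω :=
      fun r hr ω u hu i => hV ω u ⟨hu.1, hu.2.trans hr.2⟩ i
    obtain ⟨Y', hY', V', mV', hV', hV2'⟩ := H.exists_picard_step hS hG hGF hBG ha hab hbT hXa hα' hY
      (mV.const_mul (lipFactor d K L))
      (fun r hr ω i j => H.enorm_diffRow_sub_sq_le (ha.trans hr.1.le) (hsub r hr ω) i j)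
      (fun r hr ω i => H.enorm_driftAlong_sub_sq_le (ha.trans hr.1.le) (hsub r hr ω)
        (hαα r hr ω) i) (ε := ((4⁻¹ * ρ' : NNReal) : ENNReal)) (by positivity)
    refine ⟨Y', hY', V', mV', hV', hV2'.trans ?_⟩
    rw [lintegral_const_mul _ mV, ← mul_assoc]
    calc _ ≤ 2⁻¹ * (ρ' : ENNReal) + ((4⁻¹ * ρ' : NNReal) : ENNReal) := by gcongr
      _ = ((2⁻¹ * ρ' + 4⁻¹ * ρ' : NNReal) : ENNReal) := by
          have : (2⁻¹ : ENNReal) = ((2⁻¹ : NNReal) : ENNReal) := by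
            rw [ENNReal.coe_inv (by norm_num)]
            norm_num
          rw [this, ENNReal.coe_add, ENNReal.coe_mul 2⁻¹]
      _ = _ := by
          rw [hρ', ← add_mul, pow_succ]
          congr 1
          ext
          push_cast
          ring

theorem adapted_of_block (H : GirsanovCoeff T A σ lam K L)
    (hS : IsWeakSol T x₀ A σ lam P F B X α) (ha : 0 ≤ a) (hab : a < b)
    (hbT : b ≤ T) (hXa : ∀ t ∈ Icc 0 a, Measurable[augFilt P B t] (X t))
    {ξ : Ω → Fin m → ℝ} (hξ : Measurable[augFilt P B a] ξ) (hξ' : Measurable[F a] ξ)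
    (hα : ∀ r ∈ Ioc a b, ∀ ω, α r ω = ξ ω)
    (hsmall : picardFactor n d (b - a) * lipFactor d K L ≤ 2⁻¹) :
    ∀ t ∈ Icc 0 b, Measurable[augFilt P B t] (X t) := by
  have hα' : ClampedProg (bmTrace P F B) (fun r ω => if a < r then ξ ω else 0) := by
    intro t ht
    by_cases hat : a < t
    · have h1 : Measurable[bmTrace P F B t] ξ :=
        (measurable_inf_iff.2 ⟨hξ', hξ⟩ : Measurable[bmTrace P F B a] ξ).mono
          (bmTrace_mono hS.bm _ _ hat.le) le_rfl
      let _ := bmTrace P F B t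
      have hc : Measurable (fun q : ℝ × Ω => max 0 (min q.1 t)) := by fun_prop
      exact Measurable.ite (hc measurableSet_Ioi) (h1.comp measurable_snd) measurable_const
    · let _ := bmTrace P F B t
      have h2 : (fun q : ℝ × Ω => if a < max 0 (min q.1 t) then ξ q.2 else 0) = fun _ => 0 := by
        ext1 q
        exact if_neg fun h => hat (h.trans_le (max_le ht (min_le_right _ _)))
      simp only [h2]
      exact measurable_const
  obtain ⟨ρ, hρ⟩ := H.exists_approx_of_block hS (bmTrace_mono hS.bm) bmTrace_le
    (fun s hs => measurable_inf_iff.2 ⟨hS.bm.bm.2.2.1 s hs, measurable_augFilt B hs le_rfl⟩) ha hab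
    hbT (fun t ht => measurable_inf_iff.2 ⟨hS.adapted t ht.1, hXa t ht⟩) hα'
    (fun r hr ω => by rw [hα r hr ω, if_pos hr.1]) hsmall
  choose Y hY V mV hV hV2 using hρ
  have hsum : ∫⁻ ω, ∑' k, V k ω ∂P ≠ ⊤ := by
    rw [lintegral_tsum fun k => (mV k).aemeasurable]
    refine ne_top_of_le_ne_top ?_ (ENNReal.tsum_le_tsum hV2)
    rw [ENNReal.tsum_coe_ne_top_iff_summable]
    exact (NNReal.summable_geometric (by rw [div_lt_one] <;> norm_num)).mul_right _
  have hae : ∀ᵐ ω ∂P, Tendsto (fun k => V k ω) atTop (nhds 0) := by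
    filter_upwards [ae_lt_top (Measurable.tsum mV) hsum] with ω hω
    exact ENNReal.tendsto_atTop_zero_of_tsum_ne_top hω.ne
  intro t ht
  refine measurable_of_tendsto_ae_of_null (fun s hs => measurableSet_augFilt_of_null B t hs)
    (f := fun k => Y k t) (fun k => (measurable_inf_iff.1 (hY k t ht.1)).2) ?_
  filter_upwards [hae] with ω hω
  refine tendsto_pi_nhds.2 fun i => ?_
  have h1 : Tendsto (fun k => ‖X t ω i - Y k t ω i‖ₑ ^ 2) atTop (nhds 0) :=
    tendsto_of_tendsto_of_tendsto_of_le_of_le tendsto_const_nhds hω (fun _ => zero_le)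
      fun k => hV k ω t ht i
  have h2 := ENNReal.tendsto_zero_of_tendsto_sq_zero h1
  rw [tendsto_iff_edist_tendsto_0]
  refine h2.congr fun k => ?_
  rw [edist_comm, edist_eq_enorm_sub]

/-- If the control is frozen on each cell of a fine grid, at a value that is known to the Brownian
filtration as soon as the state is, then the state is adapted to the Brownian filtration. -/
theorem adapted_of_piecewise (H : GirsanovCoeff T A σ lam K L)
    (hS : IsWeakSol T x₀ A σ lam P F B X α) {δ : ℝ} (hδ : 0 < δ)
    (hsmall : picardFactor n d δ * lipFactor d K L ≤ 2⁻¹) {N : ℕ} (hN : N * δ ≤ T)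
    (hα : ∀ i : ℕ, i < N → (∀ t ∈ Icc 0 (i * δ), Measurable[augFilt P B t] (X t)) →
      ∃ ξ : Ω → Fin m → ℝ, Measurable[augFilt P B (i * δ)] ξ ∧ Measurable[F (i * δ)] ξ ∧
        ∀ r ∈ Ioc (i * δ) ((i + 1) * δ), ∀ ω, α r ω = ξ ω) :
    ∀ k : ℕ, k ≤ N → ∀ t ∈ Icc 0 (k * δ), Measurable[augFilt P B t] (X t) := by
  intro k
  induction k with
  | zero =>
    intro _ t ht
    have h0 : t = 0 := by simpa using ht
    subst h0
    exact measurable_of_ae_eq_of_null (fun s hs => measurableSet_augFilt_of_null B _ hs)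
      measurable_const (hS.ae_eq_zero_time H.T_pos)
  | succ k ih =>
    intro hk
    have h1 := ih (by omega)
    obtain ⟨ξ, hξ, hξ', hξα⟩ := hα k (by omega) h1
    have hkN : ((k + 1 : ℕ) : ℝ) * δ ≤ T :=
      (mul_le_mul_of_nonneg_right (by exact_mod_cast hk) hδ.le).trans hN
    push_cast at hkN ⊢
    refine H.adapted_of_block hS (by positivity) (by linarith) hkN h1 hξ hξ' hξα ?_
    have : ((k : ℝ) + 1) * δ - k * δ = δ := by ring
    rwa [this]

end GirsanovCoeff
end

theorem tendstoInMeasure_pi_iff {Ω ι κ : Type*} [Fintype κ] [MeasurableSpace Ω] {P : Measure Ω}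
    {l : Filter ι} {f : ι → Ω → κ → ℝ} {g : Ω → κ → ℝ} :
    TendstoInMeasure P f l g ↔
      ∀ i, TendstoInMeasure P (fun N ω => f N ω i) l (fun ω => g ω i) := by
  refine ⟨fun h i ε hε => ?_, fun h ε hε => ?_⟩
  · refine tendsto_of_tendsto_of_tendsto_of_le_of_le tendsto_const_nhds (h ε hε)
      (fun _ => zero_le) fun N => measure_mono fun ω hω => ?_
    exact le_trans (show ε ≤ _ from hω) (edist_le_pi_edist _ _ i)
  · have h1 : Tendsto (fun N => ∑ i, P {ω | ε ≤ edist (f N ω i) (g ω i)}) l (nhds 0) := by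
      have := tendsto_finsetSum (Finset.univ : Finset κ) fun i _ => h i ε hε
      simpa using this
    refine tendsto_of_tendsto_of_tendsto_of_le_of_le tendsto_const_nhds h1
      (fun _ => zero_le) fun N => ?_
    refine (measure_mono fun ω hω => ?_).trans (measure_biUnion_finset_le _ _)
    by_contra hn
    simp only [Finset.mem_univ, iUnion_true, mem_iUnion, mem_ofPred_eq, not_exists, not_le] at hn
    have h2 : edist (f N ω) (g ω) < ε := by
      rw [edist_pi_def, Finset.sup_lt_iff hε]
      exact fun i _ => hn i
    exact absurd (show ε ≤ _ from hω) (not_le.2 h2)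

section
variable {Ω : Type*} {n d m : ℕ} {T : ℝ} {x₀ : Fin n → ℝ} {A : Set (Fin m → ℝ)}
    {σ : ℝ → (ℝ → Fin n → ℝ) → Matrix (Fin n) (Fin d) ℝ}
    {lam : ℝ → (ℝ → Fin n → ℝ) → (Fin m → ℝ) → Fin d → ℝ} {K L : ℝ}
    {X : ℝ → Ω → Fin n → ℝ} {α : ℝ → Ω → Fin m → ℝ}

theorem itoRiemannSum_apply (B : ℝ → Ω → Fin d → ℝ) (s : ℝ) (N : ℕ) (ω : Ω) (i : Fin n) :
    itoRiemannSum (fun s ω => σ s (fun u => X u ω)) B s N ω i = riemannSum (diffRow σ X i) B s N ω := by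
  simp only [itoRiemannSum, riemannSum, diffRow, Finset.sum_apply, mulVec, dotProduct, Pi.sub_apply]

variable [mΩ : MeasurableSpace Ω] {P : Measure Ω}
    {F : ℝ → MeasurableSpace Ω} {B : ℝ → Ω → Fin d → ℝ}

theorem GirsanovCoeff.integral_mulVec_apply (H : GirsanovCoeff T A σ lam K L)
    (hB : IsFilteredBM P F B) (hX : ClampedProg F X) (hα : ClampedProg F α) (s : ℝ) (ω : Ω)
    (i : Fin n) :
    (∫ r in Icc (0 : ℝ) s, (σ r (fun u => X u ω)).mulVec (lam r (fun u => X u ω) (α r ω))) i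
      = ∫ r in Ioc 0 s, driftAlong σ lam X α r ω i := by
  have h1 := (H.clampedProg_driftAlong hB.mono (fun t ht => hX.measurable_apply ht)
    hα).bddProg_timeTrunc (H.abs_driftAlong_le) s
  have h2 : ∀ i, IntegrableOn (fun r => driftAlong σ lam X α r ω i) (Ioc 0 s) := fun i =>
    (integrableOn_congr_fun (fun r hr => by simp only [timeTrunc, if_pos hr]) measurableSet_Ioc).1
      (h1.integrableOn hB.le ω i 0 s)
  rw [integral_Icc_eq_integral_Ioc]
  exact eval_integral h2 i

theorem GirsanovCoeff.isItoIntegralOn_iff (H : GirsanovCoeff T A σ lam K L)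
    (hB : IsFilteredBM P F B) (hX : ClampedProg F X) (hα : ClampedProg F α) :
    IsItoIntegralOn P T (fun s ω => σ s (fun u => X u ω)) B (fun s ω => X s ω - x₀ -
      ∫ r in Icc (0 : ℝ) s, (σ r (fun u => X u ω)).mulVec (lam r (fun u => X u ω) (α r ω))) ↔
    ∀ i, ∀ s ∈ Icc 0 T, TendstoInMeasure P (riemannSum (diffRow σ X i) B s) atTop
      (fun ω => X s ω i - x₀ i - ∫ r in Ioc 0 s, driftAlong σ lam X α r ω i) := by
  simp only [IsItoIntegralOn, tendstoInMeasure_pi_iff, Pi.sub_apply, itoRiemannSum_apply,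
    H.integral_mulVec_apply hB hX hα]
  exact ⟨fun h i s hs => h s hs i, fun h s hs i => h i s hs⟩

end

section
variable {n d m : ℕ} {T : ℝ} {x₀ : Fin n → ℝ} {A : Set (Fin m → ℝ)}
    {σ : ℝ → (ℝ → Fin n → ℝ) → Matrix (Fin n) (Fin d) ℝ}
    {lam : ℝ → (ℝ → Fin n → ℝ) → (Fin m → ℝ) → Fin d → ℝ} {K L : ℝ}

theorem GirsanovCoeff.isWeakSol (H : GirsanovCoeff T A σ lam K L)
    (S : SDEWeakSol T x₀ A (fun s x a => (σ s x).mulVec (lam s x a)) (fun s x _ => σ s x)) :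
    IsWeakSol T x₀ A σ lam S.P S.F S.B S.X S.α where
  bm := ⟨S.F_mono, S.F_le, S.hB⟩
  cont := S.X_cont
  X_prog := progMeas_iff_clampedProg.1 S.X_prog
  α_prog := progMeas_iff_clampedProg.1 S.α_prog
  α_mem := S.α_mem
  sde := (H.isItoIntegralOn_iff ⟨S.F_mono, S.F_le, S.hB⟩ (progMeas_iff_clampedProg.1 S.X_prog)
    (progMeas_iff_clampedProg.1 S.α_prog)).1 S.sde

/-- The weak solution with given components. -/
def IsWeakSol.toSDEWeakSol {Ω : Type} [mΩ : MeasurableSpace Ω] {P : Measure Ω}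
    {F : ℝ → MeasurableSpace Ω} {B : ℝ → Ω → Fin d → ℝ} {X : ℝ → Ω → Fin n → ℝ}
    {α : ℝ → Ω → Fin m → ℝ} (hS : IsWeakSol T x₀ A σ lam P F B X α)
    (H : GirsanovCoeff T A σ lam K L) (hP : IsProbabilityMeasure P) :
    SDEWeakSol T x₀ A (fun s x a => (σ s x).mulVec (lam s x a)) (fun s x _ => σ s x) where
  Ω := Ω
  mΩ := mΩ
  P := P
  hP := hP
  F := F
  F_mono := hS.bm.mono
  F_le := hS.bm.le
  B := B
  X := X
  α := α
  hB := hS.bm.bm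
  X_cont := hS.cont
  X_prog := progMeas_iff_clampedProg.2 hS.X_prog
  α_prog := progMeas_iff_clampedProg.2 hS.α_prog
  α_mem := hS.α_mem
  sde := (H.isItoIntegralOn_iff hS.bm hS.X_prog hS.α_prog).2 hS.sde

end

/-- Measurable selection of almost nearest points. -/
theorem exists_measurable_almost_nearest {E Y : Type*} [TopologicalSpace E]
    [SecondCountableTopology E] [MeasurableSpace E] [PseudoMetricSpace Y] [MeasurableSpace Y]
    [OpensMeasurableSpace Y] {f : E → Y} (hf : Continuous f) {A : Set E} (hA : A.Nonempty) {ε : ℝ}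
    (hε : 0 < ε) : ∃ φ : Y → E, Measurable φ ∧ (∀ c, φ c ∈ A) ∧
      ∀ c, ∀ a ∈ A, dist (f (φ c)) c ≤ dist (f a) c + ε := by
  have _ := hA.to_subtype
  let u := TopologicalSpace.denseSeq A
  have hex : ∀ c : Y, ∃ N, dist (f (u N)) c < Metric.infDist c (f '' A) + ε := fun c => by
    obtain ⟨_, ⟨a, ha, rfl⟩, hlt⟩ := (Metric.infDist_lt_iff (hA.image f)).1
      (lt_add_of_pos_right (Metric.infDist c (f '' A)) hε)
    have hopen : IsOpen {x : A | dist (f x) c < Metric.infDist c (f '' A) + ε} :=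
      isOpen_lt (by fun_prop) continuous_const
    obtain ⟨N, hN⟩ := (TopologicalSpace.denseRange_denseSeq A).exists_mem_open hopen
      ⟨⟨a, ha⟩, by simpa [dist_comm] using hlt⟩
    exact ⟨N, hN⟩
  refine ⟨fun c => u (Nat.find (hex c)), ?_, fun c => (u _).2, fun c a ha => ?_⟩
  · refine (Measurable.of_discrete (f := fun N => (u N : E))).comp
      (measurable_find hex fun N => ?_)
    exact (isOpen_lt (continuous_const.dist continuous_id)
      ((Metric.continuous_infDist_pt _).add continuous_const)).measurableSet
  · refine (Nat.find_spec (hex c)).le.trans ?_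
    have := Metric.infDist_le_dist_of_mem (x := c) (mem_image_of_mem f ha)
    rw [dist_comm] at this
    linarith

theorem clampedProg_gridStep {Ω : Type*} {d : ℕ} {G : ℝ → MeasurableSpace Ω}
    (hG : ∀ s u, s ≤ u → G s ≤ G u) {δ : ℝ} (hδ : 0 < δ) {N : ℕ} {ψ : ℕ → Ω → Fin d → ℝ}
    (hψ : ∀ i : ℕ, i < N → Measurable[G (i * δ)] (ψ i)) : ClampedProg G (gridStep δ N ψ) := by
  intro t ht
  have h1 : ∀ i : ℕ, Measurable[G t] (if i < N ∧ (i : ℝ) * δ ≤ t then ψ i else 0) := fun i => by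
    split_ifs with h
    · exact (hψ i h.1).mono (hG _ _ h.2) le_rfl
    · exact measurable_const
  let _ := G t
  have hc : Measurable (fun q : ℝ × Ω => (max 0 (min q.1 t), q.2)) := by fun_prop
  refine (congrArg _ ?_).mp ((measurable_gridStep δ N h1).comp hc)
  ext1 q
  have hqt : max 0 (min q.1 t) ≤ t := max_le ht (min_le_right _ _)
  simp only [Function.comp_apply, gridStep]
  split_ifs with hq h2
  · rfl
  · refine absurd ⟨(cellIdx_lt_iff hδ hq.1).2 hq.2, ?_⟩ h2
    exact (((mem_cell_iff hδ).2 ⟨hq.1, rfl⟩).1.le).trans hqt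
  · rfl

theorem ClampedProg.comp_measurable {Ω E E' : Type*} [MeasurableSpace E] [MeasurableSpace E']
    {F : ℝ → MeasurableSpace Ω} {u : ℝ → Ω → E} (hu : ClampedProg F u) {φ : E → E'}
    (hφ : Measurable φ) : ClampedProg F (fun r ω => φ (u r ω)) :=
  fun t ht => hφ.comp (hu t ht)

section
variable {Ω : Type*} [mΩ : MeasurableSpace Ω] {d : ℕ} {P : Measure Ω} [IsProbabilityMeasure P]
  {F : ℝ → MeasurableSpace Ω} {B : ℝ → Ω → Fin d → ℝ} {C T : ℝ} {h : ℕ → ℝ → Ω → Fin d → ℝ}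
  {J : ℕ → Ω → ℝ}

theorem tendsto_integral_sq_of_tendsto_eLpNorm (hF : ∀ s, F s ≤ mΩ)
    (hh : ∀ k, BddProg F C T (h k))
    (hlim : Tendsto (fun k => eLpNorm (toEuclid (h k)) 2 ((volume : Measure ℝ).prod P)) atTop
      (nhds 0)) :
    Tendsto (fun k => eLpNorm (fun ω => ∫ r in Ioc 0 T, ∑ j, h k r ω j ^ 2) 1 P) atTop
      (nhds 0) := by
  have h1 := ENNReal.Tendsto.pow (n := 2) hlim
  simp only [eLpNorm_two_sq, ne_eq, OfNat.ofNat_ne_zero, not_false_eq_true, zero_pow] at h1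
  refine tendsto_of_tendsto_of_tendsto_of_le_of_le tendsto_const_nhds h1 (fun _ => zero_le)
    fun k => ?_
  have hm : Measurable fun q => ‖toEuclid (h k) q‖ₑ ^ 2 :=
    ((hh k).measurable_toEuclid hF).enorm.pow_const 2
  show eLpNorm _ 1 P ≤ ∫⁻ q, ‖toEuclid (h k) q‖ₑ ^ 2 ∂((volume : Measure ℝ).prod P)
  rw [lintegral_prod_symm _ hm.aemeasurable, eLpNorm_one_eq_lintegral_enorm]
  refine lintegral_mono fun ω => (enorm_integral_le_lintegral_enorm _).trans
    ((setLIntegral_le_lintegral _ _).trans (lintegral_mono fun r => ?_))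
  rw [enorm_toEuclid_sq]
  refine (enorm_sum_le _ _).trans (Finset.sum_le_sum fun j _ => ?_)
  rw [enorm_pow]

theorem tendsto_stochExp_one (hB : IsFilteredBM P F B) (hT : 0 < T)
    (hh : ∀ k, BddProg F C T (h k)) (mJ : ∀ k, Measurable (J k))
    (hJ : ∀ k, IsIto P F B (toEuclid (h k)) (J k))
    (hlim : Tendsto (fun k => eLpNorm (toEuclid (h k)) 2 ((volume : Measure ℝ).prod P)) atTop
      (nhds 0)) :
    Tendsto (fun k => eLpNorm (stochExp T (h k) (J k) - fun _ => 1) 1 P) atTop (nhds 0) := by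
  have hQ := tendsto_integral_sq_of_tendsto_eLpNorm hB.le hh hlim
  have mQ : ∀ k, AEStronglyMeasurable (fun ω => ∫ r in Ioc 0 T, ∑ j, h k r ω j ^ 2) P := fun k => by
    have h1 : Measurable (fun q : ℝ × Ω => ∑ j, h k q.1 q.2 j ^ 2) := by
      have := (hh k).measurable_uncurry hB.le
      fun_prop
    exact (measurable_setIntegral_left h1 _).aestronglyMeasurable
  have h1 : TendstoInMeasure P J atTop 0 :=
    tendstoInMeasure_of_tendsto_eLpNorm (p := 2) (by norm_num)
      (fun k => (mJ k).aestronglyMeasurable) aestronglyMeasurable_zero (by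
        refine hlim.congr fun k => ?_
        rw [sub_zero, (hJ k).eLpNorm_eq hB])
  have h2 : TendstoInMeasure P (fun k ω => ∫ r in Ioc 0 T, ∑ j, h k r ω j ^ 2) atTop 0 :=
    tendstoInMeasure_of_tendsto_eLpNorm (p := 1) (by norm_num) mQ aestronglyMeasurable_zero (by
        simpa only [sub_zero] using hQ)
  have h3 := h1.map_prod h2 (fun k => (mJ k).aestronglyMeasurable) mQ
    (φ := fun p : ℝ × ℝ => Real.exp (p.1 - p.2 / 2)) (by fun_prop)
  simp only [Pi.zero_apply, zero_div, sub_zero, Real.exp_zero] at h3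
  exact (tendsto_eLpNorm_one_of_tendstoInMeasure
    (fun k => ((hh k).measurable_stochExp hB.le (mJ k)).aestronglyMeasurable)
    (fun k => ((hh k).eLpNorm_stochExp_le hB hT (hJ k)).1) h3).2

/-- Expectations of bounded functions converge when densities converge in `L¹`. -/
theorem tendsto_integral_withDensity_one {Z : ℕ → Ω → ℝ} (mZ : ∀ k, Measurable (Z k))
    (hZ : ∀ k ω, 0 < Z k ω)
    (hlim : Tendsto (fun k => eLpNorm (Z k - fun _ => 1) 1 P) atTop (nhds 0))
    {f : Ω → ℝ} {M : ℝ} (hf : ∀ ω, |f ω| ≤ M) :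
    Tendsto (fun k => ∫ ω, f ω ∂(P.withDensity fun ω => ENNReal.ofReal (Z k ω))) atTop
      (nhds (∫ ω, f ω ∂P)) := by
  have e : ∀ k, ∫ ω, f ω ∂(P.withDensity fun ω => ENNReal.ofReal (Z k ω))
      = ∫ ω, Z k ω * f ω ∂P := fun k => by
    have := integral_withDensity_eq_integral_smul (μ := P) (mZ k).real_toNNReal f
    refine this.trans (integral_congr_ae (ae_of_all _ fun ω => ?_))
    simp [NNReal.smul_def, (hZ k ω).le]
  simp_rw [e]
  by_cases mf : AEStronglyMeasurable f P
  swap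
  · have h0 : ∀ k, ∫ ω, Z k ω * f ω ∂P = 0 := fun k => integral_undef fun hi => mf <| by
      refine (((mZ k).inv.aestronglyMeasurable).mul hi.1).congr (ae_of_all _ fun ω => ?_)
      exact inv_mul_cancel_left₀ (hZ k ω).ne' _
    simp_rw [h0, integral_undef fun hi : Integrable f P => mf hi.1]
    exact tendsto_const_nhds
  refine tendsto_integral_of_L1' _ mf ?_ ?_
  · have h1 : ∀ᶠ k in atTop, eLpNorm (Z k - fun _ => 1) 1 P < 1 :=
      hlim.eventually_lt_const one_pos
    filter_upwards [h1] with k hk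
    have h2 : MemLp (Z k - fun _ => 1) 1 P :=
      ⟨((mZ k).sub measurable_const).aestronglyMeasurable, hk.trans ENNReal.one_lt_top⟩
    have h3 : Integrable (Z k) P := by
      have := (memLp_one_iff_integrable.1 h2).add (integrable_const 1)
      refine this.congr (ae_of_all _ fun ω => by simp)
    exact h3.mul_bdd mf (ae_of_all _ hf)
  · have h1 : Tendsto (fun k => ENNReal.ofReal M * eLpNorm (Z k - fun _ => 1) 1 P) atTop
        (nhds 0) := by
      simpa using ENNReal.Tendsto.const_mul hlim (Or.inr ENNReal.ofReal_ne_top)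
    refine tendsto_of_tendsto_of_tendsto_of_le_of_le tendsto_const_nhds h1 (fun _ => zero_le)
      fun k => ?_
    refine eLpNorm_le_nnreal_smul_eLpNorm_of_ae_le_mul (c := M.toNNReal)
      (ae_of_all _ fun ω => ?_) 1
    simp only [Pi.sub_apply]
    rw [← NNReal.coe_le_coe]
    have hM : 0 ≤ M := (abs_nonneg _).trans (hf ω)
    have h3 : Z k ω * f ω - f ω = f ω * (Z k ω - 1) := by ring
    simp only [coe_nnnorm, NNReal.coe_mul, Real.coe_toNNReal _ hM, Real.norm_eq_abs]
    rw [h3, abs_mul]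
    exact mul_le_mul_of_nonneg_right (hf ω) (abs_nonneg _)

end

theorem tendsto_picardFactor (n d : ℕ) (T : ℝ) :
    Tendsto (fun k : ℕ => picardFactor n d (T / (k + 1))) atTop (nhds 0) := by
  have h1 : Tendsto (fun k : ℕ => T / ((k : ℝ) + 1)) atTop (nhds 0) :=
    tendsto_const_nhds.div_atTop (tendsto_natCast_atTop_atTop.atTop_add tendsto_const_nhds)
  have h2 : Tendsto (fun k : ℕ => ENNReal.ofReal (T / ((k : ℝ) + 1))) atTop (nhds 0) := by
    simpa using ENNReal.tendsto_ofReal h1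
  have h3 := (ENNReal.Tendsto.const_mul (a := 2) (ENNReal.Tendsto.pow (n := 2) h2)
    (Or.inr (by simp))).add (ENNReal.Tendsto.const_mul (a := 16 * n)
    (ENNReal.Tendsto.mul_const (b := d) h2 (Or.inr (by simp))) (Or.inr (by finiteness)))
  simpa [picardFactor] using h3

/-- The bounded process `arctan α`, restricted to `(0, T]`. -/
def arctanTrunc {Ω : Type*} {m : ℕ} (T : ℝ) (α : ℝ → Ω → Fin m → ℝ) : ℝ → Ω → Fin m → ℝ :=
  timeTrunc T fun r ω j => Real.arctan (α r ω j)

/-- The piecewise constant control obtained by applying `φ` to the averages of `arctan α` over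
preceding grid cells. -/
def stepControl {Ω : Type*} {m : ℕ} (T : ℝ) (k : ℕ) (φ : (Fin m → ℝ) → Fin m → ℝ)
    (α : ℝ → Ω → Fin m → ℝ) (r : ℝ) (ω : Ω) : Fin m → ℝ :=
  φ (avgStep T k (arctanTrunc T α) r ω)

section
variable {Ω : Type*} {m : ℕ} {T : ℝ} {α : ℝ → Ω → Fin m → ℝ} {φ : (Fin m → ℝ) → Fin m → ℝ}
  {F : ℝ → MeasurableSpace Ω}

theorem ClampedProg.bddProg_arctanTrunc (hα : ClampedProg F α) :
    BddProg F (Real.pi / 2) T (arctanTrunc T α) := by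
  refine ClampedProg.bddProg_timeTrunc
    (hα.comp_measurable (φ := fun a j => Real.arctan (a j)) (by fun_prop)) (fun r ω j => ?_) T
  exact abs_le.2 ⟨(Real.neg_pi_div_two_lt_arctan _).le, (Real.arctan_lt_pi_div_two _).le⟩

theorem clampedProg_stepControl (hT : 0 < T) (hφ : Measurable φ) (k : ℕ)
    (hF : ∀ s u, s ≤ u → F s ≤ F u)
    (h : ∀ i : ℕ, i < k + 1 →
      Measurable[F (i * (T / (k + 1)))] (prevAvg (T / (k + 1)) (arctanTrunc T α) i)) :
    ClampedProg F (stepControl T k φ α) :=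
  (clampedProg_gridStep hF (by positivity) h).comp_measurable hφ

theorem stepControl_eq_of_mem_cell (hT : 0 < T) {k i : ℕ} (hi : i < k + 1) {r : ℝ}
    (hr : r ∈ Ioc (i * (T / (k + 1))) ((i + 1) * (T / (k + 1)))) (ω : Ω) :
    stepControl T k φ α r ω = φ (prevAvg (T / (k + 1)) (arctanTrunc T α) i ω) := by
  have hδ : 0 < T / ((k : ℝ) + 1) := by positivity
  obtain ⟨h0, hc⟩ := (mem_cell_iff hδ).1 hr
  have h1 : r ≤ T := by
    have h2 : r ≤ (k + 1 : ℕ) * (T / ((k : ℝ) + 1)) := (cellIdx_lt_iff hδ h0).1 (hc ▸ hi)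
    refine h2.trans_eq ?_
    push_cast
    field_simp
  rw [stepControl, avgStep_eq_of_mem k _ ⟨h0, h1⟩, hc]

theorem tendsto_of_tendsto_arctan {f : ℕ → Fin m → ℝ} {a : Fin m → ℝ}
    (h : Tendsto (fun k j => Real.arctan (f k j)) atTop (nhds fun j => Real.arctan (a j))) :
    Tendsto f atTop (nhds a) := by
  refine tendsto_pi_nhds.2 fun j => ?_
  have := ((Real.continuousAt_tan.2 (Real.cos_arctan_pos (a j)).ne').tendsto).comp
    (tendsto_pi_nhds.1 h j)
  simpa [Function.comp_def, Real.tan_arctan] using this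

theorem ClampedProg.ae_tendsto_stepControl [mΩ : MeasurableSpace Ω] {A : Set (Fin m → ℝ)}
    (hα : ClampedProg F α) (hF : ∀ s, F s ≤ mΩ) (hT : 0 < T) (hmem : ∀ s ω, α s ω ∈ A)
    {φ : ℕ → (Fin m → ℝ) → Fin m → ℝ}
    (hφ : ∀ k : ℕ, ∀ c, ∀ a ∈ A, dist (fun j => Real.arctan (φ k c j)) c
      ≤ dist (fun j => Real.arctan (a j)) c + 1 / ((k : ℝ) + 1)) (ω : Ω) :
    ∀ᵐ r : ℝ, r ∈ Ioc 0 T →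
      Tendsto (fun k => stepControl T k (φ k) α r ω) atTop (nhds (α r ω)) := by
  filter_upwards [(hα.bddProg_arctanTrunc (T := T)).ae_tendsto_avgStep hF hT ω] with r hr hrT
  refine tendsto_of_tendsto_arctan ?_
  have e : arctanTrunc T α r ω = fun j => Real.arctan (α r ω j) := if_pos hrT
  rw [e] at hr
  have h1 : Tendsto (fun k => dist (fun j => Real.arctan (α r ω j))
      (avgStep T k (arctanTrunc T α) r ω) + 1 / ((k : ℝ) + 1)) atTop (nhds 0) := by
    have := ((tendsto_const_nhds (x := fun j => Real.arctan (α r ω j))).dist hr).add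
      tendsto_one_div_add_atTop_nhds_zero_nat
    simpa using this
  have h2 := squeeze_zero (fun _ => dist_nonneg) (fun k =>
    hφ k (avgStep T k (arctanTrunc T α) r ω) _ (hmem r ω)) h1
  exact hr.congr_dist (by simpa only [dist_comm, stepControl] using h2)

end

section
variable {Ω : Type*} {n d m : ℕ} {T : ℝ} {x₀ : Fin n → ℝ} {A : Set (Fin m → ℝ)}
    {σ : ℝ → (ℝ → Fin n → ℝ) → Matrix (Fin n) (Fin d) ℝ}
    {lam : ℝ → (ℝ → Fin n → ℝ) → (Fin m → ℝ) → Fin d → ℝ} {K L : ℝ}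
    {X : ℝ → Ω → Fin n → ℝ} {α : ℝ → Ω → Fin m → ℝ}
    [mΩ : MeasurableSpace Ω] {P : Measure Ω} {F : ℝ → MeasurableSpace Ω} {B : ℝ → Ω → Fin d → ℝ}

theorem GirsanovCoeff.tendsto_controlShift [IsProbabilityMeasure P]
    (H : GirsanovCoeff T A σ lam K L) (hS : IsWeakSol T x₀ A σ lam P F B X α)
    {β : ℕ → ℝ → Ω → Fin m → ℝ} (hβ : ∀ k, ClampedProg F (β k)) (hmem : ∀ k s ω, β k s ω ∈ A)
    (hlim : ∀ ω, ∀ᵐ r : ℝ, r ∈ Ioc 0 T → Tendsto (fun k => β k r ω) atTop (nhds (α r ω))) :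
    Tendsto (fun k => eLpNorm (toEuclid (controlShift T lam X α (β k))) 2
      ((volume : Measure ℝ).prod P)) atTop (nhds 0) := by
  have hθ := fun k => H.bddProg_controlShift hS (hβ k)
  refine tendsto_eLpNorm_prod_zero (C := d * (K + K)) (T := T)
    (fun k => (hθ k).measurable_toEuclid hS.bm.le)
    (fun k q => BddProg.norm_toEuclid_le (hθ k).bdd q)
    (fun k q hq => by rw [toEuclid, (hθ k).supp _ _ hq]; rfl) (ae_of_all _ fun ω => ?_)
  filter_upwards [hlim ω] with r hr
  by_cases hrT : r ∈ Ioc 0 T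
  · have h1 : Tendsto (fun k => β k r ω) atTop (nhdsWithin (α r ω) A) :=
      tendsto_nhdsWithin_iff.2 ⟨hr hrT, Eventually.of_forall fun k => hmem k r ω⟩
    have h2 := ((H.lam_cont r (fun u => X u ω) _ (hS.α_mem r ω)).tendsto.comp h1).sub_const
      (lam r (fun u => X u ω) (α r ω))
    rw [sub_self] at h2
    have h3 := ((PiLp.continuous_toLp 2 fun _ : Fin d => ℝ).tendsto 0).comp h2
    refine h3.congr fun k => ?_
    simp only [toEuclid, controlShift, timeTrunc, if_pos hrT, Function.comp_apply]
  · refine tendsto_const_nhds.congr fun k => ?_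
    rw [toEuclid, (hθ k).supp _ _ hrT]
    rfl

theorem GirsanovCoeff.clampedProg_stepControl_augFilt (H : GirsanovCoeff T A σ lam K L)
    {Q : Measure Ω} [IsProbabilityMeasure Q] {B' : ℝ → Ω → Fin d → ℝ} {k : ℕ} {φ : (Fin m → ℝ) → Fin m → ℝ}
    (hφ : Measurable φ) (hS : IsWeakSol T x₀ A σ lam Q F B' X (stepControl T k φ α))
    (hα : ClampedProg F α) (hαX : ClampedProg (augFilt P X) α) (hQP : Q ≪ P)
    (hsmall : picardFactor n d (T / (k + 1)) * lipFactor d K L ≤ 2⁻¹) :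
    ClampedProg (augFilt Q B') (stepControl T k φ α) := by
  have hδ : 0 < T / ((k : ℝ) + 1) := div_pos H.T_pos (by positivity)
  have hN : ((k + 1 : ℕ) : ℝ) * (T / ((k : ℝ) + 1)) = T := by
    push_cast; field_simp
  have key : ∀ i : ℕ, (∀ t ∈ Icc 0 (i * (T / ((k : ℝ) + 1))), Measurable[augFilt Q B' t] (X t)) →
      Measurable[augFilt Q B' (i * (T / (k + 1)))]
        (prevAvg (T / (k + 1)) (arctanTrunc T α) i) := fun i hX => by
    refine ((hαX.bddProg_arctanTrunc (T := T)).measurable_prevAvg hδ.le i).mono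
      (augFilt_le (fun s hs => measurableSet_augFilt_of_null B' _ (hQP hs)) fun r hr => ?_) le_rfl
    exact (hX r hr).mono (augFilt_mono B' hr.2) le_rfl
  have had := H.adapted_of_piecewise hS hδ hsmall hN.le fun i hi hX =>
    ⟨fun ω => φ (prevAvg (T / (k + 1)) (arctanTrunc T α) i ω), hφ.comp (key i hX),
      hφ.comp ((hα.bddProg_arctanTrunc (T := T)).measurable_prevAvg hδ.le i),
      fun r hr ω => stepControl_eq_of_mem_cell H.T_pos hi hr ω⟩
  exact clampedProg_stepControl H.T_pos hφ k (fun s u hsu => augFilt_mono B' hsu)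
    fun i hi => key i (had i hi.le)

/-- A closed-loop weak solution is approximated by open-loop ones that carry the same state
process under equivalent measures. -/
theorem GirsanovCoeff.exists_openLoop_approx [IsProbabilityMeasure P]
    (H : GirsanovCoeff T A σ lam K L) (hS : IsWeakSol T x₀ A σ lam P F B X α)
    (hαX : ClampedProg (augFilt P X) α) :
    ∃ (Q : ℕ → Measure Ω) (B' : ℕ → ℝ → Ω → Fin d → ℝ) (β : ℕ → ℝ → Ω → Fin m → ℝ),
      (∀ k, IsProbabilityMeasure (Q k)) ∧
      (∀ k, IsWeakSol T x₀ A σ lam (Q k) F (B' k) X (β k)) ∧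
      (∀ᶠ k in atTop, ClampedProg (augFilt (Q k) (B' k)) (β k)) ∧
      ∀ (f : Ω → ℝ) (M : ℝ), (∀ ω, |f ω| ≤ M) →
        Tendsto (fun k => ∫ ω, f ω ∂(Q k)) atTop (nhds (∫ ω, f ω ∂P)) := by
  have hA : A.Nonempty := by
    obtain ⟨ω⟩ : Nonempty Ω := nonempty_of_isProbabilityMeasure P
    exact ⟨_, hS.α_mem 0 ω⟩
  have hcont : Continuous fun (a : Fin m → ℝ) j => Real.arctan (a j) := by fun_prop
  choose φ hφm hφA hφ using fun k : ℕ =>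
    exists_measurable_almost_nearest hcont hA (Nat.one_div_pos_of_nat (α := ℝ) (n := k))
  have hβ : ∀ k, ClampedProg F (stepControl T k (φ k) α) := fun k =>
    clampedProg_stepControl H.T_pos (hφm k) k hS.bm.mono fun i _ =>
      (hS.α_prog.bddProg_arctanTrunc (T := T)).measurable_prevAvg
        (div_nonneg H.T_pos.le (by positivity)) i
  have hmem : ∀ k s ω, stepControl T k (φ k) α s ω ∈ A := fun k s ω => hφA k _
  have hθ := fun k => H.bddProg_controlShift hS (hβ k)
  choose J mJ hJ using fun k => (hθ k).exists_isIto hS.bm H.T_pos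
  have hQ := fun k => (hθ k).isProbabilityMeasure_withDensity hS.bm H.T_pos (hJ k)
  have hW := fun k => H.isWeakSol_changeControl hS (hβ k) (hmem k) (mJ k) (hJ k)
  have mZ := fun k => (hθ k).measurable_stochExp hS.bm.le (mJ k)
  refine ⟨_, _, _, hQ, hW, ?_,
    fun f M hf => ?_⟩
  · have h1 : Tendsto (fun k : ℕ => picardFactor n d (T / (k + 1)) * lipFactor d K L) atTop
        (nhds 0) := by
      simpa using ENNReal.Tendsto.mul_const (b := lipFactor d K L) (tendsto_picardFactor n d T)
        (Or.inr ENNReal.ofReal_ne_top)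
    filter_upwards [h1.eventually_le_const (show (0 : ENNReal) < 2⁻¹ by simp)] with k hk
    have := hQ k
    exact H.clampedProg_stepControl_augFilt (hφm k) (hW k) hS.α_prog hαX
      (withDensity_absolutelyContinuous _ _) hk
  · refine tendsto_integral_withDensity_one mZ (fun k ω => Real.exp_pos _) ?_ hf
    exact tendsto_stochExp_one hS.bm H.T_pos hθ mJ hJ (H.tendsto_controlShift hS hβ hmem fun ω =>
      hS.α_prog.ae_tendsto_stepControl hS.bm.le H.T_pos hS.α_mem hφ ω)

end

/-- A Lipschitz bound for all radii `C`, negative ones included, holds with a nonnegative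
constant. -/
theorem le_max_zero_mul_of_forall {p : ℝ → Prop} (hp : ∀ C C', C ≤ C' → p C → p C') {L z : ℝ}
    (hz : 0 ≤ z) (h : ∀ C, p C → z ≤ L * C) {C : ℝ} (hC : p C) : z ≤ max L 0 * C := by
  rcases le_or_gt 0 C with h0 | h0
  · exact (h C hC).trans (mul_le_mul_of_nonneg_right (le_max_left _ _) h0)
  · have h1 := h C hC
    have h2 := h 1 (hp C 1 (by linarith) hC)
    have h3 : L = 0 := by nlinarith
    rw [h3] at h1 ⊢
    simpa using h1

section
variable {n d m : ℕ} {T : ℝ} {x₀ : Fin n → ℝ} {A : Set (Fin m → ℝ)}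
    {σ : ℝ → (ℝ → Fin n → ℝ) → Matrix (Fin n) (Fin d) ℝ}
    {lam : ℝ → (ℝ → Fin n → ℝ) → (Fin m → ℝ) → Fin d → ℝ} {K L : ℝ}

/-- A weak solution can be turned into a closed-loop one with a constant control. -/
theorem GirsanovCoeff.exists_closedLoop (H : GirsanovCoeff T A σ lam K L)
    (S : SDEWeakSol T x₀ A (fun s x a => (σ s x).mulVec (lam s x a)) (fun s x _ => σ s x)) :
    ∃ S' : SDEWeakSol T x₀ A (fun s x a => (σ s x).mulVec (lam s x a)) (fun s x _ => σ s x),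
      S'.ClosedLoop := by
  have _ := S.hP
  obtain ⟨ω₀⟩ : Nonempty S.Ω := nonempty_of_isProbabilityMeasure S.P
  have hS := H.isWeakSol S
  have hc : ∀ G : ℝ → MeasurableSpace S.Ω, ClampedProg G fun _ _ => S.α 0 ω₀ :=
    fun G => clampedProg_const _
  have hθ := H.bddProg_controlShift hS (hc S.F)
  obtain ⟨J, mJ, hJ⟩ := hθ.exists_isIto hS.bm H.T_pos
  exact ⟨(H.isWeakSol_changeControl hS (hc S.F) (fun _ _ => S.α_mem 0 ω₀) mJ hJ).toSDEWeakSol H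
    (hθ.isProbabilityMeasure_withDensity hS.bm H.T_pos hJ), progMeas_iff_clampedProg.2 (hc _)⟩

theorem GirsanovCoeff.closed_le_open (H : GirsanovCoeff T A σ lam K L)
    {g : (ℝ → Fin n → ℝ) → ℝ} {M : ℝ} (hg : ∀ x, |g x| ≤ M) :
    Vclosed T x₀ A (fun s x a => (σ s x).mulVec (lam s x a)) (fun s x _ => σ s x) g
      ≤ Vopen T x₀ A (fun s x a => (σ s x).mulVec (lam s x a)) (fun s x _ => σ s x) g := by
  have hbdd : BddAbove {r | ∃ S : SDEWeakSol T x₀ A (fun s x a => (σ s x).mulVec (lam s x a))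
      (fun s x _ => σ s x), S.OpenLoop ∧ r = ∫ ω, g (fun s => S.X s ω) ∂S.P} := by
    refine ⟨M, ?_⟩
    rintro _ ⟨S, -, rfl⟩
    have _ := S.hP
    have h1 : ‖∫ ω, g (fun s => S.X s ω) ∂S.P‖ ≤ M * S.P.real univ :=
      norm_integral_le_of_norm_le_const (ae_of_all _ fun ω => hg _)
    simp only [probReal_univ, mul_one] at h1
    exact (le_abs_self _).trans h1
  by_cases hne : ∃ S : SDEWeakSol T x₀ A (fun s x a => (σ s x).mulVec (lam s x a))
      (fun s x _ => σ s x), S.ClosedLoop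
  · obtain ⟨S₀, hS₀⟩ := hne
    refine csSup_le ⟨_, S₀, hS₀, rfl⟩ ?_
    rintro _ ⟨S, hcl, rfl⟩
    have _ := S.hP
    obtain ⟨Q, B', β, hQ, hW, hol, hlim⟩ :=
      H.exists_openLoop_approx (H.isWeakSol S) (progMeas_iff_clampedProg.1 hcl)
    refine le_of_tendsto (hlim (fun ω => g fun s => S.X s ω) M fun ω => hg _) ?_
    filter_upwards [hol] with k hk
    exact le_csSup hbdd ⟨(hW k).toSDEWeakSol H (hQ k), progMeas_iff_clampedProg.2 hk, rfl⟩
  · have hcl : Vclosed T x₀ A (fun s x a => (σ s x).mulVec (lam s x a)) (fun s x _ => σ s x) g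
        = sSup ∅ := congrArg sSup (eq_empty_of_forall_notMem fun r ⟨S, hS, _⟩ => hne ⟨S, hS⟩)
    have hop : Vopen T x₀ A (fun s x a => (σ s x).mulVec (lam s x a)) (fun s x _ => σ s x) g
        = sSup ∅ := congrArg sSup (eq_empty_of_forall_notMem fun r ⟨S, _⟩ =>
      hne (H.exists_closedLoop S))
    rw [hcl, hop]

end

/-- Proposition 3.3. If `σ = σ(t, x)` does not depend on the control and
is uniformly Lipschitz in the path (uniform norm), and `b = σλ` with `λ` bounded,
continuous in `a` and uniformly Lipschitz in the path, then `V^c_0 ≤ V^o_0`. -/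
theorem closed_le_open_of_girsanov_structure
    (n d m : ℕ) (T : ℝ) (hT : 0 < T) (x₀ : Fin n → ℝ) (A : Set (Fin m → ℝ))
    (σ : ℝ → (ℝ → Fin n → ℝ) → Matrix (Fin n) (Fin d) ℝ)
    (lam : ℝ → (ℝ → Fin n → ℝ) → (Fin m → ℝ) → Fin d → ℝ)
    (g : (ℝ → Fin n → ℝ) → ℝ)
    (hσ_bdd : ∃ C : ℝ, ∀ s x i j, |σ s x i j| ≤ C)
    (hσ_meas : Measurable fun p : ℝ × (ℝ → Fin n → ℝ) =>
      (fun i j => σ p.1 p.2 i j : Fin n → Fin d → ℝ))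
    (hσ_adapted : ∀ s x y, (∀ r ∈ Set.Icc (0 : ℝ) s, x r = y r) → σ s x = σ s y)
    (hσ_lip : ∃ L : ℝ, ∀ s x y (C : ℝ),
      (∀ r ∈ Set.Icc (0 : ℝ) T, ∀ i, |x r i - y r i| ≤ C) →
      ∀ i j, |σ s x i j - σ s y i j| ≤ L * C)
    (hlam_bdd : ∃ C : ℝ, ∀ s x a j, |lam s x a j| ≤ C)
    (hlam_meas : Measurable fun p : ℝ × (ℝ → Fin n → ℝ) × (Fin m → ℝ) =>
      lam p.1 p.2.1 p.2.2)
    (hlam_adapted : ∀ s x y a, (∀ r ∈ Set.Icc (0 : ℝ) s, x r = y r) →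
      lam s x a = lam s y a)
    (hlam_cont : ∀ s x, ContinuousOn (fun a => lam s x a) A)
    (hlam_lip : ∃ L : ℝ, ∀ s x y a (C : ℝ),
      (∀ r ∈ Set.Icc (0 : ℝ) T, ∀ i, |x r i - y r i| ≤ C) →
      ∀ j, |lam s x a j - lam s y a j| ≤ L * C)
    (hg_meas : Measurable g) (hg_bdd : ∃ C : ℝ, ∀ x, |g x| ≤ C) :
    Vclosed T x₀ A (fun s x a => (σ s x).mulVec (lam s x a)) (fun s x _ => σ s x) g
      ≤ Vopen T x₀ A (fun s x a => (σ s x).mulVec (lam s x a)) (fun s x _ => σ s x) g := by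
  obtain ⟨C₁, hC₁⟩ := hσ_bdd
  obtain ⟨C₂, hC₂⟩ := hlam_bdd
  obtain ⟨L₁, hL₁⟩ := hσ_lip
  obtain ⟨L₂, hL₂⟩ := hlam_lip
  obtain ⟨M, hM⟩ := hg_bdd
  have hmono : ∀ x y : ℝ → Fin n → ℝ, ∀ C C' : ℝ, C ≤ C' →
      (∀ r ∈ Icc (0 : ℝ) T, ∀ i, |x r i - y r i| ≤ C) →
      ∀ r ∈ Icc (0 : ℝ) T, ∀ i, |x r i - y r i| ≤ C' :=
    fun x y C C' hCC h r hr i => (h r hr i).trans hCC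
  have hlip : ∃ L : ℝ, 0 ≤ L ∧
      (∀ s x y (C : ℝ), (∀ r ∈ Set.Icc (0 : ℝ) T, ∀ i, |x r i - y r i| ≤ C) →
        ∀ i j, |σ s x i j - σ s y i j| ≤ L * C) ∧
      ∀ s x y a (C : ℝ), (∀ r ∈ Set.Icc (0 : ℝ) T, ∀ i, |x r i - y r i| ≤ C) →
        ∀ j, |lam s x a j - lam s y a j| ≤ L * C := by
    rcases isEmpty_or_nonempty (Fin n) with hn | ⟨⟨i₀⟩⟩
    · exact ⟨max L₂ 0, le_max_right _ _, fun _ _ _ _ _ i => hn.elim i, fun s x y a C hC j =>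
        le_max_zero_mul_of_forall (hmono x y) (abs_nonneg _)
          (fun C hC => hL₂ s x y a C hC j) hC⟩
    · have hnonneg : ∀ (x y : ℝ → Fin n → ℝ) (C : ℝ),
          (∀ r ∈ Icc (0 : ℝ) T, ∀ i, |x r i - y r i| ≤ C) → 0 ≤ C := fun x y C hC =>
        (abs_nonneg _).trans (hC 0 ⟨le_rfl, hT.le⟩ i₀)
      refine ⟨max L₁ 0 + max L₂ 0, by positivity, fun s x y C hC i j => ?_,
        fun s x y a C hC j => ?_⟩
      · exact (hL₁ s x y C hC i j).trans (mul_le_mul_of_nonneg_right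
          (le_add_of_le_of_nonneg (le_max_left _ _) (le_max_right _ _)) (hnonneg x y C hC))
      · exact (hL₂ s x y a C hC j).trans (mul_le_mul_of_nonneg_right
          (le_add_of_nonneg_of_le (le_max_right _ _) (le_max_left _ _)) (hnonneg x y C hC))
  obtain ⟨L, hL, hσL, hlamL⟩ := hlip
  have H : GirsanovCoeff T A σ lam (max (max C₁ C₂) 0) L :=
    { T_pos := hT
      L_nonneg := hL
      K_nonneg := le_max_right _ _
      σ_bdd := fun s x i j =>
        (hC₁ s x i j).trans ((le_max_left _ _).trans (le_max_left _ _))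
      σ_meas := hσ_meas
      σ_adapted := hσ_adapted
      σ_lip := hσL
      lam_bdd := fun s x a j =>
        (hC₂ s x a j).trans ((le_max_right _ _).trans (le_max_left _ _))
      lam_meas := hlam_meas
      lam_adapted := hlam_adapted
      lam_cont := hlam_cont
      lam_lip := hlamL }
  exact H.closed_le_open hM

end
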